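/- arXiv:2308.02839 — 3 statements merged into one kernel-verified Lean document; each statement's English description precedes it below -/
import Mathlib

section
/- Let 𝔤 be a finite-dimensional semisimple Lie algebra over ℂ. Then the universal enveloping algebra U(𝔤) is free as a module over its center Z(𝔤). (First part of Kostant's Theorem.) -/
namespace Kostant

noncomputable section

open MvPolynomial

attribute [local instance] LieRing.ofAssociativeRing

section LinForm

variable {K V ι : Type*} [Field K] [AddCommGroup V] [Module K V] (b : Module.Basis ι K V)

/-- The embedding of a vector space into its symmetric algebra, in coordinates. -/
def linForm : V →ₗ[K] MvPolynomial ι K := b.constr K X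

@[simp] lemma linForm_basis (i : ι) : linForm b (b i) = X i := by
  simp [linForm, Module.Basis.constr_basis]

lemma linForm_isHomogeneous (x : V) : (linForm b x).IsHomogeneous 1 := by
  rw [← mem_homogeneousSubmodule]
  rw [← b.linearCombination_repr x, Finsupp.linearCombination_apply, Finsupp.sum, map_sum]
  refine Submodule.sum_mem _ fun i _ => ?_
  rw [map_smul, linForm_basis]
  exact Submodule.smul_mem _ _ (isHomogeneous_X K i)

end LinForm

section Symmetrization

variable {K L ι : Type*} [Field K] [LieRing L] [LieAlgebra K L]

local notation "U" => UniversalEnvelopingAlgebra K L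
local notation "u" => UniversalEnvelopingAlgebra.ι K (L := L)

lemma ι_lie (x y : L) : u ⁅x, y⁆ = u x * u y - u y * u x := by
  rw [LieHom.map_lie]; rfl

variable (b : Module.Basis ι K L)

/-- The adjoint action on the symmetric algebra, in coordinates. -/
def adDer (x : L) : Derivation K (MvPolynomial ι K) (MvPolynomial ι K) :=
  mkDerivation K fun i => linForm b ⁅x, b i⁆

@[simp] lemma adDer_X (x : L) (i : ι) : adDer b x (X i) = linForm b ⁅x, b i⁆ :=
  mkDerivation_X _ _ _

lemma adDer_linForm (x z : L) : adDer b x (linForm b z) = linForm b ⁅x, z⁆ := by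
  have : (adDer b x).toLinearMap ∘ₗ linForm b = linForm b ∘ₗ LieAlgebra.ad K L x := by
    refine b.ext fun i => ?_
    simp
  exact LinearMap.congr_fun this z

lemma derivation_sum_apply {κ : Type*} (s : Finset κ)
    (D : κ → Derivation K (MvPolynomial ι K) (MvPolynomial ι K)) (f : MvPolynomial ι K) :
    (∑ i ∈ s, D i) f = ∑ i ∈ s, D i f := by
  have := map_sum (Derivation.coeFnAddMonoidHom (R := K) (A := MvPolynomial ι K)
    (M := MvPolynomial ι K)) D s
  exact (congrFun this f).trans (by simp)

lemma derivation_eq_sum [Fintype ι]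
    (D : Derivation K (MvPolynomial ι K) (MvPolynomial ι K)) (f : MvPolynomial ι K) :
    D f = ∑ i, D (X i) * pderiv i f := by
  classical
  have : D = ∑ i, D (X i) • pderiv i := by
    refine derivation_ext fun i => ?_
    rw [derivation_sum_apply, Finset.sum_eq_single i]
    · simp
    · intro j _ hj
      simp [pderiv_X_of_ne hj.symm]
    · simp
  conv_lhs => rw [this]
  rw [derivation_sum_apply]
  simp

lemma derivation_isHomogeneous [Fintype ι]
    (D : Derivation K (MvPolynomial ι K) (MvPolynomial ι K))
    (hD : ∀ i, (D (X i)).IsHomogeneous 1) {f : MvPolynomial ι K} {n : ℕ}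
    (hf : f.IsHomogeneous n) : (D f).IsHomogeneous n := by
  rw [derivation_eq_sum]
  refine IsHomogeneous.sum _ _ _ fun i _ => ?_
  rcases n with _ | n
  · have : pderiv i f = 0 := by
      rw [totalDegree_eq_zero_iff_eq_C.1 (Nat.le_zero.1 hf.totalDegree_le)]; simp
    rw [this, mul_zero]; exact isHomogeneous_zero _ _ _
  · rw [add_comm n 1]
    exact (hD i).mul hf.pderiv

lemma adDer_isHomogeneous [Fintype ι] (x : L) {f : MvPolynomial ι K} {n : ℕ}
    (hf : f.IsHomogeneous n) : (adDer b x f).IsHomogeneous n :=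
  derivation_isHomogeneous _ (fun i => by rw [adDer_X]; exact linForm_isHomogeneous b _) hf

lemma pderiv_adDer [Fintype ι] (y : L) (i : ι) (f : MvPolynomial ι K) :
    pderiv i (adDer b y f) =
      adDer b y (pderiv i f) + ∑ k, b.repr ⁅y, b k⁆ i • pderiv k f := by
  have : ⁅pderiv (R := K) i, adDer b y⁆ = ∑ k, b.repr ⁅y, b k⁆ i • pderiv (R := K) k := by
    refine derivation_ext fun j => ?_
    rw [Derivation.commutator_apply, derivation_sum_apply, Finset.sum_eq_single j]
    · classical
      rw [pderiv_X, Pi.single_apply]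
      have h0 : adDer b y (if j = i then (1 : MvPolynomial ι K) else 0) = 0 := by
        split_ifs <;> simp
      have h1 : pderiv i (linForm b ⁅y, b j⁆) = C (b.repr ⁅y, b j⁆ i) := by
        conv_lhs => rw [← b.sum_repr ⁅y, b j⁆]
        rw [map_sum, map_sum, Finset.sum_eq_single i]
        · simp [smul_eq_C_mul]
        · intro k _ hk; simp [pderiv_X_of_ne hk]
        · simp
      simp only [adDer_X, Derivation.smul_apply, pderiv_X_self]
      rw [h1, eq_comm]
      simp [h0, smul_eq_C_mul]
    · intro k _ hk
      simp [pderiv_X_of_ne hk.symm]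
    · simp
  have h := congrArg (fun D => D f) this
  simp only [Derivation.commutator_apply, derivation_sum_apply,
    Derivation.smul_apply] at h
  rw [← h]; ring

end Symmetrization

section Symmetrization

variable {K L ι : Type*} [Field K] [LieRing L] [LieAlgebra K L]

local notation "U" => UniversalEnvelopingAlgebra K L
local notation "u" => UniversalEnvelopingAlgebra.ι K (L := L)

/-- The standard filtration of the enveloping algebra. -/
def filt (K L : Type*) [Field K] [LieRing L] [LieAlgebra K L] (n : ℕ) :
    Submodule K (UniversalEnvelopingAlgebra K L) :=
  (1 ⊔ LinearMap.range (UniversalEnvelopingAlgebra.ι K (L := L)).toLinearMap) ^ n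

lemma one_mem_filt_one : (1 : U) ∈ filt K L 1 := by
  rw [filt, pow_one]; exact Submodule.mem_sup_left (Submodule.one_le.1 le_rfl)

lemma ι_mem_filt (x : L) : u x ∈ filt K L 1 := by
  rw [filt, pow_one]; exact Submodule.mem_sup_right ⟨x, rfl⟩

lemma mul_mem_filt {m n : ℕ} {a c : U} (ha : a ∈ filt K L m) (hc : c ∈ filt K L n) :
    a * c ∈ filt K L (m + n) := by
  rw [filt, pow_add]; exact Submodule.mul_mem_mul ha hc

lemma filt_mono : Monotone (filt K L) := by
  refine monotone_nat_of_le_succ fun n a ha => ?_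
  simpa using mul_mem_filt ha one_mem_filt_one

lemma algebraMap_mem_filt (n : ℕ) (c : K) : algebraMap K U c ∈ filt K L n := by
  refine filt_mono (Nat.zero_le n) ?_
  rw [filt, pow_zero, Submodule.mem_one]; exact ⟨c, rfl⟩

lemma ι_mul_mem_filt {n : ℕ} (x : L) {a : U} (ha : a ∈ filt K L n) :
    u x * a ∈ filt K L (n + 1) := by
  rw [add_comm]; exact mul_mem_filt (ι_mem_filt x) ha

lemma filt_succ_induction {n : ℕ} {p : U → Prop} (hp : ∀ a ∈ filt K L n, p a)
    (hmul : ∀ x : L, ∀ a ∈ filt K L n, p (u x * a)) (hadd : ∀ a c, p a → p c → p (a + c))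
    {a : U} (ha : a ∈ filt K L (n + 1)) : p a := by
  rw [filt, pow_succ'] at ha
  refine Submodule.mul_induction_on ha (fun m hm c hc => ?_) hadd
  obtain ⟨k, hk, r, ⟨x, rfl⟩, rfl⟩ := Submodule.mem_sup.1 hm
  obtain ⟨k, rfl⟩ := Submodule.mem_one.1 hk
  rw [add_mul]
  refine hadd _ _ (hp _ ?_) (hmul _ _ hc)
  rw [← Algebra.smul_def]; exact Submodule.smul_mem _ _ hc

lemma homogeneous_zero_eq_C {f : MvPolynomial ι K} (hf : f.IsHomogeneous 0) :
    f = C (coeff 0 f) := totalDegree_eq_zero_iff_eq_C.1 (Nat.le_zero.1 hf.totalDegree_le)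

/-- The part of the filtration strictly below `n`. -/
def filtLT (K L : Type*) [Field K] [LieRing L] [LieAlgebra K L] :
    ℕ → Submodule K (UniversalEnvelopingAlgebra K L)
  | 0 => ⊥
  | n + 1 => filt K L n

lemma ι_mul_mem_filtLT {n : ℕ} (x : L) {a : U} (ha : a ∈ filtLT K L n) :
    u x * a ∈ filtLT K L (n + 1) := by
  cases n with
  | zero => rw [(Submodule.mem_bot K).1 ha, mul_zero]; exact zero_mem _
  | succ n => exact ι_mul_mem_filt x ha

variable [Fintype ι] (b : Module.Basis ι K L)

/-- The symmetrization map on polynomials which are homogeneous of a given degree. -/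
def symAux : ℕ → MvPolynomial ι K →ₗ[K] U
  | 0 => (Algebra.linearMap K U) ∘ₗ (lcoeff K 0)
  | n + 1 => ((n + 1 : ℕ) : K)⁻¹ • ∑ i, (LinearMap.mulLeft K (u (b i))) ∘ₗ symAux n ∘ₗ
      (pderiv i).toLinearMap

lemma symAux_zero (f : MvPolynomial ι K) :
    symAux b 0 f = algebraMap K U (coeff 0 f) := rfl

lemma symAux_succ (n : ℕ) (f : MvPolynomial ι K) :
    symAux b (n + 1) f = ((n + 1 : ℕ) : K)⁻¹ • ∑ i, u (b i) * symAux b n (pderiv i f) := by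
  simp [symAux]

lemma symAux_mem_filt (n : ℕ) (f : MvPolynomial ι K) : symAux b n f ∈ filt K L n := by
  induction n generalizing f with
  | zero => exact algebraMap_mem_filt _ _
  | succ n ih =>
    rw [symAux_succ]
    exact Submodule.smul_mem _ _ (sum_mem fun i _ => ι_mul_mem_filt _ (ih _))

lemma coeff_zero_adDer (y : L) (f : MvPolynomial ι K) : coeff 0 (adDer b y f) = 0 := by
  rw [derivation_eq_sum]
  rw [coeff_sum]
  refine Finset.sum_eq_zero fun i _ => ?_
  rw [← constantCoeff_eq, map_mul]
  rw [adDer_X, constantCoeff_eq]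
  rw [(linForm_isHomogeneous b _).coeff_eq_zero (by simp), zero_mul]

lemma commutator_symAux (y : L) (n : ℕ) (f : MvPolynomial ι K) :
    u y * symAux b n f - symAux b n f * u y = symAux b n (adDer b y f) := by
  induction n generalizing f with
  | zero => rw [symAux_zero, symAux_zero, coeff_zero_adDer, Algebra.commutes]; simp
  | succ n ih =>
    rw [symAux_succ, symAux_succ, mul_smul_comm, smul_mul_assoc, ← smul_sub]
    congr 1
    have key : ∀ i, u y * (u (b i) * symAux b n (pderiv i f))
        - u (b i) * symAux b n (pderiv i f) * u y
        = u ⁅y, b i⁆ * symAux b n (pderiv i f)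
          + u (b i) * symAux b n (adDer b y (pderiv i f)) := by
      intro i
      rw [← ih, ι_lie]; noncomm_ring
    rw [Finset.mul_sum, Finset.sum_mul, ← Finset.sum_sub_distrib]
    simp_rw [key, pderiv_adDer, map_add, mul_add]
    rw [Finset.sum_add_distrib, Finset.sum_add_distrib, add_comm]
    congr 1
    simp_rw [map_sum, map_smul, Finset.mul_sum]
    rw [Finset.sum_comm]
    refine Finset.sum_congr rfl fun k _ => ?_
    conv_lhs => rw [← b.sum_repr ⁅y, b k⁆]
    rw [map_sum, Finset.sum_mul]
    refine Finset.sum_congr rfl fun i _ => ?_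
    rw [map_smul, smul_mul_assoc, mul_smul_comm]

variable [CharZero K]

lemma sum_X_mul_pderiv_smul {n : ℕ} {f : MvPolynomial ι K} (hf : f.IsHomogeneous (n + 1)) :
    f = ((n + 1 : ℕ) : K)⁻¹ • ∑ i, X i * pderiv i f := by
  rw [hf.sum_X_mul_pderiv, ← Nat.cast_smul_eq_nsmul K, smul_smul, inv_mul_cancel₀, one_smul]
  exact_mod_cast n.succ_ne_zero

lemma symAux_X_mul (n : ℕ) (i : ι) {f : MvPolynomial ι K} (hf : f.IsHomogeneous n) :
    symAux b (n + 1) (X i * f) - u (b i) * symAux b n f ∈ filt K L n := by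
  classical
  induction n generalizing f with
  | zero =>
    rw [homogeneous_zero_eq_C hf]
    have : symAux b 1 (X i * C (coeff 0 f)) - u (b i) * symAux b 0 (C (coeff 0 f)) = 0 := by
      rw [symAux_succ]
      have h : ∀ k, symAux b 0 (pderiv k (X i * C (coeff 0 f))) =
          if k = i then algebraMap K U (coeff 0 f) else 0 := by
        intro k
        rw [symAux_zero]
        split_ifs with h
        · subst h; simp [Derivation.leibniz]
        · simp [Derivation.leibniz, pderiv_X_of_ne (Ne.symm h)]
      simp_rw [h]
      simp [symAux_zero]
    rw [this]; exact zero_mem _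
  | succ n ih =>
    have hn1 : ((n + 1 : ℕ) : K) ≠ 0 := by exact_mod_cast n.succ_ne_zero
    have hn2 : ((n + 1 + 1 : ℕ) : K) ≠ 0 := by exact_mod_cast (n + 1).succ_ne_zero
    -- multiply by `n + 2`
    suffices h : ((n + 1 + 1 : ℕ) : K) • (symAux b (n + 1 + 1) (X i * f)
        - u (b i) * symAux b (n + 1) f) ∈ filt K L (n + 1) by
      have := Submodule.smul_mem _ ((n + 1 + 1 : ℕ) : K)⁻¹ h
      rwa [smul_smul, inv_mul_cancel₀ hn2, one_smul] at this
    have e1 : ((n + 1 + 1 : ℕ) : K) • symAux b (n + 1 + 1) (X i * f)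
        = u (b i) * symAux b (n + 1) f
          + ∑ k, u (b k) * symAux b (n + 1) (X i * pderiv k f) := by
      rw [symAux_succ, smul_smul, mul_inv_cancel₀ hn2, one_smul]
      have h : ∀ k, pderiv k (X i * f) = (if k = i then f else 0) + X i * pderiv k f := by
        intro k
        rw [Derivation.leibniz, smul_eq_mul, smul_eq_mul, add_comm]
        split_ifs with h
        · subst h; simp
        · simp [pderiv_X_of_ne (Ne.symm h)]
      simp_rw [h, map_add, mul_add, Finset.sum_add_distrib]
      congr 1
      rw [Finset.sum_eq_single i]
      · simp
      · intro k _ hk; simp [hk]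
      · simp
    have e2 : ((n + 1 : ℕ) : K) • symAux b (n + 1) f
        = ∑ k, u (b k) * symAux b n (pderiv k f) := by
      rw [symAux_succ, smul_smul, mul_inv_cancel₀ hn1, one_smul]
    have e3 : ((n + 1 + 1 : ℕ) : K) • (symAux b (n + 1 + 1) (X i * f)
        - u (b i) * symAux b (n + 1) f)
        = ∑ k, (u (b k) * (symAux b (n + 1) (X i * pderiv k f) -
            u (b i) * symAux b n (pderiv k f))
            + u ⁅b k, b i⁆ * symAux b n (pderiv k f)) := by
      have e4 : ((n + 1 + 1 : ℕ) : K) • (u (b i) * symAux b (n + 1) f)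
          = u (b i) * symAux b (n + 1) f + u (b i) *
            ∑ k, u (b k) * symAux b n (pderiv k f) := by
        rw [← e2, Nat.cast_succ (n + 1), add_smul, one_smul, mul_smul_comm, add_comm]
      rw [smul_sub, e1, e4, Finset.mul_sum, add_sub_add_left_eq_sub, ← Finset.sum_sub_distrib]
      refine Finset.sum_congr rfl fun k _ => ?_
      rw [ι_lie]; noncomm_ring
    rw [e3]
    refine sum_mem fun k _ => add_mem (ι_mul_mem_filt _ (ih hf.pderiv)) ?_
    exact ι_mul_mem_filt _ (symAux_mem_filt b _ _)

lemma symAux_mul (n m : ℕ) {f g : MvPolynomial ι K} (hf : f.IsHomogeneous n)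
    (hg : g.IsHomogeneous m) :
    symAux b n f * symAux b m g - symAux b (n + m) (f * g) ∈ filtLT K L (n + m) := by
  induction n generalizing f with
  | zero =>
    rw [homogeneous_zero_eq_C hf, symAux_zero, ← smul_eq_C_mul, zero_add, map_smul]
    simp [← Algebra.smul_def]
  | succ n ih =>
    have e0 := sum_X_mul_pderiv_smul hf
    have e1 : symAux b (n + 1) f * symAux b m g - symAux b (n + 1 + m) (f * g)
        = ((n + 1 : ℕ) : K)⁻¹ • ∑ i, (u (b i) * (symAux b n (pderiv i f) * symAux b m g
            - symAux b (n + m) (pderiv i f * g))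
            - (symAux b (n + m + 1) (X i * (pderiv i f * g))
              - u (b i) * symAux b (n + m) (pderiv i f * g))) := by
      have : symAux b (n + 1 + m) (f * g) = ((n + 1 : ℕ) : K)⁻¹ •
          ∑ i, symAux b (n + m + 1) (X i * (pderiv i f * g)) := by
        conv_lhs => rw [e0]
        rw [smul_mul_assoc, map_smul, Finset.sum_mul, map_sum, add_right_comm]
        simp_rw [mul_assoc]
      rw [this, symAux_succ, smul_mul_assoc, ← smul_sub, Finset.sum_mul,
        ← Finset.sum_sub_distrib]
      congr 1
      refine Finset.sum_congr rfl fun k _ => ?_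
      noncomm_ring
    rw [e1, add_right_comm]
    refine Submodule.smul_mem _ _ (sum_mem fun i _ => sub_mem ?_ ?_)
    · exact ι_mul_mem_filtLT _ (ih hf.pderiv)
    · exact symAux_X_mul b _ i (hf.pderiv.mul hg)

end Symmetrization

section Degree

variable {K σ : Type*} [Field K]

/-- Polynomials all of whose homogeneous components have degree less than `n`. -/
def degLT (K σ : Type*) [Field K] (n : ℕ) : Submodule K (MvPolynomial σ K) :=
  Submodule.span K {p | ∃ k < n, p.IsHomogeneous k}

lemma IsHomogeneous.mem_degLT {p : MvPolynomial σ K} {k n : ℕ} (hp : p.IsHomogeneous k)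
    (h : k < n) : p ∈ degLT K σ n := Submodule.subset_span ⟨k, h, hp⟩

lemma degLT_mono : Monotone (degLT K σ) := fun _ _ h =>
  Submodule.span_mono fun _ ⟨k, hk, hp⟩ => ⟨k, hk.trans_le h, hp⟩

lemma mem_degLT_totalDegree (p : MvPolynomial σ K) : p ∈ degLT K σ (p.totalDegree + 1) := by
  rw [← sum_homogeneousComponent p]
  refine sum_mem fun i hi => ?_
  refine IsHomogeneous.mem_degLT (homogeneousComponent_isHomogeneous i p) ?_
  rw [sum_homogeneousComponent]; exact Finset.mem_range.1 hi

lemma homogeneousComponent_eq_zero_of_mem_degLT {p : MvPolynomial σ K} {n : ℕ}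
    (hp : p ∈ degLT K σ n) : homogeneousComponent n p = 0 := by
  have : degLT K σ n ≤ LinearMap.ker (homogeneousComponent n) := by
    refine Submodule.span_le.2 ?_
    rintro q ⟨k, hk, hq⟩
    rw [SetLike.mem_coe, LinearMap.mem_ker, homogeneousComponent_of_mem hq, if_neg hk.ne']
  exact this hp

lemma sub_homogeneousComponent_mem_degLT {p : MvPolynomial σ K} {n : ℕ}
    (hp : p ∈ degLT K σ (n + 1)) : p - homogeneousComponent n p ∈ degLT K σ n := by
  refine Submodule.span_induction (p := fun p _ => p - homogeneousComponent n p ∈ degLT K σ n)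
    ?_ (by simp) (fun p q _ _ hp hq => ?_) (fun c p _ hp => ?_) hp
  · rintro q ⟨k, hk, hq⟩
    rw [homogeneousComponent_of_mem hq]
    split_ifs with h
    · simp
    · rw [sub_zero]; exact IsHomogeneous.mem_degLT hq (by omega)
  · rw [map_add, add_sub_add_comm]; exact add_mem hp hq
  · rw [map_smul, ← smul_sub]; exact Submodule.smul_mem _ _ hp

lemma mul_mem_degLT {p q : MvPolynomial σ K} {k n : ℕ} (hp : p.IsHomogeneous k)
    (hq : q ∈ degLT K σ n) : p * q ∈ degLT K σ (k + n) := by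
  have : degLT K σ n ≤ (degLT K σ (k + n)).comap (LinearMap.mulLeft K p) := by
    refine Submodule.span_le.2 ?_
    rintro q ⟨j, hj, hq⟩
    exact IsHomogeneous.mem_degLT (hp.mul hq) (by omega)
  exact this hq

lemma derivation_mem_degLT [Fintype σ]
    (D : Derivation K (MvPolynomial σ K) (MvPolynomial σ K))
    (hD : ∀ i, (D (X i)).IsHomogeneous 1) {p : MvPolynomial σ K} {n : ℕ}
    (hp : p ∈ degLT K σ n) : D p ∈ degLT K σ n := by
  have : degLT K σ n ≤ (degLT K σ n).comap D.toLinearMap := by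
    refine Submodule.span_le.2 ?_
    rintro q ⟨j, hj, hq⟩
    exact IsHomogeneous.mem_degLT (derivation_isHomogeneous D hD hq) hj
  exact this hp

/-- A polynomial is a sum of its homogeneous components; induction principle. -/
lemma induction_homogeneous {P : MvPolynomial σ K → Prop} (f : MvPolynomial σ K)
    (h : ∀ n f, f.IsHomogeneous n → P f) (hadd : ∀ f g, P f → P g → P (f + g)) : P f := by
  rw [← sum_homogeneousComponent f]
  refine Finset.sum_induction _ P hadd (h 0 0 (isHomogeneous_zero _ _ _)) fun i _ => ?_
  exact h _ _ (homogeneousComponent_isHomogeneous i f)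

end Degree

section Symmetrization

variable {K L ι : Type*} [Field K] [LieRing L] [LieAlgebra K L]

local notation "U" => UniversalEnvelopingAlgebra K L
local notation "u" => UniversalEnvelopingAlgebra.ι K (L := L)

variable [Fintype ι] (b : Module.Basis ι K L)

/-- The symmetrization map. -/
def sym : MvPolynomial ι K →ₗ[K] U :=
  (basisMonomials ι K).constr K fun s => symAux b s.degree (monomial s 1)

lemma sym_monomial (s : ι →₀ ℕ) (c : K) :
    sym b (monomial s c) = symAux b s.degree (monomial s c) := by
  have h : sym b (monomial s 1) = symAux b s.degree (monomial s 1) := by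
    have := (basisMonomials ι K).constr_basis K
      (fun s => symAux b s.degree (monomial s 1)) s
    simpa [sym] using this
  have h2 : (monomial s c : MvPolynomial ι K) = c • monomial s 1 := by
    rw [smul_monomial, smul_eq_mul, mul_one]
  rw [h2, map_smul, map_smul, h]

lemma sym_of_isHomogeneous {n : ℕ} {f : MvPolynomial ι K} (hf : f.IsHomogeneous n) :
    sym b f = symAux b n f := by
  conv_lhs => rw [f.as_sum]
  conv_rhs => rw [f.as_sum]
  rw [map_sum, map_sum]
  refine Finset.sum_congr rfl fun s hs => ?_
  rw [sym_monomial]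
  congr 1
  have := hf (mem_support_iff.1 hs)
  rw [← this, Finsupp.degree_eq_weight_one]; rfl

lemma commutator_sym (y : L) (f : MvPolynomial ι K) :
    u y * sym b f - sym b f * u y = sym b (adDer b y f) := by
  induction f using induction_homogeneous with
  | h n f hf =>
    rw [sym_of_isHomogeneous b hf, sym_of_isHomogeneous b (adDer_isHomogeneous b y hf),
      commutator_symAux]
  | hadd f g hf hg => rw [map_add, map_add, map_add, ← hf, ← hg]; noncomm_ring

variable [CharZero K]

lemma filt_le_map_sym (n : ℕ) : filt K L n ≤ (degLT K ι (n + 1)).map (sym b) := by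
  induction n with
  | zero =>
    intro a ha
    rw [filt, pow_zero] at ha
    obtain ⟨k, rfl⟩ := Submodule.mem_one.1 ha
    refine ⟨C k, IsHomogeneous.mem_degLT (isHomogeneous_C _ _) Nat.one_pos, ?_⟩
    rw [sym_of_isHomogeneous b (isHomogeneous_C _ _), symAux_zero]; simp
  | succ n ih =>
    have key : ∀ i, (degLT K ι (n + 1)).map (sym b) ≤
        ((degLT K ι (n + 2)).map (sym b)).comap (LinearMap.mulLeft K (u (b i))) := by
      intro i
      rw [degLT, Submodule.map_span, Submodule.span_le]
      rintro _ ⟨p, ⟨k, hk, hp⟩, rfl⟩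
      rw [SetLike.mem_coe, Submodule.mem_comap, LinearMap.mulLeft_apply]
      have h1 : sym b (X i * p) ∈ (degLT K ι (n + 2)).map (sym b) :=
        ⟨_, IsHomogeneous.mem_degLT ((isHomogeneous_X K i).mul hp) (by omega), rfl⟩
      have h2 := symAux_X_mul b k i hp
      have h3 := Submodule.map_mono (degLT_mono (Nat.le_succ _))
        (ih (filt_mono (Nat.lt_succ_iff.1 hk) h2))
      have := sub_mem h1 h3
      rwa [sym_of_isHomogeneous b ((isHomogeneous_X K i).mul hp), add_comm 1 k,
        sub_sub_cancel, ← sym_of_isHomogeneous b hp] at this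
    intro a ha
    refine filt_succ_induction (p := fun a => a ∈ (degLT K ι (n + 2)).map (sym b))
      (fun a ha => Submodule.map_mono (degLT_mono (Nat.le_succ _)) (ih ha)) (fun x a ha => ?_)
      (fun a c => add_mem) ha
    rw [← b.sum_repr x, map_sum, Finset.sum_mul]
    refine sum_mem fun i _ => ?_
    rw [map_smul, smul_mul_assoc]
    exact Submodule.smul_mem _ _ (key i (ih ha))

lemma sym_mul_sub_mem {n m : ℕ} {f g : MvPolynomial ι K} (hf : f.IsHomogeneous n)
    (hg : g.IsHomogeneous m) :
    sym b f * sym b g - sym b (f * g) ∈ (degLT K ι (n + m)).map (sym b) := by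
  have h := symAux_mul b n m hf hg
  rw [sym_of_isHomogeneous b hf, sym_of_isHomogeneous b hg,
    sym_of_isHomogeneous b (hf.mul hg)]
  generalize symAux b n f * symAux b m g - symAux b (n + m) (f * g) = a at h ⊢
  cases hk : n + m with
  | zero => rw [hk] at h; rw [(Submodule.mem_bot K).1 h]; exact zero_mem _
  | succ k => rw [hk] at h; exact filt_le_map_sym b k h

lemma sym_surjective : Function.Surjective (sym b) := by
  let S : Subalgebra K U :=
    { carrier := {a | ∃ n, a ∈ filt K L n}
      mul_mem' := fun ⟨n, hn⟩ ⟨m, hm⟩ => ⟨n + m, mul_mem_filt hn hm⟩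
      add_mem' := fun ⟨n, hn⟩ ⟨m, hm⟩ => ⟨max n m,
        add_mem (filt_mono (le_max_left _ _) hn) (filt_mono (le_max_right _ _) hm)⟩
      algebraMap_mem' := fun c => ⟨0, algebraMap_mem_filt _ _⟩ }
  let φ : L →ₗ⁅K⁆ S :=
    { toFun := fun x => ⟨u x, 1, ι_mem_filt x⟩
      map_add' := fun x y => Subtype.ext (map_add u x y)
      map_smul' := fun c x => Subtype.ext (map_smul u c x)
      map_lie' := fun {x y} => Subtype.ext (ι_lie x y) }
  have h2 : S.val.comp (UniversalEnvelopingAlgebra.lift K φ) = AlgHom.id K U := by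
    refine UniversalEnvelopingAlgebra.hom_ext (R := K) (L := L) ?_
    ext x
    change ((UniversalEnvelopingAlgebra.lift K φ (u x) : S) : U) = u x
    rw [UniversalEnvelopingAlgebra.lift_ι_apply]
    rfl
  intro a
  have h3 : ((UniversalEnvelopingAlgebra.lift K φ a : S) : U) = a := AlgHom.congr_fun h2 a
  obtain ⟨n, hn⟩ := (UniversalEnvelopingAlgebra.lift K φ a).2
  rw [h3] at hn
  obtain ⟨p, -, hp⟩ := filt_le_map_sym b n hn
  exact ⟨p, hp⟩

end Symmetrization

section Injectivity

variable {K L ι : Type*} [Field K] [LieRing L] [LieAlgebra K L]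

local notation "U" => UniversalEnvelopingAlgebra K L
local notation "u" => UniversalEnvelopingAlgebra.ι K (L := L)

variable [Fintype ι]

/-- The linear polynomial on matrices attached to a matrix. -/
def matForm : Matrix ι ι K →ₗ[K] MvPolynomial (ι × ι) K where
  toFun M := ∑ p : ι × ι, M p.1 p.2 • X p
  map_add' M N := by simp [add_smul, Finset.sum_add_distrib]
  map_smul' c M := by simp [Finset.smul_sum, smul_smul]

lemma matForm_apply (M : Matrix ι ι K) :
    matForm M = ∑ p : ι × ι, M p.1 p.2 • (X p : MvPolynomial (ι × ι) K) := rfl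

lemma matForm_isHomogeneous (M : Matrix ι ι K) : (matForm M).IsHomogeneous 1 := by
  rw [← mem_homogeneousSubmodule, matForm_apply]
  exact sum_mem fun p _ => Submodule.smul_mem _ _ (isHomogeneous_X K p)

variable [DecidableEq ι]

lemma matrix_eq_sum (M : Matrix ι ι K) :
    M = ∑ p : ι × ι, M p.1 p.2 • Matrix.single p.1 p.2 (1 : K) := by
  conv_lhs => rw [Matrix.matrix_eq_sum_single M]
  rw [Fintype.sum_prod_type]
  simp [Matrix.smul_single]

/-- The derivation of the symmetric algebra on matrices extending left multiplication. -/
def mulDer (M : Matrix ι ι K) :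
    Derivation K (MvPolynomial (ι × ι) K) (MvPolynomial (ι × ι) K) :=
  mkDerivation K fun p => matForm (M * Matrix.single p.1 p.2 1)

lemma mulDer_X (M : Matrix ι ι K) (p : ι × ι) :
    mulDer M (X p) = matForm (M * Matrix.single p.1 p.2 1) := mkDerivation_X _ _ _

lemma mulDer_X_isHomogeneous (M : Matrix ι ι K) (p : ι × ι) :
    (mulDer M (X p)).IsHomogeneous 1 := by
  rw [mulDer_X]; exact matForm_isHomogeneous _

lemma mulDer_matForm (M N : Matrix ι ι K) : mulDer M (matForm N) = matForm (M * N) := by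
  conv_rhs => rw [matrix_eq_sum N]
  rw [matForm_apply, map_sum, Finset.mul_sum, map_sum]
  refine Finset.sum_congr rfl fun p _ => ?_
  rw [Derivation.map_smul, mulDer_X, Matrix.mul_smul, map_smul]

/-- Multiplication by `M` plus the action of `M` on the symmetric algebra of matrices. -/
def twistOp (M : Matrix ι ι K) : Module.End K (MvPolynomial (ι × ι) K) :=
  LinearMap.mulLeft K (matForm M) + (mulDer M).toLinearMap

lemma twistOp_apply (M : Matrix ι ι K) (p : MvPolynomial (ι × ι) K) :
    twistOp M p = matForm M * p + mulDer M p := rfl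

lemma mulDer_lie (M N : Matrix ι ι K) (p : MvPolynomial (ι × ι) K) :
    mulDer (M * N - N * M) p = mulDer M (mulDer N p) - mulDer N (mulDer M p) := by
  have : mulDer (M * N - N * M) = ⁅mulDer M, mulDer N⁆ := by
    refine derivation_ext fun q => ?_
    rw [Derivation.commutator_apply]
    simp only [mulDer_X, mulDer_matForm, ← map_sub, sub_mul, mul_assoc]
  rw [this, Derivation.commutator_apply]

lemma mulDer_add (M N : Matrix ι ι K) : mulDer (M + N) = mulDer M + mulDer N :=
  derivation_ext fun q => by simp [mulDer_X, add_mul]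

lemma mulDer_smul (c : K) (M : Matrix ι ι K) : mulDer (c • M) = c • mulDer M :=
  derivation_ext fun q => by simp [mulDer_X]

/-- The representation by `twistOp`. -/
def twistHom (ρ : L →ₗ⁅K⁆ Matrix ι ι K) : L →ₗ⁅K⁆ Module.End K (MvPolynomial (ι × ι) K) where
  toFun x := twistOp (ρ x)
  map_add' x y := by
    refine LinearMap.ext fun p => ?_
    simp only [map_add, twistOp_apply, LinearMap.add_apply, mulDer_add, Derivation.add_apply]
    ring
  map_smul' c x := by
    refine LinearMap.ext fun p => ?_
    simp only [map_smul, twistOp_apply, LinearMap.smul_apply, mulDer_smul, Derivation.smul_apply,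
      RingHom.id_apply, smul_add, smul_mul_assoc]
  map_lie' {x y} := by
    refine LinearMap.ext fun p => ?_
    rw [LieHom.map_lie, LieRing.of_associative_ring_bracket, LieRing.of_associative_ring_bracket]
    simp only [LinearMap.sub_apply, Module.End.mul_apply, twistOp_apply, map_add,
      Derivation.leibniz, smul_eq_mul, mulDer_lie, mulDer_matForm, map_sub]
    ring

/-- Evaluation of the twisted representation at `1`. -/
def twistEval (ρ : L →ₗ⁅K⁆ Matrix ι ι K) : U →ₗ[K] MvPolynomial (ι × ι) K :=
  (LinearMap.applyₗ 1) ∘ₗ (UniversalEnvelopingAlgebra.lift K (twistHom ρ)).toLinearMap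

lemma twistEval_algebraMap (ρ : L →ₗ⁅K⁆ Matrix ι ι K) (c : K) :
    twistEval ρ (algebraMap K U c) = C c := by
  change UniversalEnvelopingAlgebra.lift K (twistHom ρ) (algebraMap K U c) 1 = C c
  rw [AlgHom.commutes, Module.algebraMap_end_apply, smul_eq_C_mul, mul_one]

lemma twistEval_ι_mul (ρ : L →ₗ⁅K⁆ Matrix ι ι K) (x : L) (a : U) :
    twistEval ρ (u x * a) = twistOp (ρ x) (twistEval ρ a) := by
  change UniversalEnvelopingAlgebra.lift K (twistHom ρ) (u x * a) 1 = _
  rw [map_mul, UniversalEnvelopingAlgebra.lift_ι_apply]; rfl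

variable (b : Module.Basis ι K L) (ρ : L →ₗ⁅K⁆ Matrix ι ι K)

/-- The map of symmetric algebras induced by a matrix representation. -/
def symMap : MvPolynomial ι K →ₐ[K] MvPolynomial (ι × ι) K :=
  aeval fun i => matForm (ρ (b i))

lemma symMap_isHomogeneous {n : ℕ} {f : MvPolynomial ι K} (hf : f.IsHomogeneous n) :
    (symMap b ρ f).IsHomogeneous n := by
  have := hf.aeval (fun i => matForm (ρ (b i))) (n := 1) fun i => matForm_isHomogeneous _
  rwa [one_mul] at this

lemma symMap_injective (hρ : Function.Injective ρ) : Function.Injective (symMap b ρ) := by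
  obtain ⟨g, hg⟩ := (ρ : L →ₗ[K] Matrix ι ι K).exists_leftInverse_of_injective
    (LinearMap.ker_eq_bot.2 hρ)
  let ψ : MvPolynomial (ι × ι) K →ₐ[K] MvPolynomial ι K :=
    aeval fun p => linForm b (g (Matrix.single p.1 p.2 1))
  have h1 : ψ.comp (symMap b ρ) = AlgHom.id K _ := by
    refine algHom_ext fun i => ?_
    rw [AlgHom.comp_apply, symMap, aeval_X, matForm_apply, map_sum]
    have : ∀ p : ι × ι, ψ (ρ (b i) p.1 p.2 • X p)
        = linForm b (g (ρ (b i) p.1 p.2 • Matrix.single p.1 p.2 1)) := by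
      intro p
      rw [map_smul, map_smul, map_smul, aeval_X]
    simp_rw [this]
    rw [← map_sum, ← map_sum, ← matrix_eq_sum]
    have h2 := LinearMap.congr_fun hg (b i)
    simp only [LinearMap.comp_apply, LinearMap.id_apply, LieHom.coe_toLinearMap] at h2
    rw [h2]; simp
  intro p q h
  have := congrArg ψ h
  rwa [← AlgHom.comp_apply, ← AlgHom.comp_apply, h1] at this

variable [CharZero K]

lemma twistEval_symAux (n : ℕ) {f : MvPolynomial ι K} (hf : f.IsHomogeneous n) :
    twistEval ρ (symAux b n f) - symMap b ρ f ∈ degLT K (ι × ι) n := by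
  induction n generalizing f with
  | zero =>
    rw [symAux_zero, twistEval_algebraMap]
    conv => enter [2]; rw [homogeneous_zero_eq_C hf]
    rw [symMap]; simp
  | succ n ih =>
    have e : twistEval ρ (symAux b (n + 1) f) - symMap b ρ f
        = ((n + 1 : ℕ) : K)⁻¹ • ∑ i, (matForm (ρ (b i)) *
            (twistEval ρ (symAux b n (pderiv i f)) - symMap b ρ (pderiv i f))
          + mulDer (ρ (b i)) ((twistEval ρ (symAux b n (pderiv i f)) -
              symMap b ρ (pderiv i f)) + symMap b ρ (pderiv i f))) := by
      conv_lhs => enter [2]; rw [sum_X_mul_pderiv_smul hf]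
      rw [symAux_succ, map_smul, map_smul, ← smul_sub, map_sum, map_sum,
        ← Finset.sum_sub_distrib]
      congr 1
      refine Finset.sum_congr rfl fun i _ => ?_
      rw [twistEval_ι_mul, twistOp_apply, map_mul]
      conv_lhs => enter [2, 1]; rw [symMap, aeval_X]
      rw [sub_add_cancel]; ring
    rw [e]
    refine Submodule.smul_mem _ _ (sum_mem fun i _ => add_mem ?_ ?_)
    · rw [add_comm n 1]
      exact mul_mem_degLT (matForm_isHomogeneous _) (ih hf.pderiv)
    · refine derivation_mem_degLT _ (mulDer_X_isHomogeneous _) (add_mem ?_ ?_)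
      · exact degLT_mono n.le_succ (ih hf.pderiv)
      · exact IsHomogeneous.mem_degLT (symMap_isHomogeneous b ρ hf.pderiv) n.lt_succ_self

lemma sym_injective_of_matrix (hρ : Function.Injective ρ) : Function.Injective (sym b) := by
  rw [← LinearMap.ker_eq_bot, LinearMap.ker_eq_bot']
  have hlow : ∀ n, degLT K ι n ≤ (degLT K (ι × ι) n).comap (twistEval ρ ∘ₗ sym b) := by
    intro n
    refine Submodule.span_le.2 ?_
    rintro p ⟨k, hk, hp⟩
    rw [SetLike.mem_coe, Submodule.mem_comap, LinearMap.comp_apply, sym_of_isHomogeneous b hp]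
    have := add_mem (degLT_mono hk.le (twistEval_symAux b ρ k hp))
      (IsHomogeneous.mem_degLT (symMap_isHomogeneous b ρ hp) hk)
    rwa [sub_add_cancel] at this
  have key : ∀ n, ∀ f ∈ degLT K ι n, sym b f = 0 → f = 0 := by
    intro n
    induction n with
    | zero =>
      intro f hf _
      have : degLT K ι 0 = ⊥ := by rw [degLT, Submodule.span_eq_bot]; simp
      rw [this] at hf; exact (Submodule.mem_bot K).1 hf
    | succ n ih =>
      intro f hf h0
      refine ih f ?_ h0
      set g := homogeneousComponent n f with hg
      have hgh : g.IsHomogeneous n := homogeneousComponent_isHomogeneous n f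
      have h1 := sub_homogeneousComponent_mem_degLT hf
      have h2 := hlow n h1
      rw [Submodule.mem_comap, LinearMap.comp_apply, map_sub, h0, zero_sub, map_neg,
        ← hg, neg_mem_iff, sym_of_isHomogeneous b hgh] at h2
      have h3 := sub_mem h2 (twistEval_symAux b ρ n hgh)
      rw [sub_sub_cancel] at h3
      have h4 := homogeneousComponent_eq_zero_of_mem_degLT h3
      rw [homogeneousComponent_of_mem (symMap_isHomogeneous b ρ hgh), if_pos rfl] at h4
      have h5 : g = 0 := symMap_injective b ρ hρ (by rw [h4, map_zero])
      rw [← hg, h5, sub_zero] at h1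
      exact h1
  exact fun f => key _ f (mem_degLT_totalDegree f)

/-- The symmetrization map is injective whenever the adjoint representation is. -/
lemma sym_injective (had : Function.Injective (LieAlgebra.ad K L)) :
    Function.Injective (sym b) := by
  let ρ : L →ₗ⁅K⁆ Matrix ι ι K :=
    { toFun := fun x => LinearMap.toMatrixAlgEquiv b (LieAlgebra.ad K L x)
      map_add' := fun x y => by simp
      map_smul' := fun c x => by simp
      map_lie' := fun {x y} => by
        rw [LieHom.map_lie, LieRing.of_associative_ring_bracket, map_sub, map_mul, map_mul]; rfl }
  exact sym_injective_of_matrix b ρ ((LinearMap.toMatrixAlgEquiv b).injective.comp had)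

end Injectivity

section Chevalley

variable {k κ : Type*} [Field k]

local notation "A" => MvPolynomial κ k

/-- The ideal generated by the elements of a subalgebra without constant term. -/
def augIdeal (J : Subalgebra k (MvPolynomial κ k)) : Ideal (MvPolynomial κ k) :=
  Ideal.span {a | a ∈ J ∧ coeff 0 a = 0}

variable (J : Subalgebra k (MvPolynomial κ k)) (R : Set (MvPolynomial κ k ≃ₐ[k] MvPolynomial κ k))

lemma fixed_of_mem_closure {a : A} (h : ∀ s ∈ R, s a = a) {g : A ≃ₐ[k] A}
    (hg : g ∈ Subgroup.closure R) : g a = a := by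
  have : Subgroup.closure R ≤ MulAction.stabilizer (A ≃ₐ[k] A) a :=
    (Subgroup.closure_le _).2 fun s hs => h s hs
  exact this hg

variable {J R}

lemma sub_mem_augIdeal (hJ : ∀ a, a ∈ J ↔ ∀ s ∈ R, s a = a) {y : A}
    (hy : ∀ s ∈ R, s y - y ∈ augIdeal J) {g : A ≃ₐ[k] A}
    (hg : g ∈ Subgroup.closure R) : g y - y ∈ augIdeal J := by
  have hst : ∀ g ∈ Subgroup.closure R, ∀ x ∈ augIdeal J, g x ∈ augIdeal J := by
    intro g hg x hx
    have : augIdeal J ≤ (augIdeal J).comap (g : A →+* A) := by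
      refine Ideal.span_le.2 fun x hx => ?_
      rw [SetLike.mem_coe, Ideal.mem_comap]
      have : g x = x := fixed_of_mem_closure R ((hJ x).1 hx.1) hg
      change g x ∈ _
      rw [this]; exact Ideal.subset_span hx
    exact this hx
  induction hg using Subgroup.closure_induction with
  | mem s hs => exact hy s hs
  | one => simp
  | mul g h hg hh ihg ihh =>
    have : (g * h) y - y = g (h y - y) + (g y - y) := by
      rw [map_sub, AlgEquiv.mul_apply]; ring
    rw [this]
    exact add_mem (hst g hg _ ihh) ihg
  | inv g hg ih =>
    have h1 := hst g⁻¹ (inv_mem hg) _ ih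
    rw [map_sub, ← AlgEquiv.mul_apply, inv_mul_cancel, AlgEquiv.one_apply] at h1
    have := neg_mem h1
    rwa [neg_sub] at this

lemma homogeneousComponent_mul_mem (hJh : ∀ a ∈ J, ∀ n, homogeneousComponent n a ∈ J)
    (S : Submodule J A) (n : ℕ) (hS : ∀ i < n, ∀ f : A, f.IsHomogeneous i → f ∈ S)
    {x : A} (hx : x ∈ augIdeal J) : homogeneousComponent n x ∈ S := by
  suffices h : ∀ g, homogeneousComponent n (g * x) ∈ S by simpa using h 1
  refine Submodule.span_induction (p := fun x _ => ∀ g, homogeneousComponent n (g * x) ∈ S)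
    ?_ (by simp) (fun x y _ _ hx hy g => ?_) (fun a x _ hx g => ?_) hx
  · rintro x ⟨hxJ, hx0⟩ g
    induction g using induction_homogeneous with
    | h i g hg =>
      rw [← sum_homogeneousComponent x, Finset.mul_sum, map_sum]
      refine sum_mem fun j _ => ?_
      rw [homogeneousComponent_of_mem (hg.mul (homogeneousComponent_isHomogeneous j x))]
      split_ifs with h
      · rcases Nat.eq_zero_or_pos j with rfl | hj
        · rw [homogeneousComponent_zero, hx0]; simp
        · have := S.smul_mem ⟨_, hJh x hxJ j⟩ (hS i (by omega) g hg)
          rwa [Subalgebra.smul_def, smul_eq_mul, mul_comm] at this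
      · exact zero_mem _
    | hadd f g hf hg => rw [add_mul, map_add]; exact add_mem hf hg
  · rw [mul_add, map_add]; exact add_mem (hx g) (hy g)
  · rw [smul_eq_mul, ← mul_assoc]; exact hx _

variable [CharZero k]

/-- The key lemma in Chevalley's theorem: relations with invariant coefficients are trivial
modulo the ideal generated by the invariants without constant term. -/
lemma sum_smul_mem_augIdeal (hJ : ∀ a, a ∈ J ↔ ∀ s ∈ R, s a = a)
    (hfin : Finite (Subgroup.closure R))
    (hrefl : ∀ s ∈ R, ∃ ℓ : A, ℓ.IsHomogeneous 1 ∧ ℓ ≠ 0 ∧ ∀ f : A, ∃ g, s f - f = ℓ * g)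
    (hdeg : ∀ s ∈ R, ∀ f : A, (s f).totalDegree ≤ f.totalDegree)
    {I : Type*} (t : Finset I) (r : I → A) (hr : ∀ i, r i ∈ J)
    (χ : A →ₗ[k] k) (hχ : ∀ j ∈ J, ∀ i, χ (j * r i) = coeff 0 j * χ (r i)) (N : ℕ)
    (f : I → A) (hN : ∀ i, f i = 0 ∨ (f i).totalDegree < N) (hf : ∑ i ∈ t, r i * f i = 0) :
    ∑ i ∈ t, χ (r i) • f i ∈ augIdeal J := by
  induction N generalizing f with
  | zero =>
    rw [Finset.sum_eq_zero]
    · exact zero_mem _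
    · intro i _
      rcases hN i with h | h
      · rw [h, smul_zero]
      · omega
  | succ N ih =>
    set y := ∑ i ∈ t, χ (r i) • f i with hy
    have h1 : ∀ s ∈ R, s y - y ∈ augIdeal J := by
      intro s hs
      obtain ⟨ℓ, hℓ, hℓ0, hdiv⟩ := hrefl s hs
      choose Δ hΔ using hdiv
      have h2 : ∑ i ∈ t, r i * Δ (f i) = 0 := by
        refine (mul_eq_zero.1 ?_).resolve_left hℓ0
        have e1 : ∑ i ∈ t, r i * s (f i) = 0 := by
          have := congrArg s hf
          rw [map_sum, map_zero] at this
          rw [← this]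
          refine Finset.sum_congr rfl fun i _ => ?_
          rw [map_mul, (hJ _).1 (hr i) s hs]
        rw [Finset.mul_sum]
        have e2 : ∀ i, ℓ * (r i * Δ (f i)) = r i * s (f i) - r i * f i := by
          intro i; rw [← mul_sub, hΔ]; ring
        simp_rw [e2]
        rw [Finset.sum_sub_distrib, e1, hf, sub_zero]
      have h3 := ih (fun i => Δ (f i)) (fun i => ?_) h2
      · have : s y - y = ℓ * ∑ i ∈ t, χ (r i) • Δ (f i) := by
          rw [hy, map_sum, ← Finset.sum_sub_distrib, Finset.mul_sum]
          refine Finset.sum_congr rfl fun i _ => ?_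
          rw [map_smul, ← smul_sub, hΔ, mul_smul_comm]
        rw [this]
        exact Ideal.mul_mem_left _ _ h3
      · by_cases h0 : Δ (f i) = 0
        · exact Or.inl h0
        right
        have e := hΔ (f i)
        have d1 : (ℓ * Δ (f i)).totalDegree = 1 + (Δ (f i)).totalDegree := by
          rw [totalDegree_mul_of_isDomain hℓ0 h0, hℓ.totalDegree hℓ0]
        have d2 : (s (f i) - f i).totalDegree ≤ (f i).totalDegree :=
          (totalDegree_sub _ _).trans (max_le (hdeg s hs _) le_rfl)
        rw [e, d1] at d2
        rcases hN i with h | h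
        · rw [h, totalDegree_zero] at d2; omega
        · omega
    have : Fintype (Subgroup.closure R) := Fintype.ofFinite _
    set c : k := ((Fintype.card (Subgroup.closure R) : ℕ) : k) with hc
    have hc0 : c ≠ 0 := by rw [hc]; exact_mod_cast Fintype.card_ne_zero
    let avg : A →ₗ[k] A := c⁻¹ • ∑ g : Subgroup.closure R, (g : A ≃ₐ[k] A).toLinearMap
    have avg_apply : ∀ f, avg f = c⁻¹ • ∑ g : Subgroup.closure R, (g : A ≃ₐ[k] A) f := by
      intro f; simp [avg]
    have avg_mem : ∀ f, avg f ∈ J := by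
      intro f
      rw [hJ]
      intro s hs
      rw [avg_apply, map_smul, map_sum]
      congr 1
      refine Fintype.sum_equiv (Equiv.mulLeft ⟨s, Subgroup.subset_closure hs⟩) _ _ fun g => ?_
      rfl
    have h4 : avg y - y ∈ augIdeal J := by
      have : avg y - y = C c⁻¹ * ∑ g : Subgroup.closure R, ((g : A ≃ₐ[k] A) y - y) := by
        rw [avg_apply, Finset.sum_sub_distrib, Finset.sum_const, Finset.card_univ,
          ← Nat.cast_smul_eq_nsmul k, ← smul_eq_C_mul, smul_sub, smul_smul,
          inv_mul_cancel₀ hc0, one_smul]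
      rw [this]
      refine Ideal.mul_mem_left _ _ (sum_mem fun g _ => sub_mem_augIdeal hJ h1 g.2)
    have h5 : avg y ∈ augIdeal J := by
      refine Ideal.subset_span ⟨avg_mem y, ?_⟩
      have e1 : ∑ i ∈ t, avg (f i) * r i = 0 := by
        have := congrArg avg hf
        rw [map_sum, map_zero] at this
        rw [← this]
        refine Finset.sum_congr rfl fun i _ => ?_
        rw [avg_apply, avg_apply, smul_mul_assoc, Finset.sum_mul]
        congr 1
        refine Finset.sum_congr rfl fun g _ => ?_
        rw [map_mul, fixed_of_mem_closure R ((hJ _).1 (hr i)) g.2, mul_comm]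
      have e2 := congrArg χ e1
      rw [map_sum, map_zero] at e2
      rw [hy, map_sum, coeff_sum, ← e2]
      refine Finset.sum_congr rfl fun i _ => ?_
      rw [map_smul, hχ _ (avg_mem _), coeff_smul, smul_eq_mul, mul_comm]
    have := sub_mem h5 h4
    rwa [sub_sub_cancel] at this

/-- Chevalley's theorem: a polynomial ring is free over the invariants of a finite group
generated by reflections, on a set of monomials. -/
theorem exists_monomial_basis (hJ : ∀ a, a ∈ J ↔ ∀ s ∈ R, s a = a)
    (hJh : ∀ a ∈ J, ∀ n, homogeneousComponent n a ∈ J)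
    (hfin : Finite (Subgroup.closure R))
    (hrefl : ∀ s ∈ R, ∃ ℓ : A, ℓ.IsHomogeneous 1 ∧ ℓ ≠ 0 ∧ ∀ f : A, ∃ g, s f - f = ℓ * g)
    (hdeg : ∀ s ∈ R, ∀ f : A, (s f).totalDegree ≤ f.totalDegree) :
    ∃ B : Set (κ →₀ ℕ), ∃ e : Module.Basis B J A, ∀ m, e m = monomial (m : κ →₀ ℕ) 1 := by
  obtain ⟨B', a, ha, hspan, hli⟩ := exists_linearIndependent' k
    (fun m : κ →₀ ℕ => Ideal.Quotient.mkₐ k (augIdeal J) (monomial m 1))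
  set B := Set.range a
  let v : B → A := fun m => monomial (m : κ →₀ ℕ) 1
  have hli' : LinearIndependent k fun m : B => Ideal.Quotient.mkₐ k (augIdeal J) (v m) := by
    rw [← linearIndependent_equiv (Equiv.ofInjective a ha)]
    exact hli
  have hspan' : ∀ f : A, ∃ x ∈ Submodule.span k (Set.range v), f - x ∈ augIdeal J := by
    intro f
    have h1 : Ideal.Quotient.mkₐ k (augIdeal J) f ∈ Submodule.span k (Set.range
        fun m : κ →₀ ℕ => Ideal.Quotient.mkₐ k (augIdeal J) (monomial m 1)) := by
      rw [f.as_sum, map_sum]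
      refine sum_mem fun m _ => ?_
      have : (monomial m (coeff m f) : A) = coeff m f • monomial m 1 := by
        rw [smul_monomial, smul_eq_mul, mul_one]
      rw [this, map_smul]
      exact Submodule.smul_mem _ _ (Submodule.subset_span ⟨m, rfl⟩)
    rw [← hspan] at h1
    have h2 : Set.range ((fun m : κ →₀ ℕ => Ideal.Quotient.mkₐ k (augIdeal J) (monomial m 1)) ∘ a)
        = (Ideal.Quotient.mkₐ k (augIdeal J)).toLinearMap '' Set.range v := by
      ext q; constructor
      · rintro ⟨i, rfl⟩; exact ⟨_, ⟨⟨a i, i, rfl⟩, rfl⟩, rfl⟩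
      · rintro ⟨_, ⟨⟨_, i, rfl⟩, rfl⟩, rfl⟩; exact ⟨i, rfl⟩
    rw [h2, ← Submodule.map_span] at h1
    obtain ⟨x, hx, hxf⟩ := h1
    exact ⟨x, hx, Ideal.Quotient.eq.1 hxf.symm⟩
  have hvli : LinearIndependent J v := by
    rw [linearIndependent_iff']
    classical
    intro t r hsum
    by_contra! hcon
    let r' : B → A := fun i => if i ∈ t then (r i : A) else 0
    have hr' : ∀ i, r' i ∈ J := by
      intro i; simp only [r']; split_ifs
      · exact (r i).2
      · exact zero_mem _
    have hex : ∃ d, ∃ i, ∃ m, coeff m (r' i) ≠ 0 ∧ m.degree = d := by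
      obtain ⟨i, hi, hri⟩ := hcon
      have : (r i : A) ≠ 0 := fun h => hri (Subtype.ext h)
      obtain ⟨m, hm⟩ := ne_zero_iff.1 this
      exact ⟨_, i, m, by simpa [r', hi] using hm, rfl⟩
    obtain ⟨i₀, m, hm, hmd⟩ := Nat.find_spec hex
    have hmin : ∀ i m', m'.degree < m.degree → coeff m' (r' i) = 0 := by
      intro i m' hlt
      by_contra h
      exact Nat.find_min hex (hmd ▸ hlt) ⟨i, m', h, rfl⟩
    have hχ : ∀ j ∈ J, ∀ i, lcoeff k m (j * r' i) = coeff 0 j * lcoeff k m (r' i) := by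
      intro j _ i
      rw [lcoeff_apply, lcoeff_apply, coeff_mul, Finset.sum_eq_single (0, m)]
      · rintro ⟨p, q⟩ hpq hne
        rw [Finset.HasAntidiagonal.mem_antidiagonal] at hpq
        simp only at hpq ⊢
        rw [hmin i q, mul_zero]
        rw [← hpq, map_add]
        have : p ≠ 0 := by
          rintro rfl; rw [zero_add] at hpq; exact hne (by rw [hpq])
        have : p.degree ≠ 0 := by rwa [Ne, Finsupp.degree_eq_zero_iff]
        omega
      · intro h; exact absurd (Finset.HasAntidiagonal.mem_antidiagonal.2 (zero_add m)) h
    have hrel : ∑ i ∈ t, r' i * v i = 0 := by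
      rw [← hsum]
      refine Finset.sum_congr rfl fun i hi => ?_
      simp [r', hi, Subalgebra.smul_def]
    obtain ⟨N, hN⟩ : ∃ N, ∀ i ∈ t, (v i).totalDegree < N :=
      ⟨t.sup (fun i => (v i).totalDegree) + 1, fun i hi =>
        Nat.lt_succ_of_le (Finset.le_sup (f := fun i => (v i).totalDegree) hi)⟩
    let v' : B → A := fun i => if i ∈ t then v i else 0
    have hv' : ∀ i ∈ t, v' i = v i := fun i hi => by simp [v', hi]
    have := sum_smul_mem_augIdeal hJ hfin hrefl hdeg t r' hr' (lcoeff k m) hχ N v'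
      (fun i => by
        by_cases h : i ∈ t
        · right; rw [hv' i h]; exact hN i h
        · left; simp [v', h])
      (by rw [← hrel]; exact Finset.sum_congr rfl fun i hi => by rw [hv' i hi])
    have h0 : ∑ i ∈ t, coeff m (r' i) • Ideal.Quotient.mkₐ k (augIdeal J) (v i) = 0 := by
      have h1 : Ideal.Quotient.mkₐ k (augIdeal J) (∑ i ∈ t, lcoeff k m (r' i) • v' i) = 0 :=
        Ideal.Quotient.eq_zero_iff_mem.2 this
      rw [map_sum] at h1
      rw [← h1]
      refine Finset.sum_congr rfl fun i hi => ?_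
      rw [map_smul, hv' i hi]; rfl
    have hi₀ : i₀ ∈ t := by
      by_contra h; simp [r', h] at hm
    exact hm (linearIndependent_iff'.1 hli' t _ h0 i₀ hi₀)
  have hvspan : ⊤ ≤ Submodule.span J (Set.range v) := by
    have key : ∀ n, ∀ f : A, f.IsHomogeneous n → f ∈ Submodule.span J (Set.range v) := by
      intro n
      induction n using Nat.strong_induction_on with
      | _ n ih =>
        intro f hf
        obtain ⟨x, hx, hxf⟩ := hspan' f
        have h1 := homogeneousComponent_mul_mem hJh _ n ih hxf
        rw [map_sub, homogeneousComponent_of_mem hf, if_pos rfl] at h1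
        have h2 : homogeneousComponent n x ∈ Submodule.span J (Set.range v) := by
          refine Submodule.span_induction
            (p := fun x _ => homogeneousComponent n x ∈ Submodule.span J (Set.range v))
            ?_ (by simp) (fun x y _ _ hx hy => ?_) (fun c x _ hx => ?_) hx
          · rintro _ ⟨m, rfl⟩
            rw [homogeneousComponent_of_mem (isHomogeneous_monomial 1 rfl)]
            split_ifs
            · exact Submodule.subset_span ⟨m, rfl⟩
            · exact zero_mem _
          · rw [map_add]; exact add_mem hx hy
          · rw [map_smul]
            exact Submodule.smul_of_tower_mem _ c hx
        have := add_mem h1 h2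
        rwa [sub_add_cancel] at this
    intro f _
    induction f using induction_homogeneous with
    | h n f hf => exact key n f hf
    | hadd f g hf hg => exact add_mem (hf trivial) (hg trivial)
  exact ⟨B, Module.Basis.mk hvli hvspan, fun m => by rw [Module.Basis.mk_apply]⟩

end Chevalley

section LinearAlgebra

variable {K V I : Type*} [Field K] [AddCommGroup V] [Module K V]

/-- A unitriangular perturbation of a basis is a basis. -/
lemma exists_basis_of_triangular (v : Module.Basis I K V) (v' : I → V) (d : I → ℕ)
    (h : ∀ i, v' i - v i ∈ Submodule.span K (v '' {j | d j < d i})) :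
    ∃ e : Module.Basis I K V, ∀ i, e i = v' i := by
  have hrepr : ∀ i j, ¬ d j < d i → v.repr (v' i - v i) j = 0 := by
    intro i j hij
    have := (v.mem_span_image).1 (h i)
    by_contra hne
    exact hij (this (Finsupp.mem_support_iff.2 hne))
  have hli : LinearIndependent K v' := by
    rw [linearIndependent_iff']
    classical
    intro t c hc
    by_contra! hcon
    obtain ⟨i₀, hi₀, hmax⟩ := Finset.exists_max_image (t.filter fun i => c i ≠ 0) d
      (by obtain ⟨i, hi, hci⟩ := hcon; exact ⟨i, Finset.mem_filter.2 ⟨hi, hci⟩⟩)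
    rw [Finset.mem_filter] at hi₀
    have h1 := congrArg (fun x => v.repr x i₀) hc
    simp only [map_sum, map_smul, Finsupp.coe_finsetSum, Finset.sum_apply, Finsupp.smul_apply,
      smul_eq_mul, map_zero, Finsupp.coe_zero, Pi.zero_apply] at h1
    have h2 : ∀ i, v.repr (v' i) i₀ = v.repr (v' i - v i) i₀ + if i = i₀ then 1 else 0 := by
      intro i
      have : v' i = (v' i - v i) + v i := by abel
      conv_lhs => rw [this]
      rw [map_add, Finsupp.add_apply, v.repr_self, Finsupp.single_apply]
    have h3 : ∀ i ∈ t, c i * v.repr (v' i) i₀ = if i = i₀ then c i else 0 := by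
      intro i hi
      by_cases hci : c i = 0
      · simp [hci]
      · rw [h2, hrepr i i₀ (not_lt.2 (hmax i (Finset.mem_filter.2 ⟨hi, hci⟩)))]
        simp
    rw [Finset.sum_congr rfl h3, Finset.sum_ite_eq_of_mem' _ _ _ hi₀.1] at h1
    exact hi₀.2 h1
  have hsp : ∀ n, ∀ i, d i < n → v i ∈ Submodule.span K (Set.range v') := by
    intro n
    induction n with
    | zero => intro i hi; omega
    | succ n ih =>
      intro i hi
      have h1 : Submodule.span K (v '' {j | d j < d i}) ≤ Submodule.span K (Set.range v') := by
        rw [Submodule.span_le]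
        rintro _ ⟨j, hj, rfl⟩
        exact ih j (lt_of_lt_of_le hj (Nat.lt_succ_iff.1 hi))
      have := sub_mem (Submodule.subset_span ⟨i, rfl⟩ : v' i ∈ Submodule.span K (Set.range v'))
        (h1 (h i))
      rwa [sub_sub_cancel] at this
  refine ⟨Module.Basis.mk hli ?_, fun i => by rw [Module.Basis.mk_apply]⟩
  rw [← v.span_eq, Submodule.span_le]
  rintro _ ⟨i, rfl⟩
  exact hsp _ i (Nat.lt_succ_self _)

lemma free_of_basis_mul {R C D : Type*} [Ring R] [Algebra K R] (Z : Subalgebra K R)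
    (z : Module.Basis C K Z) (x : D → R) (w : Module.Basis (C × D) K R)
    (hw : ∀ c d, w (c, d) = (z c : R) * x d) : Module.Free Z R := by
  let T : (D →₀ Z) →ₗ[Z] R := Finsupp.linearCombination Z x
  let e : Module.Basis (Σ _ : D, C) K (D →₀ Z) := Finsupp.basis fun _ => z
  let r : (Σ _ : D, C) ≃ C × D := (Equiv.sigmaEquivProd D C).trans (Equiv.prodComm D C)
  let E : (D →₀ Z) ≃ₗ[K] R := e.equiv w r
  have h : ∀ y, T y = E y := by
    have : T.restrictScalars K = E.toLinearMap := by
      refine e.ext fun ⟨d, c⟩ => ?_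
      rw [LinearEquiv.coe_coe, Module.Basis.equiv_apply]
      have h1 : e ⟨d, c⟩ = Finsupp.single d (z c) := by simp [e]
      have h2 : r ⟨d, c⟩ = (c, d) := rfl
      rw [h1, h2, hw, LinearMap.restrictScalars_apply]
      simp [T, Subalgebra.smul_def]
    exact fun y => LinearMap.congr_fun this y
  have hb : Function.Bijective T := by
    have : (T : (D →₀ Z) → R) = E := funext h
    rw [this]; exact E.bijective
  exact Module.Free.of_equiv (LinearEquiv.ofBijective T hb)

/-- In a basis of weighted homogeneous polynomials, a weighted homogeneous polynomial only
involves basis elements of its own degree. -/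
lemma mem_span_of_isWeightedHomogeneous {σ : Type*} (w : σ → ℕ)
    (v : Module.Basis I K (MvPolynomial σ K)) (d : I → ℕ)
    (hv : ∀ i, IsWeightedHomogeneous w (v i) (d i)) {p : MvPolynomial σ K} {n : ℕ}
    (hp : IsWeightedHomogeneous w p n) :
    p ∈ Submodule.span K (v '' {i | d i = n}) := by
  classical
  have h1 : ∀ q : MvPolynomial σ K, weightedHomogeneousComponent w n q ∈
      Submodule.span K (v '' {i | d i = n}) := by
    intro q
    have := v.mem_span q
    refine Submodule.span_induction (p := fun q _ => weightedHomogeneousComponent w n q ∈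
      Submodule.span K (v '' {i | d i = n})) ?_ (by simp) (fun x y _ _ hx hy => ?_)
      (fun c x _ hx => ?_) this
    · rintro _ ⟨i, rfl⟩
      by_cases h : d i = n
      · rw [(h ▸ hv i : IsWeightedHomogeneous w (v i) n).weightedHomogeneousComponent_same]
        exact Submodule.subset_span ⟨i, h, rfl⟩
      · rw [(hv i).weightedHomogeneousComponent_ne n (Ne.symm h)]
        exact zero_mem _
    · rw [map_add]; exact add_mem hx hy
    · rw [map_smul]; exact Submodule.smul_mem _ _ hx
  have := h1 p
  rwa [hp.weightedHomogeneousComponent_same] at this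

end LinearAlgebra

section Invariants

variable {K L ι : Type*} [Field K] [LieRing L] [LieAlgebra K L]

/-- The invariant polynomials under the adjoint action. -/
def invariants (b : Module.Basis ι K L) : Subalgebra K (MvPolynomial ι K) where
  carrier := {f | ∀ x, adDer b x f = 0}
  mul_mem' hf hg x := by simp [hf x, hg x]
  add_mem' hf hg x := by simp [hf x, hg x]
  algebraMap_mem' c x := by simp

lemma mem_invariants (b : Module.Basis ι K L) {f : MvPolynomial ι K} :
    f ∈ invariants b ↔ ∀ x, adDer b x f = 0 := Iff.rfl

lemma adDer_homogeneousComponent [Fintype ι] (b : Module.Basis ι K L) (x : L) (n : ℕ)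
    (f : MvPolynomial ι K) :
    adDer b x (homogeneousComponent n f) = homogeneousComponent n (adDer b x f) := by
  induction f using induction_homogeneous with
  | h m f hf =>
    rw [homogeneousComponent_of_mem hf, homogeneousComponent_of_mem (adDer_isHomogeneous b x hf)]
    split_ifs <;> simp
  | hadd f g hf hg => simp [hf, hg]

lemma homogeneousComponent_mem_invariants [Fintype ι] (b : Module.Basis ι K L) (n : ℕ)
    {f : MvPolynomial ι K} (hf : f ∈ invariants b) :
    homogeneousComponent n f ∈ invariants b := fun x => by
  rw [adDer_homogeneousComponent, hf x, map_zero]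

lemma mem_center_iff (a : UniversalEnvelopingAlgebra K L) :
    a ∈ Subalgebra.center K (UniversalEnvelopingAlgebra K L) ↔
      ∀ x : L, UniversalEnvelopingAlgebra.ι K x * a = a * UniversalEnvelopingAlgebra.ι K x := by
  rw [Subalgebra.mem_center_iff]
  refine ⟨fun h x => h _, fun h c => ?_⟩
  have : (⊤ : Subalgebra K (UniversalEnvelopingAlgebra K L)) ≤ Subalgebra.centralizer K {a} := by
    let S := Subalgebra.centralizer K {a}
    have hS : ∀ x : L, UniversalEnvelopingAlgebra.ι K x ∈ S := fun x => by
      rw [Subalgebra.mem_centralizer_iff]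
      rintro _ rfl
      exact (h x).symm
    let φ : L →ₗ⁅K⁆ S :=
      { toFun := fun x => ⟨UniversalEnvelopingAlgebra.ι K x, hS x⟩
        map_add' := fun x y => Subtype.ext (map_add _ x y)
        map_smul' := fun c x => Subtype.ext (map_smul _ c x)
        map_lie' := fun {x y} => Subtype.ext (ι_lie x y) }
    have h2 : S.val.comp (UniversalEnvelopingAlgebra.lift K φ) =
        AlgHom.id K (UniversalEnvelopingAlgebra K L) := by
      refine UniversalEnvelopingAlgebra.hom_ext (R := K) (L := L) ?_
      ext x
      change ((UniversalEnvelopingAlgebra.lift K φ (UniversalEnvelopingAlgebra.ι K x) : S) :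
        UniversalEnvelopingAlgebra K L) = UniversalEnvelopingAlgebra.ι K x
      rw [UniversalEnvelopingAlgebra.lift_ι_apply]
      rfl
    intro c _
    have := (UniversalEnvelopingAlgebra.lift K φ c).2
    rwa [show ((UniversalEnvelopingAlgebra.lift K φ c : S) : UniversalEnvelopingAlgebra K L) = c
      from AlgHom.congr_fun h2 c] at this
  exact ((Subalgebra.mem_centralizer_iff K).1 (this (Algebra.mem_top (x := c))) a rfl).symm

lemma sym_mem_center_iff [Fintype ι] [CharZero K] (b : Module.Basis ι K L)
    (hinj : Function.Injective (sym b)) (f : MvPolynomial ι K) :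
    sym b f ∈ Subalgebra.center K (UniversalEnvelopingAlgebra K L) ↔ f ∈ invariants b := by
  rw [mem_center_iff, mem_invariants]
  refine forall_congr' fun x => ?_
  rw [← sub_eq_zero, commutator_sym, map_eq_zero_iff _ hinj]

end Invariants

section Assembly

variable {K L κ Φ : Type*} [Field K] [LieRing L] [LieAlgebra K L]

/-- Restriction of polynomials to the variables in `κ`. -/
def res (K κ Φ : Type*) [Field K] : MvPolynomial (Φ ⊕ κ) K →ₐ[K] MvPolynomial κ K :=
  aeval (Sum.elim 0 X)

/-- Extension of polynomials in the variables `κ`. -/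
def inr (K κ Φ : Type*) [Field K] : MvPolynomial κ K →ₐ[K] MvPolynomial (Φ ⊕ κ) K :=
  rename Sum.inr

/-- The weight giving degree one to the variables in `κ` and zero to those in `Φ`. -/
def hWeight : Φ ⊕ κ → ℕ := Sum.elim 0 1

lemma isWeightedHomogeneous_inr {p : MvPolynomial κ K} {n : ℕ} (hp : p.IsHomogeneous n) :
    IsWeightedHomogeneous hWeight (inr K κ Φ p) n := by
  rw [p.as_sum, map_sum]
  refine (weightedHomogeneousSubmodule K (hWeight (Φ := Φ)) n).sum_mem fun s hs => ?_
  rw [mem_weightedHomogeneousSubmodule, inr, rename_monomial]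
  refine isWeightedHomogeneous_monomial _ _ _ ?_
  have h := hp (mem_support_iff.1 hs)
  rw [← h, Finsupp.weight_apply, Finsupp.weight_apply,
    Finsupp.sum_mapDomain_index (fun _ => by simp) (fun _ _ _ => by simp [add_mul])]
  rfl

lemma isHomogeneous_inr {p : MvPolynomial κ K} {n : ℕ} (hp : p.IsHomogeneous n) :
    (inr K κ Φ p).IsHomogeneous n := hp.rename_isHomogeneous

/-- The difference between an invariant and its restriction has smaller degree in `κ`. -/
lemma sub_inr_res_mem (d : ℕ) {p : MvPolynomial (Φ ⊕ κ) K} (hp : p.IsHomogeneous d) :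
    p - inr K κ Φ (res K κ Φ p) ∈
      Submodule.span K {q | ∃ k < d, IsWeightedHomogeneous hWeight q k} := by
  suffices h : ∀ s : (Φ ⊕ κ) →₀ ℕ, s.degree = d → monomial s (1 : K) -
      inr K κ Φ (res K κ Φ (monomial s 1)) ∈
      Submodule.span K {q | ∃ k < d, IsWeightedHomogeneous hWeight q k} by
    rw [p.as_sum, map_sum, map_sum, ← Finset.sum_sub_distrib]
    refine sum_mem fun s hs => ?_
    have h1 : (monomial s (coeff s p)) = coeff s p • monomial s (1 : K) := by
      rw [smul_monomial, smul_eq_mul, mul_one]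
    rw [h1, map_smul, map_smul, ← smul_sub]
    refine Submodule.smul_mem _ _ (h s ?_)
    have := hp (mem_support_iff.1 hs)
    rw [← this, Finsupp.degree_eq_weight_one]; rfl
  intro s hs
  by_cases hΦ : ∃ α, s (Sum.inl α) ≠ 0
  · obtain ⟨α, hα⟩ := hΦ
    have h0 : res K κ Φ (monomial s 1) = 0 := by
      rw [res, aeval_monomial, Finsupp.prod, Finset.prod_eq_zero (i := Sum.inl α), mul_zero]
      · simpa using hα
      · simp [hα]
    rw [h0, map_zero, sub_zero]
    refine Submodule.subset_span ⟨_, ?_, isWeightedHomogeneous_monomial hWeight s 1 rfl⟩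
    rw [← hs, Finsupp.weight_apply, Finsupp.sum, Finsupp.degree_apply]
    refine Finset.sum_lt_sum (fun i _ => ?_) ⟨Sum.inl α, by simpa using hα, ?_⟩
    · rcases i with i | i <;> simp [hWeight]
    · simp [hWeight]; omega
  · push Not at hΦ
    have h0 : inr K κ Φ (res K κ Φ (monomial s 1)) = monomial s 1 := by
      rw [res, aeval_monomial, map_one, one_mul, Finsupp.prod, map_prod, monomial_eq, C_1, one_mul,
        Finsupp.prod]
      refine Finset.prod_congr rfl fun i hi => ?_
      rcases i with i | i
      · simp [hΦ i] at hi
      · simp [inr]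
    rw [h0, sub_self]; exact zero_mem _

variable [Fintype κ] [Fintype Φ] [CharZero K]

/-- The reduction of Kostant's theorem to a statement about polynomials. -/
theorem free_center_of_restriction (b : Module.Basis (Φ ⊕ κ) K L)
    (had : Function.Injective (LieAlgebra.ad K L))
    (hres : ∀ f ∈ invariants b, res K κ Φ f = 0 → f = 0)
    {J : Subalgebra K (MvPolynomial κ K)} (hJ : J = (invariants b).map (res K κ Φ))
    (B : Set (κ →₀ ℕ)) (e : Module.Basis B J (MvPolynomial κ K))
    (he : ∀ m, e m = monomial (m : κ →₀ ℕ) 1) :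
    Module.Free (Subalgebra.center K (UniversalEnvelopingAlgebra K L))
      (UniversalEnvelopingAlgebra K L) := by
  have hsym : Function.Injective (sym b) := by
    classical exact sym_injective b had
  -- a homogeneous basis of the invariants
  obtain ⟨C, hCsub, hCspan, hCli⟩ := exists_linearIndependent K
    {f | f ∈ invariants b ∧ ∃ n, f.IsHomogeneous n}
  have hCspan' : Submodule.span K C = Subalgebra.toSubmodule (invariants b) := by
    rw [hCspan]
    refine le_antisymm (Submodule.span_le.2 fun f hf => hf.1) fun f hf => ?_
    rw [← sum_homogeneousComponent f]
    exact sum_mem fun n _ => Submodule.subset_span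
      ⟨homogeneousComponent_mem_invariants b n hf, n, homogeneousComponent_isHomogeneous n f⟩
  choose deg hdeg using fun c : C => (hCsub c.2).2
  have hCinv : ∀ c : C, (c : MvPolynomial (Φ ⊕ κ) K) ∈ invariants b := fun c => (hCsub c.2).1
  -- its image in the restricted invariants
  have hJmem : ∀ a, a ∈ J ↔ ∃ f ∈ invariants b, res K κ Φ f = a := fun a => by
    rw [hJ]; rfl
  obtain ⟨jb, hjb⟩ : ∃ jb : Module.Basis C K J, ∀ c, (jb c : MvPolynomial κ K) = res K κ Φ c := by
    let v : C → J := fun c => ⟨res K κ Φ c, (hJmem _).2 ⟨c, hCinv c, rfl⟩⟩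
    have hli : LinearIndependent K v := by
      rw [linearIndependent_iff']
      intro t r hr i hi
      refine linearIndependent_iff'.1 hCli t r ?_ i hi
      refine hres _ (sum_mem fun c _ => Subalgebra.smul_mem _ (hCinv c) _) ?_
      have := congrArg (Subalgebra.val J) hr
      rw [map_sum, map_zero] at this
      rw [map_sum, ← this]
      refine Finset.sum_congr rfl fun c _ => ?_
      rw [map_smul, map_smul]; rfl
    refine ⟨Module.Basis.mk hli ?_, fun c => by rw [Module.Basis.mk_apply]⟩
    rintro ⟨a, ha⟩ -
    obtain ⟨f, hf, rfl⟩ := (hJmem a).1 ha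
    have hf' : f ∈ Submodule.span K C := by rw [hCspan']; exact hf
    have h1 : res K κ Φ f ∈ Submodule.map (Subalgebra.val J).toLinearMap
        (Submodule.span K (Set.range v)) := by
      rw [Submodule.map_span]
      have h2 : res K κ Φ f ∈ Submodule.map (res K κ Φ).toLinearMap (Submodule.span K C) :=
        ⟨f, hf', rfl⟩
      rw [Submodule.map_span] at h2
      refine Submodule.span_mono ?_ h2
      rintro _ ⟨c, hc, rfl⟩
      exact ⟨v ⟨c, hc⟩, ⟨_, rfl⟩, rfl⟩
    obtain ⟨y, hy, hyf⟩ := h1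
    have : y = ⟨res K κ Φ f, ha⟩ := Subtype.ext hyf
    rw [← this]
    exact hy
  -- a basis of the polynomial ring adapted to the restricted invariants
  let D := B × (Φ →₀ ℕ)
  let x : D → MvPolynomial (Φ ⊕ κ) K := fun d =>
    inr K κ Φ (monomial (d.1 : κ →₀ ℕ) 1) * rename Sum.inl (monomial d.2 1)
  let xdeg : D → ℕ := fun d => (d.1 : κ →₀ ℕ).degree + d.2.degree
  have hx : ∀ d, (x d).IsHomogeneous (xdeg d) := fun d =>
    (isHomogeneous_inr (isHomogeneous_monomial 1 rfl)).mul
      (isHomogeneous_monomial 1 rfl).rename_isHomogeneous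
  have hxw : ∀ d, IsWeightedHomogeneous hWeight (x d) (d.1 : κ →₀ ℕ).degree := fun d => by
    have h1 : IsWeightedHomogeneous (hWeight (κ := κ)) (rename Sum.inl (monomial d.2 (1 : K)))
        0 := by
      rw [rename_monomial]
      refine isWeightedHomogeneous_monomial _ _ _ ?_
      rw [Finsupp.weight_apply, Finsupp.sum_mapDomain_index (fun _ => by simp) (fun _ _ _ => by simp [add_mul])]
      simp [hWeight]
    simpa using (isWeightedHomogeneous_inr (isHomogeneous_monomial 1 rfl)).mul h1
  obtain ⟨v, hv⟩ : ∃ v : Module.Basis (C × D) K (MvPolynomial (Φ ⊕ κ) K),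
      ∀ c d, v (c, d) = inr K κ Φ (res K κ Φ c) * x d := by
    let a : Module.Basis (C × B) K (MvPolynomial κ K) := jb.smulTower e
    let q : Module.Basis ((C × B) × (Φ →₀ ℕ)) K (MvPolynomial Φ (MvPolynomial κ K)) :=
      a.smulTower (basisMonomials Φ (MvPolynomial κ K))
    refine ⟨(q.map (sumAlgEquiv K Φ κ).symm.toLinearEquiv).reindex (Equiv.prodAssoc C B _),
      fun c d => ?_⟩
    rw [Module.Basis.reindex_apply, Module.Basis.map_apply]
    change (sumAlgEquiv K Φ κ).symm (q ((c, d.1), d.2)) = _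
    rw [AlgEquiv.symm_apply_eq]
    simp only [q, a, Module.Basis.smulTower_apply, he, coe_basisMonomials, x, map_mul]
    have h1 : ∀ p : MvPolynomial κ K, sumAlgEquiv K Φ κ (inr K κ Φ p) = MvPolynomial.C p := fun p =>
      AlgHom.congr_fun (sumAlgEquiv_comp_rename_inr (R := K) (S₁ := Φ) (S₂ := κ)) p
    have h2 : ∀ p : MvPolynomial Φ K, sumAlgEquiv K Φ κ (rename Sum.inl p) =
        MvPolynomial.map (algebraMap K (MvPolynomial κ K)) p := fun p =>
      AlgHom.congr_fun (sumAlgEquiv_comp_rename_inl (R := K) (S₁ := Φ) (S₂ := κ)) p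
    rw [h1, h1, h2, Subalgebra.smul_def, hjb, map_monomial,
      map_one (algebraMap K (MvPolynomial κ K)), ← mul_assoc, ← MvPolynomial.C_mul,
      MvPolynomial.smul_eq_C_mul, smul_eq_mul]
  -- replacing restrictions by the invariants themselves
  obtain ⟨v', hv'⟩ : ∃ v' : Module.Basis (C × D) K (MvPolynomial (Φ ⊕ κ) K),
      ∀ i, v' i = (i.1 : MvPolynomial (Φ ⊕ κ) K) * x i.2 := by
    refine exists_basis_of_triangular v _ (fun i => deg i.1 + (i.2.1 : κ →₀ ℕ).degree) ?_
    rintro ⟨c, d⟩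
    rw [hv, ← sub_mul]
    have hw : ∀ i, IsWeightedHomogeneous hWeight (v i) (deg i.1 + (i.2.1 : κ →₀ ℕ).degree) := by
      rintro ⟨c, d⟩
      rw [hv]
      refine (isWeightedHomogeneous_inr ?_).mul (hxw d)
      have := (hdeg c).aeval (Sum.elim 0 X : Φ ⊕ κ → MvPolynomial κ K) (n := 1) (fun i => by
        rcases i with i | i
        · exact isHomogeneous_zero _ _ _
        · exact isHomogeneous_X _ _)
      rwa [one_mul] at this
    refine Submodule.span_induction (p := fun p _ => p * x d ∈ Submodule.span K
      (v '' {j | deg j.1 + (j.2.1 : κ →₀ ℕ).degree < deg c + (d.1 : κ →₀ ℕ).degree})) ?_ (by simp)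
      (fun p q _ _ hp hq => ?_) (fun r p _ hp => ?_) (sub_inr_res_mem (deg c) (hdeg c))
    · rintro p ⟨k, hk, hp⟩
      refine Submodule.span_mono (Set.image_mono fun j hj => ?_)
        (mem_span_of_isWeightedHomogeneous hWeight v _ hw (hp.mul (hxw d)))
      simp only [Set.mem_ofPred_eq] at hj ⊢
      omega
    · rw [add_mul]; exact add_mem hp hq
    · rw [smul_mul_assoc]; exact Submodule.smul_mem _ _ hp
  -- passing to the enveloping algebra through symmetrization
  let E : MvPolynomial (Φ ⊕ κ) K ≃ₗ[K] UniversalEnvelopingAlgebra K L :=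
    LinearEquiv.ofBijective (sym b) ⟨hsym, sym_surjective b⟩
  obtain ⟨w, hw⟩ : ∃ w : Module.Basis (C × D) K (UniversalEnvelopingAlgebra K L),
      ∀ i, w i = sym b i.1 * sym b (x i.2) := by
    refine exists_basis_of_triangular (v'.map E) _ (fun i => deg i.1 + xdeg i.2) ?_
    rintro ⟨c, d⟩
    have h1 := sym_mul_sub_mem b (hdeg c) (hx d)
    have h2 : degLT K (Φ ⊕ κ) (deg c + xdeg d) ≤
        Submodule.span K (Set.image v' {j | deg j.1 + xdeg j.2 < deg c + xdeg d}) := by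
      refine Submodule.span_le.2 ?_
      rintro p ⟨k, hk, hp⟩
      refine Submodule.span_mono (Set.image_mono fun j hj => ?_)
        (mem_span_of_isWeightedHomogeneous 1 v' (fun i => deg i.1 + xdeg i.2) (fun i => ?_) hp)
      · simp only [Set.mem_ofPred_eq] at hj ⊢
        omega
      · rw [hv']
        exact (hdeg i.1).mul (hx i.2)
    have h3 := Submodule.map_mono (f := sym b) h2 h1
    rw [Submodule.map_span, ← Set.image_comp] at h3
    rw [Module.Basis.map_apply, hv']
    exact h3
  -- the invariants give a basis of the center
  obtain ⟨z, hz⟩ : ∃ z : Module.Basis C K (Subalgebra.center K (UniversalEnvelopingAlgebra K L)),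
      ∀ c, (z c : UniversalEnvelopingAlgebra K L) = sym b c := by
    let v : C → Subalgebra.center K (UniversalEnvelopingAlgebra K L) := fun c =>
      ⟨sym b c, (sym_mem_center_iff b hsym _).2 (hCinv c)⟩
    have hli : LinearIndependent K v := by
      refine LinearIndependent.of_comp (Subalgebra.val _).toLinearMap ?_
      exact hCli.map' (sym b) (LinearMap.ker_eq_bot.2 hsym)
    refine ⟨Module.Basis.mk hli ?_, fun c => by rw [Module.Basis.mk_apply]⟩
    rintro ⟨a, ha⟩ -
    obtain ⟨f, rfl⟩ := sym_surjective b a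
    have hf' : f ∈ Submodule.span K C := by
      rw [hCspan']; exact (sym_mem_center_iff b hsym _).1 ha
    have h1 : sym b f ∈ Submodule.map (Subalgebra.val
        (Subalgebra.center K (UniversalEnvelopingAlgebra K L))).toLinearMap
        (Submodule.span K (Set.range v)) := by
      rw [Submodule.map_span]
      have h2 : sym b f ∈ Submodule.map (sym b) (Submodule.span K C) := ⟨f, hf', rfl⟩
      rw [Submodule.map_span] at h2
      refine Submodule.span_mono ?_ h2
      rintro _ ⟨c, hc, rfl⟩
      exact ⟨v ⟨c, hc⟩, ⟨_, rfl⟩, rfl⟩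
    obtain ⟨y, hy, hyf⟩ := h1
    have : y = ⟨sym b f, ha⟩ := Subtype.ext hyf
    rwa [← this]
  exact free_of_basis_mul _ z (fun d => sym b (x d)) w fun c d => by rw [hw, hz]

end Assembly

end

noncomputable section

open MvPolynomial

section SymMap

variable {K V V' V'' ι ι' ι'' : Type*} [Field K] [AddCommGroup V] [Module K V]
  [AddCommGroup V'] [Module K V'] [AddCommGroup V''] [Module K V'']

/-- The map on symmetric algebras induced by a linear map, in coordinates. -/
def polyMap (b : Module.Basis ι K V) (b' : Module.Basis ι' K V') (g : V →ₗ[K] V') :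
    MvPolynomial ι K →ₐ[K] MvPolynomial ι' K :=
  aeval fun i => linForm b' (g (b i))

lemma polyMap_linForm (b : Module.Basis ι K V) (b' : Module.Basis ι' K V') (g : V →ₗ[K] V')
    (v : V) : polyMap b b' g (linForm b v) = linForm b' (g v) := by
  have : (polyMap b b' g).toLinearMap ∘ₗ linForm b = linForm b' ∘ₗ g :=
    b.ext fun i => by simp [polyMap]
  exact LinearMap.congr_fun this v

lemma polyMap_comp (b : Module.Basis ι K V) (b' : Module.Basis ι' K V')
    (b'' : Module.Basis ι'' K V'') (g : V →ₗ[K] V') (g' : V' →ₗ[K] V'') :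
    (polyMap b' b'' g').comp (polyMap b b' g) = polyMap b b'' (g' ∘ₗ g) := by
  refine algHom_ext fun i => ?_
  rw [← linForm_basis b, AlgHom.comp_apply, polyMap_linForm, polyMap_linForm, polyMap_linForm]
  rfl

lemma polyMap_id (b : Module.Basis ι K V) : polyMap b b LinearMap.id = AlgHom.id K _ := by
  refine algHom_ext fun i => ?_
  rw [← linForm_basis b, polyMap_linForm]; rfl

lemma linForm_injective (b : Module.Basis ι K V) : Function.Injective (linForm b) := by
  classical
  rw [injective_iff_map_eq_zero]
  intro v hv
  refine b.ext_elem fun i => ?_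
  have h1 : lcoeff K (Finsupp.single i 1) ∘ₗ linForm b = b.coord i := by
    refine b.ext fun j => ?_
    simp [lcoeff_apply, coeff_X, Finsupp.single_left_inj, Finsupp.single_apply]
  have h2 := LinearMap.congr_fun h1 v
  rw [LinearMap.comp_apply, hv, map_zero] at h2
  rw [map_zero]
  exact h2.symm

/-- The action of linear automorphisms on the symmetric algebra. -/
def polyEquiv (b : Module.Basis ι K V) :
    (V ≃ₗ[K] V) →* (MvPolynomial ι K ≃ₐ[K] MvPolynomial ι K) where
  toFun g := AlgEquiv.ofAlgHom (polyMap b b g) (polyMap b b g.symm)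
    (by rw [polyMap_comp, ← polyMap_id b]; congr 1; ext; simp)
    (by rw [polyMap_comp, ← polyMap_id b]; congr 1; ext; simp)
  map_one' := by
    ext1 f
    exact AlgHom.congr_fun (polyMap_id b) f
  map_mul' g h := by
    ext1 f
    exact (AlgHom.congr_fun (polyMap_comp b b b (h : V →ₗ[K] V) g) f).symm

lemma polyEquiv_apply (b : Module.Basis ι K V) (g : V ≃ₗ[K] V) (f : MvPolynomial ι K) :
    polyEquiv b g f = polyMap b b g f := rfl

lemma polyEquiv_linForm (b : Module.Basis ι K V) (g : V ≃ₗ[K] V) (v : V) :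
    polyEquiv b g (linForm b v) = linForm b (g v) := polyMap_linForm b b _ v

end SymMap

section DualNumbers

variable {K P : Type*} [CommRing K] [CommRing P] [Algebra K P]

/-- The ring homomorphism to dual numbers defined by a derivation. -/
def dualHom (D : Derivation K P P) : P →+* DualNumber P where
  toFun f := TrivSqZeroExt.inl f + TrivSqZeroExt.inr (D f)
  map_one' := by simp
  map_mul' f g := by
    ext
    · simp
    · simp [mul_comm]
  map_zero' := by simp
  map_add' f g := by
    ext <;> simp

lemma snd_dualHom (D : Derivation K P P) (f : P) : (dualHom D f).snd = D f := by simp [dualHom]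

variable {n : Type*}

lemma map_dualHom (D : Derivation K P P) (M : Matrix n n P) :
    M.map (dualHom D) = M.map (TrivSqZeroExt.inlHom P P) +
      (DualNumber.eps : DualNumber P) • (M.map D).map (TrivSqZeroExt.inlHom P P) := by
  ext i j <;> simp [dualHom, TrivSqZeroExt.inlHom]

variable [Fintype n] [DecidableEq n]

/-- Infinitesimal conjugation invariance of the characteristic polynomial. -/
lemma derivation_charpoly_coeff (D : Derivation K P P) (M Y : Matrix n n P)
    (h : M.map D = M * Y - Y * M) (k : ℕ) : D (M.charpoly.coeff k) = 0 := by
  let i := TrivSqZeroExt.inlHom P P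
  let ε : DualNumber P := DualNumber.eps
  have hε : ε * ε = 0 := DualNumber.eps_mul_eps
  have hsm : ∀ A B : Matrix n n (DualNumber P), (ε • A) * (ε • B) = 0 := fun A B => by
    rw [smul_mul_smul_comm, hε, zero_smul]
  let u : (Matrix n n (DualNumber P))ˣ :=
    { val := 1 - ε • Y.map i
      inv := 1 + ε • Y.map i
      val_inv := by
        rw [sub_mul, one_mul, mul_add, hsm, mul_one]; abel
      inv_val := by
        rw [add_mul, one_mul, mul_sub, hsm, mul_one]; abel }
  have h1 : M.map (dualHom D) = u.val * M.map i * u⁻¹.val := by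
    rw [map_dualHom, h]
    change _ = (1 - ε • Y.map i) * M.map i * (1 + ε • Y.map i)
    have h2 : (M * Y - Y * M).map i = M.map i * Y.map i - Y.map i * M.map i := by
      rw [← Matrix.map_mul, ← Matrix.map_mul, Matrix.map_sub]
      exact map_sub i
    rw [h2, sub_mul, one_mul, mul_add, mul_one, sub_mul]
    rw [smul_mul_assoc ε (Y.map i), hsm, mul_smul_comm, smul_sub]
    change M.map i + (ε • _ - ε • _) = _
    abel
  have h3 : M.charpoly.map (dualHom D) = M.charpoly.map i := by
    rw [← Matrix.charpoly_map, ← Matrix.charpoly_map]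
    rw [h1, Matrix.coe_units_inv, Matrix.charpoly_units_conj]
  have h4 := congrArg (fun p => (Polynomial.coeff p k).snd) h3
  simp only [Polynomial.coeff_map, snd_dualHom] at h4
  rw [h4]; rfl

/-- Jacobi's formula for linear flows. -/
lemma derivation_det (D : Derivation K P P) (M N : Matrix n n P) (h : M.map D = N * M) :
    D M.det = N.trace * M.det := by
  let i := TrivSqZeroExt.inlHom P P
  let ε : DualNumber P := DualNumber.eps
  have hε : ε * ε = 0 := DualNumber.eps_mul_eps
  have h1 : dualHom D M.det = (1 + ε * i N.trace) * i M.det := by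
    rw [RingHom.map_det, RingHom.map_det]
    rw [show (dualHom D).mapMatrix M = M.map (dualHom D) from rfl, map_dualHom, h]
    have h2 : M.map i + ε • (N * M).map i = (1 + ε • N.map i) * i.mapMatrix M := by
      rw [Matrix.map_mul, add_mul, one_mul, smul_mul_assoc]; rfl
    rw [h2, Matrix.det_mul, Matrix.det_one_add_smul, pow_two, hε, mul_zero, add_zero]
    congr 2
    rw [mul_comm]
    congr 1
    simp [Matrix.trace, map_sum]
  have h3 := congrArg TrivSqZeroExt.snd h1
  rw [snd_dualHom] at h3
  rw [h3]
  simp [ε, i, TrivSqZeroExt.inlHom]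

end DualNumbers

section Flow

variable {K σ : Type*} [Field K] [CharZero K]

/-- A polynomial killed by a derivation is fixed by its flow. -/
lemma eval_flow_eq (D : Derivation K (MvPolynomial σ K) (MvPolynomial σ K))
    (Θ : MvPolynomial σ K →ₐ[K] Polynomial (MvPolynomial σ K))
    (hΘ : ∀ j, Polynomial.derivative (Θ (X j)) = Θ (D (X j)))
    (h0 : ∀ j, (Θ (X j)).eval 0 = X j) {f : MvPolynomial σ K} (hf : D f = 0)
    (p : MvPolynomial σ K) : (Θ f).eval p = f := by
  have h1 : ∀ f, Polynomial.derivative (Θ f) = Θ (D f) := fun f => by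
    induction f using MvPolynomial.induction_on with
    | C a => rw [← algebraMap_eq, AlgHom.commutes, Derivation.map_algebraMap, map_zero,
        Polynomial.algebraMap_apply, Polynomial.derivative_C]
    | add f g hf hg => simp [hf, hg]
    | mul_X f j hf =>
      rw [map_mul, Polynomial.derivative_mul, hf, hΘ, Derivation.leibniz, map_add, smul_eq_mul,
        smul_eq_mul, map_mul, map_mul]
      ring
  have h2 : ∀ f, (Θ f).eval 0 = f := fun f => by
    induction f using MvPolynomial.induction_on with
    | C a => rw [← algebraMap_eq, AlgHom.commutes, Polynomial.algebraMap_apply, Polynomial.eval_C]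
    | add f g hf hg => simp [hf, hg]
    | mul_X f j hf => rw [map_mul, Polynomial.eval_mul, hf, h0]
  have h3 : Polynomial.derivative (Θ f) = 0 := by rw [h1, hf, map_zero]
  rw [Polynomial.eq_C_of_derivative_eq_zero h3, Polynomial.eval_C, Polynomial.coeff_zero_eq_eval_zero,
    h2]

end Flow

section ResInjective

variable {K L κ Φ : Type*} [Field K] [LieRing L] [LieAlgebra K L]

/-- The weight giving degree zero to the variables in `κ` and one to those in `Φ`. -/
def rootWeight : Φ ⊕ κ → ℕ := Sum.elim 1 0

lemma linForm_mem_of_mem_span (b : Module.Basis (Φ ⊕ κ) K L) {τ : Type*} (f : τ → Φ ⊕ κ) (n : ℕ)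
    (hf : ∀ i, rootWeight (f i) = n) {z : L} (hz : z ∈ Submodule.span K (Set.range (b ∘ f))) :
    IsWeightedHomogeneous rootWeight (linForm b z) n := by
  rw [← mem_weightedHomogeneousSubmodule]
  have : Submodule.span K (Set.range (b ∘ f)) ≤
      (weightedHomogeneousSubmodule K rootWeight n).comap (linForm b) := by
    refine Submodule.span_le.2 ?_
    rintro _ ⟨i, rfl⟩
    simp only [Submodule.comap_coe, Set.mem_preimage, Function.comp_apply, linForm_basis,
      SetLike.mem_coe, mem_weightedHomogeneousSubmodule]
    rw [← hf i]
    exact isWeightedHomogeneous_X K _ _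
  exact this hz

lemma component_zero_eq_inr_res (f : MvPolynomial (Φ ⊕ κ) K) :
    weightedHomogeneousComponent rootWeight 0 f = inr K κ Φ (res K κ Φ f) := by
  suffices h : ∀ s : (Φ ⊕ κ) →₀ ℕ, weightedHomogeneousComponent rootWeight 0 (monomial s (1 : K)) =
      inr K κ Φ (res K κ Φ (monomial s 1)) by
    rw [f.as_sum, map_sum, map_sum, map_sum]
    refine Finset.sum_congr rfl fun s _ => ?_
    have h1 : (monomial s (coeff s f)) = coeff s f • monomial s (1 : K) := by
      rw [smul_monomial, smul_eq_mul, mul_one]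
    rw [h1, map_smul, map_smul, map_smul, h s]
  intro s
  by_cases hΦ : ∃ α, s (Sum.inl α) ≠ 0
  · obtain ⟨α, hα⟩ := hΦ
    have h0 : res K κ Φ (monomial s 1) = 0 := by
      rw [res, aeval_monomial, Finsupp.prod, Finset.prod_eq_zero (i := Sum.inl α), mul_zero]
      · simpa using hα
      · simp [hα]
    rw [h0, map_zero]
    refine (isWeightedHomogeneous_monomial rootWeight s (1 : K)
      rfl).weightedHomogeneousComponent_ne _ fun h => hα ?_
    rw [Finsupp.weight_apply, Finsupp.sum, eq_comm, Finset.sum_eq_zero_iff] at h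
    simpa [rootWeight, hα] using h (Sum.inl α) (by simpa using hα)
  · push Not at hΦ
    have h0 : inr K κ Φ (res K κ Φ (monomial s 1)) = monomial s 1 := by
      rw [res, aeval_monomial, map_one, one_mul, Finsupp.prod, map_prod, monomial_eq, C_1, one_mul,
        Finsupp.prod]
      refine Finset.prod_congr rfl fun i hi => ?_
      rcases i with i | i
      · simp [hΦ i] at hi
      · simp [inr]
    rw [h0]
    refine weightedHomogeneousComponent_eq_self (isWeightedHomogeneous_monomial _ _ _ ?_)
    rw [Finsupp.weight_apply, Finsupp.sum]
    refine Finset.sum_eq_zero fun i _ => ?_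
    rcases i with i | i <;> simp [rootWeight, hΦ]

/-- Invariant polynomials are determined by their restriction. -/
theorem eq_zero_of_res_eq_zero [CharZero K] [Fintype κ] [Fintype Φ] (b : Module.Basis (Φ ⊕ κ) K L)
    (hb : ∀ γ, ∃ y : L, (∀ j, ⁅y, b (Sum.inr j)⁆ ∈ Submodule.span K (Set.range (b ∘ Sum.inl))) ∧
      (∀ β ≠ γ, ⁅y, b (Sum.inl β)⁆ ∈ Submodule.span K (Set.range (b ∘ Sum.inl))) ∧
      ⁅y, b (Sum.inl γ)⁆ ∈ Submodule.span K (Set.range (b ∘ Sum.inr)) ∧ ⁅y, b (Sum.inl γ)⁆ ≠ 0)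
    {f : MvPolynomial (Φ ⊕ κ) K} (hf : f ∈ invariants b) (h0 : res K κ Φ f = 0) : f = 0 := by
  have key : ∀ k, weightedHomogeneousComponent rootWeight k f = 0 := by
    intro k
    induction k using Nat.strong_induction_on with
    | _ k ih =>
    rcases k with _ | n
    · rw [component_zero_eq_inr_res, h0, map_zero]
    have hmem : f ∈ Submodule.span K {g | ∃ m, n + 1 ≤ m ∧
        IsWeightedHomogeneous (rootWeight (Φ := Φ) (κ := κ)) (g : MvPolynomial _ K) m} := by
      rw [← finsum_weightedHomogeneousComponent rootWeight f]
      refine finsum_induction (p := fun g => g ∈ Submodule.span K _) (zero_mem _)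
        (fun _ _ => add_mem) fun m => ?_
      by_cases hm : m < n + 1
      · rw [ih m hm]; exact zero_mem _
      · exact Submodule.subset_span
          ⟨m, not_lt.1 hm, weightedHomogeneousComponent_isWeightedHomogeneous _ _⟩
    have hp : ∀ γ, pderiv (Sum.inl γ) (weightedHomogeneousComponent rootWeight (n + 1) f) = 0 := by
      intro γ
      obtain ⟨y, hy1, hy2, hy3, hy4⟩ := hb γ
      have hQ : weightedHomogeneousComponent rootWeight n (adDer b y f) =
          linForm b ⁅y, b (Sum.inl γ)⁆ *
            pderiv (Sum.inl γ) (weightedHomogeneousComponent rootWeight (n + 1) f) := by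
        refine Submodule.span_induction (p := fun f _ =>
          weightedHomogeneousComponent rootWeight n (adDer b y f) =
          linForm b ⁅y, b (Sum.inl γ)⁆ *
            pderiv (Sum.inl γ) (weightedHomogeneousComponent rootWeight (n + 1) f))
          ?_ (by simp) (fun p q _ _ hp hq => by simp [hp, hq, mul_add])
          (fun c p _ hp => by simp [hp]) hmem
        rintro g ⟨m, hm, hg⟩
        rw [derivation_eq_sum, map_sum, Finset.sum_eq_single (Sum.inl γ)]
        · rw [adDer_X]
          have h1 : IsWeightedHomogeneous rootWeight
              (linForm b ⁅y, b (Sum.inl γ)⁆ * pderiv (Sum.inl γ) g) (0 + (m - 1)) :=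
            (linForm_mem_of_mem_span b Sum.inr 0 (fun _ => rfl) hy3).mul
              (hg.pderiv (by simp [rootWeight]; omega))
          rcases eq_or_ne m (n + 1) with rfl | hne
          · rw [weightedHomogeneousComponent_eq_self hg]
            exact weightedHomogeneousComponent_eq_self (by simpa using h1)
          · rw [hg.weightedHomogeneousComponent_ne _ hne.symm, map_zero, mul_zero]
            exact h1.weightedHomogeneousComponent_ne _ (by omega)
        · rintro (β | j) - hi
          · rw [adDer_X]
            have h1 := (linForm_mem_of_mem_span b Sum.inl 1 (fun _ => rfl)
              (hy2 β fun h => hi (by rw [h]))).mul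
              (hg.pderiv (i := Sum.inl β) (n' := m - 1) (by simp [rootWeight]; omega))
            exact h1.weightedHomogeneousComponent_ne _ (by omega)
          · rw [adDer_X]
            have h1 := (linForm_mem_of_mem_span b Sum.inl 1 (fun _ => rfl) (hy1 j)).mul
              (hg.pderiv (i := Sum.inr j) (n' := m) (by simp [rootWeight]))
            exact h1.weightedHomogeneousComponent_ne _ (by omega)
        · simp
      rw [hf y, map_zero, eq_comm, mul_eq_zero] at hQ
      refine hQ.resolve_left fun h => hy4 (linForm_injective b ?_)
      rw [h, map_zero]
    have hE := (weightedHomogeneousComponent_isWeightedHomogeneous (w := rootWeight)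
      (n + 1) f).sum_weight_X_mul_pderiv
    rw [Fintype.sum_sum_type] at hE
    have hinr : ∀ j : κ, rootWeight (Φ := Φ) (Sum.inr j) = 0 := fun _ => rfl
    simp only [hp, mul_zero, smul_zero, Finset.sum_const_zero, hinr, zero_smul, add_zero] at hE
    exact (smul_eq_zero.1 hE.symm).resolve_left (Nat.succ_ne_zero n)
  rw [← finsum_weightedHomogeneousComponent rootWeight f]
  simp [key]

end ResInjective

section RootGroup

variable {K V : Type*} [Field K] [AddCommGroup V] [Module K V]

lemma pow_mem_of_stable (ρ : V ≃ₗ[K] V) {p : V → Prop} (h : ∀ v, p v → p (ρ v)) {v : V}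
    (hv : p v) (k : ℕ) : p ((ρ ^ k) v) := by
  induction k with
  | zero => simpa using hv
  | succ k ih => rw [pow_succ']; exact h _ ih

lemma exists_pow_fix (Φ : Finset V) (ρ : V ≃ₗ[K] V) (h : ∀ α ∈ Φ, ρ α ∈ Φ) :
    ∃ m, 0 < m ∧ ∀ α ∈ Φ, (ρ ^ m) α = α := by
  let f : Φ → Φ := fun α => ⟨ρ α, h α α.2⟩
  have hf : Function.Injective f := fun α β hαβ =>
    Subtype.ext (ρ.injective (congrArg Subtype.val hαβ))
  let p : Equiv.Perm Φ := Equiv.ofBijective f (Finite.injective_iff_bijective.1 hf)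
  have hp : ∀ k (α : Φ), ((p ^ k) α : V) = (ρ ^ k) α := fun k => by
    induction k with
    | zero => simp
    | succ k ih =>
      intro α
      rw [pow_succ', pow_succ', LinearEquiv.mul_apply, ← ih]
      rfl
  refine ⟨orderOf p, orderOf_pos p, fun α hα => ?_⟩
  rw [← hp _ ⟨α, hα⟩, pow_orderOf_eq_one]; rfl

/-- The sum of the elements on which a functional is positive. -/
def posSum (Φ : Finset V) (φ : V →+ ℝ) : V := ∑ α ∈ Φ with 0 < φ α, α

variable {Φ : Finset V}

lemma pos_of_posSum_sub_mem {ρ : V ≃ₗ[K] V} (hρ : ∀ α ∈ Φ, ρ α ∈ Φ)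
    {x y : V →+ ℝ} (hpos : ∀ α ∈ Φ, 0 < x α → 0 < x (ρ α)) (hxy : ∀ α ∈ Φ, 0 < y α → 0 < x α)
    (hstar : posSum Φ y - ρ (posSum Φ y) ∈ AddSubmonoid.closure {α | α ∈ Φ ∧ 0 < y α}) :
    ∀ α ∈ Φ, 0 < y α → 0 < y (ρ α) := by
  classical
  obtain ⟨m, hm, hfix⟩ := exists_pow_fix Φ ρ hρ
  let z : V →+ ℝ := ∑ k ∈ Finset.range m, x.comp ((ρ ^ k : V ≃ₗ[K] V) : V →+ V)
  have hz : ∀ v, z v = ∑ k ∈ Finset.range m, x ((ρ ^ k) v) := fun v => by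
    simp [z]
  have hzinv : ∀ α ∈ Φ, z (ρ α) = z α := fun α hα => by
    have h1 := Finset.sum_range_succ (fun k => x ((ρ ^ k) α)) m
    rw [Finset.sum_range_succ'] at h1
    rw [hfix α hα, pow_zero, LinearEquiv.coe_one, id, add_right_cancel_iff] at h1
    rw [hz, hz, ← h1]
    refine Finset.sum_congr rfl fun k _ => ?_
    rw [pow_succ, LinearEquiv.mul_apply]
  have hzpos : ∀ α ∈ Φ, 0 < x α → 0 < z α := fun α hα hxα => by
    rw [hz]
    refine Finset.sum_pos (fun k _ => ?_) ⟨0, by simpa using hm⟩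
    exact (pow_mem_of_stable ρ (p := fun v => v ∈ Φ ∧ 0 < x v)
      (fun v hv => ⟨hρ v hv.1, hpos v hv.1 hv.2⟩) ⟨hα, hxα⟩ k).2
  have hcl : ∀ v ∈ AddSubmonoid.closure {α | α ∈ Φ ∧ 0 < y α}, 0 ≤ z v ∧ (z v = 0 → v = 0) := by
    intro v hv
    induction hv using AddSubmonoid.closure_induction with
    | mem α h =>
      have := hzpos α h.1 (hxy α h.1 h.2)
      exact ⟨this.le, fun h0 => absurd h0 this.ne'⟩
    | zero => simp
    | add v w _ _ hv hw =>
      refine ⟨by rw [map_add]; linarith [hv.1, hw.1], fun h0 => ?_⟩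
      rw [map_add] at h0
      rw [hv.2 (by linarith [hv.1, hw.1]), hw.2 (by linarith [hv.1, hw.1]), add_zero]
  have hlam : ρ (posSum Φ y) = posSum Φ y := by
    refine (sub_eq_zero.1 ((hcl _ hstar).2 ?_)).symm
    rw [map_sub, posSum, map_sum, map_sum, map_sum, sub_eq_zero]
    exact Finset.sum_congr rfl fun α hα => (hzinv α (Finset.mem_filter.1 hα).1).symm
  set I := Φ.filter fun α => 0 < y α with hI
  set I' := I.image ρ with hI'
  have hsum : ∑ α ∈ I', y α = ∑ α ∈ I, y α := by
    rw [hI', Finset.sum_image (fun _ _ _ _ h => ρ.injective h)]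
    have := congrArg y hlam
    rw [posSum, map_sum, map_sum, map_sum] at this
    exact this
  have hempty : I \ I' = ∅ := by
    by_contra hne
    have h1 : 0 < ∑ α ∈ I \ I', y α := by
      refine Finset.sum_pos (fun α hα => ?_) (Finset.nonempty_iff_ne_empty.2 hne)
      exact (Finset.mem_filter.1 (Finset.mem_sdiff.1 hα).1).2
    have h2 : ∑ α ∈ I' \ I, y α ≤ 0 := by
      refine Finset.sum_nonpos fun α hα => ?_
      obtain ⟨h3, h4⟩ := Finset.mem_sdiff.1 hα
      obtain ⟨β, hβ, rfl⟩ := Finset.mem_image.1 h3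
      by_contra h5
      exact h4 (Finset.mem_filter.2 ⟨hρ β (Finset.mem_filter.1 hβ).1, not_le.1 h5⟩)
    have h3 := Finset.sum_sdiff_sub_sum_sdiff (s₁ := I) (s₂ := I') (f := fun α => y α)
    linarith
  have hII' : I = I' := Finset.eq_of_subset_of_card_le (Finset.sdiff_eq_empty_iff_subset.1 hempty)
    Finset.card_image_le
  intro α hα hyα
  have : ρ α ∈ I := by
    rw [hII']; exact Finset.mem_image_of_mem _ (Finset.mem_filter.2 ⟨hα, hyα⟩)
  exact (Finset.mem_filter.1 this).2

lemma fix_of_pos {ρ : V ≃ₗ[K] V} (hρ : ∀ α ∈ Φ, ρ α ∈ Φ) (hneg : ∀ α ∈ Φ, -α ∈ Φ)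
    {x : V →+ ℝ} (hx0 : ∀ α ∈ Φ, x α ≠ 0) (hinj : Set.InjOn x Φ)
    (hpos : ∀ α ∈ Φ, 0 < x α → 0 < x (ρ α))
    (hstar : ∀ y : V →+ ℝ, posSum Φ y - ρ (posSum Φ y) ∈
      AddSubmonoid.closure {α | α ∈ Φ ∧ 0 < y α}) :
    ∀ α ∈ Φ, ρ α = α := by
  classical
  obtain ⟨m, hm, hfix⟩ := exists_pow_fix Φ ρ hρ
  suffices h : ∀ α ∈ Φ, 0 < x α → ρ α = α by
    intro α hα
    rcases lt_or_gt_of_ne (hx0 α hα) with h1 | h1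
    · have := h (-α) (hneg α hα) (by rw [map_neg]; linarith)
      rwa [map_neg, neg_inj] at this
    · exact h α hα h1
  let P := Φ.filter fun α => 0 < x α
  rcases P.eq_empty_or_nonempty with hP | hP
  · intro α hα h
    have : α ∈ P := Finset.mem_filter.2 ⟨hα, h⟩
    simp [hP] at this
  obtain ⟨α₀, hα₀, hmin⟩ := P.exists_min_image (fun α => x α / x (ρ α)) hP
  obtain ⟨hα₀Φ, hα₀x⟩ := Finset.mem_filter.1 hα₀
  set t := x α₀ / x (ρ α₀) with ht
  have htpos : 0 < t := div_pos hα₀x (hpos _ hα₀Φ hα₀x)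
  have hle : ∀ α ∈ Φ, 0 < x α → t * x (ρ α) ≤ x α := fun α hα hxα => by
    have := hmin α (Finset.mem_filter.2 ⟨hα, hxα⟩)
    rwa [le_div_iff₀ (hpos α hα hxα)] at this
  let y : V →+ ℝ := x - (AddMonoidHom.mulLeft t).comp (x.comp (ρ : V →+ V))
  have hy : ∀ v, y v = x v - t * x (ρ v) := fun v => rfl
  have hyx : ∀ α ∈ Φ, 0 < y α → 0 < x α := fun α hα hyα => by
    by_contra hneg'
    have h1 : 0 < x (-α) := by
      rw [map_neg]
      have := lt_of_le_of_ne (not_lt.1 hneg') (hx0 α hα)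
      linarith
    have h2 := hle (-α) (hneg α hα) h1
    rw [hy] at hyα
    simp only [map_neg] at h2
    linarith
  have hys := pos_of_posSum_sub_mem hρ hpos hyx (hstar y)
  have hyback : ∀ α ∈ Φ, 0 < y (ρ α) → 0 < y α := fun α hα h => by
    have := (pow_mem_of_stable ρ (p := fun v => v ∈ Φ ∧ 0 < y v)
      (fun v hv => ⟨hρ v hv.1, hys v hv.1 hv.2⟩) ⟨hρ α hα, h⟩ (m - 1)).2
    rwa [← LinearEquiv.mul_apply, ← pow_succ, Nat.sub_add_cancel hm, hfix α hα] at this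
  have hZ : ∀ k, ((ρ ^ k) α₀ ∈ Φ ∧ 0 < x ((ρ ^ k) α₀)) ∧ y ((ρ ^ k) α₀) = 0 := fun k => by
    refine pow_mem_of_stable ρ (p := fun v => (v ∈ Φ ∧ 0 < x v) ∧ y v = 0) ?_ ?_ k
    · rintro v ⟨⟨hv, hxv⟩, hyv⟩
      have h1 : 0 < x (ρ v) := hpos v hv hxv
      refine ⟨⟨hρ v hv, h1⟩, le_antisymm ?_ ?_⟩
      · by_contra h2
        exact (hyback v hv (not_le.1 h2)).ne' hyv
      · rw [hy]; linarith [hle _ (hρ v hv) h1]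
    · refine ⟨⟨hα₀Φ, hα₀x⟩, ?_⟩
      rw [hy, ht, div_mul_cancel₀ _ (hpos _ hα₀Φ hα₀x).ne', sub_self]
  have hpow : ∀ k, x α₀ = t ^ k * x ((ρ ^ k) α₀) := fun k => by
    induction k with
    | zero => simp
    | succ k ih =>
      have h1 := (hZ k).2
      rw [hy, sub_eq_zero] at h1
      rw [ih, h1, pow_succ', pow_succ', LinearEquiv.mul_apply]
      ring
  have ht1 : t = 1 := by
    have h1 := hpow m
    rw [hfix _ hα₀Φ] at h1
    refine (pow_eq_one_iff_of_nonneg htpos.le hm.ne').1 ?_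
    exact mul_right_cancel₀ hα₀x.ne' (by rw [← h1, one_mul])
  intro α hα hxα
  have hdec : ∀ k, ((ρ ^ k) (ρ α) ∈ Φ ∧ 0 < x ((ρ ^ k) (ρ α))) ∧ x ((ρ ^ k) (ρ α)) ≤ x (ρ α) := by
    intro k
    refine pow_mem_of_stable ρ (p := fun v => (v ∈ Φ ∧ 0 < x v) ∧ x v ≤ x (ρ α)) ?_
      ⟨⟨hρ α hα, hpos α hα hxα⟩, le_rfl⟩ k
    rintro v ⟨⟨hv, hxv⟩, h⟩
    refine ⟨⟨hρ v hv, hpos v hv hxv⟩, ?_⟩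
    have := hle v hv hxv
    rw [ht1, one_mul] at this
    exact this.trans h
  have h1 := (hdec (m - 1)).2
  rw [← LinearEquiv.mul_apply, ← pow_succ, Nat.sub_add_cancel hm, hfix α hα] at h1
  have h2 := hle α hα hxα
  rw [ht1, one_mul] at h2
  exact hinj (hρ α hα) hα (le_antisymm h2 h1)

/-- A group of automorphisms of a root system containing the reflections and moving sums of
positive roots downwards consists of products of reflections. -/
theorem exists_mem_closure_reflections {G : Subgroup (V ≃ₗ[K] V)}
    (hG : ∀ g ∈ G, ∀ α ∈ Φ, g α ∈ Φ) (hneg : ∀ α ∈ Φ, -α ∈ Φ)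
    {s : V → (V ≃ₗ[K] V)} {n : V → V → ℤ} (hsG : ∀ α ∈ Φ, s α ∈ G)
    (hs : ∀ α ∈ Φ, ∀ β ∈ Φ, s α β = β - n α β • α) (hn2 : ∀ α ∈ Φ, n α α = 2)
    (hns : ∀ α ∈ Φ, ∀ β ∈ Φ, n α (s α β) = -n α β)
    {x : V →+ ℝ} (hx0 : ∀ α ∈ Φ, x α ≠ 0) (hinj : Set.InjOn x Φ)
    (hstar : ∀ g ∈ G, ∀ y : V →+ ℝ, posSum Φ y - g (posSum Φ y) ∈
      AddSubmonoid.closure {α | α ∈ Φ ∧ 0 < y α})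
    {σ : V ≃ₗ[K] V} (hσ : σ ∈ G) :
    ∃ w ∈ Subgroup.closure (s '' Φ), ∀ β ∈ Φ, σ (w β) = β := by
  classical
  have hW : Subgroup.closure (s '' Φ) ≤ G := by
    rw [Subgroup.closure_le]
    rintro _ ⟨α, hα, rfl⟩
    exact hsG α hα
  let T : Set (Φ → Φ) := {p | ∃ w ∈ Subgroup.closure (s '' Φ), ∀ β : Φ, (p β : V) = σ (w β)}
  obtain ⟨p, ⟨w, hw, hp⟩, hmax⟩ := Set.exists_max_image T
    (fun p => ∑ β : Φ, x β * x (p β)) T.toFinite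
    ⟨fun β => ⟨σ β, hG σ hσ β β.2⟩, 1, one_mem _, fun β => rfl⟩
  refine ⟨w, hw, ?_⟩
  have hρG : σ * w ∈ G := mul_mem hσ (hW hw)
  have hprod : ∀ α ∈ Φ, 0 ≤ x α * x ((σ * w) α) := fun α hα => by
    have hss : ∀ β ∈ Φ, s α (s α β) = β := fun β hβ => by
      rw [hs α hα _ (hG _ (hsG α hα) β hβ), hns α hα β hβ, hs α hα β hβ]
      simp
    have h1 := hmax (fun β => ⟨σ ((w * s α) β), hG _ (mul_mem hσ (mul_mem (hW hw) (hsG α hα))) β β.2⟩)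
      ⟨w * s α, mul_mem hw (Subgroup.subset_closure ⟨α, hα, rfl⟩), fun β => rfl⟩
    simp only [hp] at h1
    have h2 : ∀ β : Φ, x (σ ((w * s α) β)) = x (σ (w β)) - n α β * x ((σ * w) α) := fun β => by
      rw [LinearEquiv.mul_apply, hs α hα β β.2, map_sub, map_sub, map_sub, map_zsmul, map_zsmul,
        map_zsmul, zsmul_eq_mul]
      rfl
    simp only [h2, mul_sub, Finset.sum_sub_distrib] at h1
    have h3 : ∑ β : Φ, x β * (n α β * x ((σ * w) α)) =
        (∑ β : Φ, n α β * x β) * x ((σ * w) α) := by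
      rw [Finset.sum_mul]
      exact Finset.sum_congr rfl fun β _ => by ring
    have h4 : (∑ β : Φ, n α β * x β) = ∑ β : Φ, (-n α β) * (x β - n α β * x α) := by
      let e : Φ ≃ Φ :=
        { toFun := fun β => ⟨s α β, hG _ (hsG α hα) β β.2⟩
          invFun := fun β => ⟨s α β, hG _ (hsG α hα) β β.2⟩
          left_inv := fun β => Subtype.ext (hss β β.2)
          right_inv := fun β => Subtype.ext (hss β β.2) }
      rw [← Equiv.sum_comp e]
      refine Finset.sum_congr rfl fun β _ => ?_
      change (n α (s α β) : ℝ) * x (s α β) = _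
      rw [hns α hα β β.2, hs α hα β β.2, map_sub, map_zsmul, zsmul_eq_mul]
      push_cast
      ring
    have h5 : 2 * ∑ β : Φ, n α β * x β = (∑ β : Φ, (n α β : ℝ) ^ 2) * x α := by
      have : ∑ β : Φ, (-n α β : ℝ) * (x β - n α β * x α) =
          -(∑ β : Φ, n α β * x β) + (∑ β : Φ, (n α β : ℝ) ^ 2) * x α := by
        rw [Finset.sum_mul, ← Finset.sum_neg_distrib, ← Finset.sum_add_distrib]
        exact Finset.sum_congr rfl fun β _ => by ring
      rw [this] at h4
      linarith
    have h6 : 0 < ∑ β : Φ, (n α β : ℝ) ^ 2 := by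
      refine Finset.sum_pos' (fun _ _ => sq_nonneg _) ⟨⟨α, hα⟩, Finset.mem_univ _, ?_⟩
      simp [hn2 α hα]
    rw [h3] at h1
    have h7 : 0 ≤ (∑ β : Φ, (n α β : ℝ) ^ 2) * (x α * x ((σ * w) α)) := by
      rw [← mul_assoc, ← h5]
      linarith
    exact nonneg_of_mul_nonneg_right h7 h6
  refine fix_of_pos (ρ := σ * w) (hG _ hρG) hneg hx0 hinj (fun α hα hxα => ?_) (hstar _ hρG)
  exact lt_of_le_of_ne (nonneg_of_mul_nonneg_right (hprod α hα) hxα) (hx0 _ (hG _ hρG α hα)).symm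

end RootGroup

section GaloisDescent

variable {K V κ n : Type*} [Field K] [AddCommGroup V] [Module K V] {d : Module.Basis κ K V}
  {μ : n → V}

lemma subalgebra_eq_top (hμ : Submodule.span K (Set.range μ) = ⊤)
    {S : Subalgebra K (MvPolynomial κ K)} (h : ∀ i, linForm d (μ i) ∈ S) : S = ⊤ := by
  have h1 : Submodule.span K (Set.range μ) ≤ (Subalgebra.toSubmodule S).comap (linForm d) := by
    rw [Submodule.span_le]
    rintro _ ⟨i, rfl⟩
    exact h i
  rw [hμ] at h1
  rw [← top_le_iff, ← MvPolynomial.adjoin_range_X, Algebra.adjoin_le_iff]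
  rintro _ ⟨i, rfl⟩
  rw [← linForm_basis d]
  exact h1 Submodule.mem_top

variable [Fintype n] {J : Subalgebra K (MvPolynomial κ K)}

lemma isIntegral_of_coeff_mem (hμ : Submodule.span K (Set.range μ) = ⊤)
    (hJ : ∀ k, (∏ i, (Polynomial.X - Polynomial.C (linForm d (μ i)))).coeff k ∈ J)
    (a : MvPolynomial κ K) : IsIntegral J a := by
  have hS : (integralClosure J (MvPolynomial κ K)).restrictScalars K = ⊤ := by
    refine subalgebra_eq_top (d := d) hμ fun i => ?_
    rw [Subalgebra.mem_restrictScalars, mem_integralClosure_iff]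
    obtain ⟨Q, hQ, -, hQm⟩ := Polynomial.lifts_and_natDegree_eq_and_monic
      (f := algebraMap J (MvPolynomial κ K))
      (p := ∏ i, (Polynomial.X - Polynomial.C (linForm d (μ i)))) ((Polynomial.lifts_iff_coeff_lifts _).2 fun k =>
        ⟨⟨_, hJ k⟩, rfl⟩) (Polynomial.monic_prod_of_monic _ _ fun i _ => Polynomial.monic_X_sub_C _)
    refine ⟨Q, hQm, ?_⟩
    rw [← Polynomial.eval_map, hQ, Polynomial.eval_prod]
    exact Finset.prod_eq_zero (Finset.mem_univ i) (by simp)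
  have h : a ∈ (integralClosure J (MvPolynomial κ K)).restrictScalars K := hS ▸ Algebra.mem_top
  exact h

variable [CharZero K] [FiniteDimensional K V]

theorem exists_mul_mem_of_fixed (E : Type*) [Field E] [Algebra K E] [Algebra (MvPolynomial κ K) E]
    [IsScalarTower K (MvPolynomial κ K) E] [IsFractionRing (MvPolynomial κ K) E]
    (hμ : Submodule.span K (Set.range μ) = ⊤)
    (hJ : ∀ k, (∏ i, (Polynomial.X - Polynomial.C (linForm d (μ i)))).coeff k ∈ J)
    {a : MvPolynomial κ K}
    (ha : ∀ g : V ≃ₗ[K] V, (∀ f ∈ J, polyEquiv d g f = f) → polyEquiv d g a = a) :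
    ∃ q ∈ J, q ≠ 0 ∧ q * a ∈ J := by
  let j : MvPolynomial κ K →ₐ[K] E := IsScalarTower.toAlgHom K _ E
  have hj : Function.Injective j := IsFractionRing.injective (MvPolynomial κ K) E
  let F : IntermediateField K E := IntermediateField.adjoin K (J.map j : Set E)
  have hF : ∀ f ∈ J, j f ∈ F := fun f hf =>
    IntermediateField.subset_adjoin K _ ((Subalgebra.mem_map).2 ⟨f, hf, rfl⟩)
  obtain ⟨Q, hQ, -, hQm⟩ := Polynomial.lifts_and_natDegree_eq_and_monic
    (f := algebraMap F E) (p := ∏ i, (Polynomial.X - Polynomial.C (j (linForm d (μ i)))))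
    ((Polynomial.lifts_iff_coeff_lifts _).2 fun k => by
      refine ⟨⟨_, hF _ (hJ k)⟩, ?_⟩
      change j.toRingHom _ = _
      rw [← Polynomial.coeff_map, Polynomial.map_prod]
      simp)
    (Polynomial.monic_prod_of_monic _ _ fun i _ => Polynomial.monic_X_sub_C _)
  have hroot : ∀ z : E, Polynomial.aeval z Q = 0 ↔ ∃ i, z = j (linForm d (μ i)) := fun z => by
    rw [Polynomial.aeval_def, ← Polynomial.eval_map, hQ, Polynomial.eval_prod,
      Finset.prod_eq_zero_iff]
    simp [sub_eq_zero]
  have hsplit : Polynomial.IsSplittingField F E Q := by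
    rw [isSplittingField_iff_intermediateField]
    refine ⟨hQ ▸ Polynomial.Splits.prod fun i _ => Polynomial.Splits.X_sub_C _, ?_⟩
    let T := IntermediateField.adjoin F (Q.rootSet E)
    have hT : ((T.restrictScalars K).toSubalgebra.comap j) = ⊤ := by
      refine subalgebra_eq_top (d := d) hμ fun i => ?_
      exact IntermediateField.subset_adjoin F _
        (Polynomial.mem_rootSet.2 ⟨hQm.ne_zero, (hroot _).2 ⟨i, rfl⟩⟩)
    have hT' : ∀ f, j f ∈ T := fun f => by
      have h : f ∈ ((T.restrictScalars K).toSubalgebra.comap j) := hT ▸ Algebra.mem_top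
      exact h
    refine top_le_iff.1 fun z _ => ?_
    obtain ⟨f, f', -, rfl⟩ := IsFractionRing.div_surjective (MvPolynomial κ K) z
    exact div_mem (hT' f) (hT' f')
  have := Polynomial.IsSplittingField.finiteDimensional E Q
  have := Normal.of_isSplittingField (E := E) Q
  have : IsGalois F E := ⟨⟩
  have hbot : j a ∈ (⊥ : IntermediateField F E) := by
    rw [IsGalois.mem_bot_iff_fixed]
    intro σ
    let e : V →ₗ[K] E := j.toLinearMap ∘ₗ linForm d
    have he : Function.Injective e := hj.comp (linForm_injective d)
    let σe : V →ₗ[K] E := (σ.restrictScalars K).toLinearMap ∘ₗ e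
    have hσe : ∀ v, σe v ∈ LinearMap.range e := fun v => by
      have h1 : Submodule.span K (Set.range μ) ≤ (LinearMap.range e).comap σe := by
        rw [Submodule.span_le]
        rintro _ ⟨i, rfl⟩
        have h2 : Polynomial.aeval (σ (j (linForm d (μ i)))) Q = 0 := by
          rw [Polynomial.aeval_algHom_apply, (hroot _).2 ⟨i, rfl⟩, map_zero]
        obtain ⟨k, hk⟩ := (hroot _).1 h2
        exact ⟨μ k, hk.symm⟩
      exact h1 (hμ ▸ Submodule.mem_top)
    let g₀ : V →ₗ[K] V := (LinearEquiv.ofInjective e he).symm.toLinearMap ∘ₗ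
      σe.codRestrict (LinearMap.range e) hσe
    have hg₀ : ∀ v, e (g₀ v) = σ (e v) := fun v =>
      congrArg Subtype.val ((LinearEquiv.ofInjective e he).apply_symm_apply ⟨σe v, hσe v⟩)
    have hg₀i : Function.Injective g₀ := fun v w h =>
      he (σ.injective ((hg₀ v).symm.trans ((congrArg e h).trans (hg₀ w))))
    let g := LinearEquiv.ofInjectiveEndo g₀ hg₀i
    have hcomp : ∀ f, j (polyEquiv d g f) = σ (j f) := by
      have h : j.comp (polyEquiv d g).toAlgHom = (σ.restrictScalars K).toAlgHom.comp j := by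
        refine algHom_ext fun i => ?_
        rw [← linForm_basis d]
        change j (polyEquiv d g (linForm d (d i))) = σ (j (linForm d (d i)))
        rw [polyEquiv_linForm]
        exact hg₀ _
      exact fun f => AlgHom.congr_fun h f
    rw [← hcomp, ha g fun f hf => hj ?_]
    rw [hcomp]
    exact σ.commutes ⟨j f, hF f hf⟩
  obtain ⟨⟨z, hz⟩, hza : z = j a⟩ := IntermediateField.mem_bot.1 hbot
  rw [IntermediateField.mem_adjoin_iff_div, Algebra.adjoin_eq] at hz
  obtain ⟨_, ⟨r, hr, rfl⟩, _, ⟨s, hs, rfl⟩, hrs⟩ := hz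
  change z = j r / j s at hrs
  by_cases hs0 : s = 0
  · refine ⟨1, one_mem _, one_ne_zero, ?_⟩
    rw [hza, hs0, map_zero, div_zero, map_eq_zero_iff j hj] at hrs
    rw [hrs, mul_zero]
    exact zero_mem _
  · refine ⟨s, hs, hs0, ?_⟩
    have : s * a = r := hj (by
      rw [map_mul, ← hza, hrs, mul_div_cancel₀ _ ((map_ne_zero_iff j hj).2 hs0)])
    exact this ▸ hr

end GaloisDescent

section Descent

variable {K P A : Type*} [Field K] [CommRing P] [IsDomain P] [IsIntegrallyClosed P] [Algebra K P]
  [CommRing A] [IsDomain A] [Algebra K A] {I : Subalgebra K P} {r : P →ₐ[K] A}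

theorem mem_map_of_isIntegral (hr : ∀ f ∈ I, r f = 0 → f = 0)
    (hI : ∀ f ∈ I, f ≠ 0 → ∀ c, f * c ∈ I → c ∈ I) {a q : A} (ha : IsIntegral (I.map r) a)
    (hq : q ∈ I.map r) (hq0 : q ≠ 0) (hqa : q * a ∈ I.map r) : a ∈ I.map r := by
  let φ : I →ₐ[K] A := r.comp I.val
  have hφ : Function.Injective φ := (injective_iff_map_eq_zero φ).2 fun f h =>
    Subtype.ext (hr f f.2 h)
  obtain ⟨f, hf, rfl⟩ := Subalgebra.mem_map.1 hq
  obtain ⟨f', hf', hff'⟩ := Subalgebra.mem_map.1 hqa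
  obtain ⟨m, hm, hma⟩ : ∃ m : Polynomial I, m.Monic ∧ m.eval₂ φ.toRingHom a = 0 := by
    have h : I.map r = φ.range := (Subalgebra.range_comp_val I r).symm
    rw [h] at ha
    obtain ⟨m, hm, hma⟩ := ha
    let e := AlgEquiv.ofInjective φ hφ
    refine ⟨m.map (e.symm : φ.range →+* I), hm.map _, ?_⟩
    rw [Polynomial.eval₂_map]
    have h2 : φ.toRingHom.comp (e.symm : φ.range →+* I) = algebraMap φ.range A :=
      RingHom.ext fun x => congrArg Subtype.val (e.apply_symm_apply x)
    rw [h2]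
    exact hma
  have h1 : (m.scaleRoots ⟨f, hf⟩).eval ⟨f', hf'⟩ = 0 := hφ <| by
    have h2 := Polynomial.scaleRoots_eval₂_mul (p := m) φ.toRingHom a ⟨f, hf⟩
    have h3 : φ.toRingHom ⟨f, hf⟩ * a = φ.toRingHom ⟨f', hf'⟩ := hff'.symm
    rw [hma, mul_zero, h3, Polynomial.eval₂_at_apply] at h2
    exact h2.trans (map_zero φ).symm
  have hf0 : f ≠ 0 := fun h => hq0 (by rw [h, map_zero])
  let ψ : I →+* FractionRing P := (algebraMap P (FractionRing P)).comp I.val.toRingHom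
  have hψf : ψ ⟨f, hf⟩ ≠ 0 := (map_ne_zero_iff _ (IsFractionRing.injective P _)).2 hf0
  let z : FractionRing P := algebraMap P _ f' / algebraMap P _ f
  have hz : ψ ⟨f, hf⟩ * z = ψ ⟨f', hf'⟩ := mul_div_cancel₀ _ hψf
  have h4 : IsIntegral P z := by
    refine ⟨m.map I.val.toRingHom, hm.map _, ?_⟩
    rw [Polynomial.eval₂_map]
    have h2 := Polynomial.scaleRoots_eval₂_mul (p := m) ψ z ⟨f, hf⟩
    rw [hz, Polynomial.eval₂_at_apply, h1, map_zero] at h2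
    exact (mul_eq_zero.1 h2.symm).resolve_left (pow_ne_zero _ hψf)
  obtain ⟨c, hc⟩ := IsIntegrallyClosed.isIntegral_iff.1 h4
  have h5 : f * c = f' := IsFractionRing.injective P (FractionRing P) (by
    rw [map_mul, hc]; exact hz)
  refine Subalgebra.mem_map.2 ⟨c, hI f hf hf0 c (h5 ▸ hf'), mul_left_cancel₀ hq0 ?_⟩
  rw [← hff', ← h5, map_mul]

end Descent

end

noncomputable section

open LieAlgebra LieAlgebra.IsKilling LieModule MvPolynomial

set_option linter.unusedSectionVars false

section Cartan

variable {K L : Type*} [Field K] [CharZero K] [LieRing L] [LieAlgebra K L] [FiniteDimensional K L]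
  [IsKilling K L] (H : LieSubalgebra K L) [H.IsCartanSubalgebra]

/-- The functional on a Cartan subalgebra which an element represents through the Killing form. -/
def proj : L →ₗ[K] Module.Dual K H := H.toSubmodule.subtype.dualMap ∘ₗ killingForm K L

@[simp]
lemma proj_apply (z : L) (h : H) : proj H z h = killingForm K L z h := rfl

lemma proj_cartanEquivDual_symm (μ : Module.Dual K H) :
    proj H ((cartanEquivDual H).symm μ : H) = μ := by
  conv_rhs => rw [← (cartanEquivDual H).apply_symm_apply μ]
  ext h
  rw [cartanEquivDual_apply_apply]
  exact LinearMap.congr_fun₂ (restrict_killingForm K L H) _ _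

variable [IsTriangularizable K H L]

lemma proj_of_mem_rootSpace {α : H → K} (hα : α ≠ 0) {z : L} (hz : z ∈ rootSpace H α) :
    proj H z = 0 := by
  ext h
  refine killingForm_apply_eq_zero_of_mem_rootSpace_of_add_ne_zero K L H hz (β := 0) ?_ ?_
  · rw [rootSpace_zero_eq]; exact h.2
  · simpa using hα

lemma exists_killingForm_ne_zero {α : H → K} {x : L} (hx : x ∈ rootSpace H α) (h0 : x ≠ 0) :
    ∃ y ∈ rootSpace H (-α), killingForm K L x y ≠ 0 := by
  by_contra! h
  have := mem_ker_killingForm_of_mem_rootSpace_of_forall_rootSpace_neg K L H hx h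
  rw [IsKilling.ker_killingForm_eq_bot] at this
  exact h0 (by simpa using this)

lemma exists_root_basis {κ : Type*} [Finite κ] (d : Module.Basis κ K (Module.Dual K H)) :
    ∃ b : Module.Basis (H.root ⊕ κ) K L,
      (∀ α : H.root, b (.inl α) ∈ rootSpace H (α : Weight K H L)) ∧
      ∀ j, b (.inr j) = ((cartanEquivDual H).symm (d j) : H) := by
  classical
  have := Fintype.ofFinite κ
  have hex : ∀ α : H.root, ∃ e ∈ rootSpace H (α : Weight K H L), e ≠ 0 := fun α =>
    (α : Weight K H L).exists_ne_zero
  choose e he he0 using hex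
  choose f hf hef using fun α => exists_killingForm_ne_zero H (he α) (he0 α)
  have hα0 : ∀ α : H.root, ((α : Weight K H L) : H → K) ≠ 0 := fun α =>
    H.isNonZero_coe_root α
  let v : H.root ⊕ κ → L := Sum.elim e fun j => ((cartanEquivDual H).symm (d j) : H)
  have hli : LinearIndependent K v := by
    rw [Fintype.linearIndependent_iff]
    intro g hg
    rw [Fintype.sum_sum_type] at hg
    simp only [v, Sum.elim_inl, Sum.elim_inr] at hg
    have hr : ∀ j, g (.inr j) = 0 := by
      have h1 := congrArg (proj H) hg
      rw [map_add, map_sum, map_sum] at h1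
      simp only [map_smul, proj_cartanEquivDual_symm, map_zero,
        proj_of_mem_rootSpace H (hα0 _) (he _), smul_zero, Finset.sum_const_zero, zero_add] at h1
      exact Fintype.linearIndependent_iff.1 d.linearIndependent _ h1
    simp only [hr, zero_smul, Finset.sum_const_zero, add_zero] at hg
    rintro (α | j)
    · have h1 := congrArg (fun z => killingForm K L z (f α)) hg
      simp only [map_sum, map_smul, LinearMap.sum_apply, LinearMap.smul_apply, map_zero,
        LinearMap.zero_apply] at h1
      rw [Finset.sum_eq_single α] at h1
      · exact (smul_eq_zero.1 h1).resolve_right (hef α)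
      · intro β _ hβ
        rw [killingForm_apply_eq_zero_of_mem_rootSpace_of_add_ne_zero K L H (he β) (hf α),
          smul_zero]
        rw [← sub_eq_add_neg, sub_ne_zero]
        exact fun h => hβ (Subtype.ext (DFunLike.coe_injective h))
      · simp
    · exact hr j
  have hsp : ⊤ ≤ Submodule.span K (Set.range v) := by
    have h1 := congrArg LieSubmodule.toSubmodule (cartan_sup_iSup_rootSpace_eq_top (K := K) H)
    rw [LieSubmodule.top_toSubmodule] at h1
    rw [← h1]
    simp only [LieSubmodule.sup_toSubmodule, LieSubmodule.iSup_toSubmodule]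
    refine sup_le ?_ (iSup₂_le fun α hα => ?_)
    · intro h hh
      have h2 : h = ((H.toSubmodule.subtype ∘ₗ (cartanEquivDual H).symm.toLinearMap)
          (cartanEquivDual H ⟨h, hh⟩)) := by simp
      rw [h2, ← d.sum_repr (cartanEquivDual H ⟨h, hh⟩), map_sum]
      refine Submodule.sum_mem _ fun j _ => ?_
      rw [map_smul]
      exact Submodule.smul_mem _ _ (Submodule.subset_span ⟨.inr j, rfl⟩)
    · intro x hx
      let α' : H.root := ⟨α, by simpa using hα⟩
      obtain ⟨c, hc⟩ := (finrank_eq_one_iff_of_nonzero' (⟨e α', he α'⟩ : rootSpace H α)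
        (fun h => he0 α' (congrArg Subtype.val h))).1 (finrank_rootSpace_eq_one α hα) ⟨x, hx⟩
      have hc' : c • e α' = x := congrArg Subtype.val hc
      rw [← hc']
      exact Submodule.smul_mem _ _ (Submodule.subset_span ⟨.inl α', rfl⟩)
  refine ⟨Module.Basis.mk hli hsp, fun α => ?_, fun j => ?_⟩
  · simpa [v] using he α
  · simp [v]

end Cartan

section ExpInvariant

variable {K L ι : Type*} [Field K] [CharZero K] [LieRing L] [LieAlgebra K L]

lemma exists_exp {x : L} (hx : _root_.IsNilpotent (ad K L x)) :
    ∃ θ : L ≃ₗ⁅K⁆ L, ∀ N z, ((ad K L x) ^ N) z = 0 →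
      θ z = ∑ k ∈ Finset.range N, ((k.factorial : K)⁻¹) • ((ad K L x) ^ k) z := by
  let _ : Module ℚ L := Module.compHom L (algebraMap ℚ K)
  let _ : LieAlgebra ℚ L :=
    { lie_smul := fun t x m => lie_smul (algebraMap ℚ K t) x m }
  have hD : (LieDerivation.ad K L x).toLinearMap = ad K L x := by ext z; simp
  refine ⟨LieDerivation.exp (LieDerivation.ad K L x) (by rwa [hD]), fun N z hN => ?_⟩
  rw [LieDerivation.exp_map_apply, ← Module.End.smul_def, hD, IsNilpotent.exp_smul_eq_sum hN hx]
  refine Finset.sum_congr rfl fun k _ => ?_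
  rw [inv_natCast_smul_eq ℚ K]
  rfl

lemma polyMap_exp_eq (b : Module.Basis ι K L) {x : L} (hx : _root_.IsNilpotent (ad K L x))
    {θ : L →ₗ[K] L} (hθ : ∀ N z, ((ad K L x) ^ N) z = 0 →
      θ z = ∑ k ∈ Finset.range N, ((k.factorial : K)⁻¹) • ((ad K L x) ^ k) z)
    {f : MvPolynomial ι K} (hf : f ∈ invariants b) : polyMap b b θ f = f := by
  obtain ⟨N, hN⟩ := hx
  let T : L →ₗ[K] Polynomial (MvPolynomial ι K) :=
    ∑ k ∈ Finset.range (N + 1), ((k.factorial : K)⁻¹) •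
      ((Polynomial.monomial k).restrictScalars K ∘ₗ linForm b ∘ₗ (ad K L x) ^ k)
  have hT : ∀ z, T z = ∑ k ∈ Finset.range (N + 1),
      Polynomial.monomial k (linForm b (((k.factorial : K)⁻¹) • ((ad K L x) ^ k) z)) := fun z => by
    simp only [T, LinearMap.sum_apply, LinearMap.smul_apply, LinearMap.comp_apply,
      LinearMap.restrictScalars_apply, map_smul, Polynomial.smul_monomial]
  let Θ : MvPolynomial ι K →ₐ[K] Polynomial (MvPolynomial ι K) := aeval fun j => T (b j)
  have hΘ : ∀ z, Θ (linForm b z) = T z := fun z => by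
    have : Θ.toLinearMap ∘ₗ linForm b = T := b.ext fun i => by simp [Θ]
    exact LinearMap.congr_fun this z
  have hder : ∀ z, Polynomial.derivative (T z) = T ⁅x, z⁆ := fun z => by
    rw [hT, hT, map_sum, Finset.sum_range_succ', Finset.sum_range_succ]
    simp only [Polynomial.derivative_monomial]
    have h1 : ((ad K L x) ^ N) ⁅x, z⁆ = 0 := by rw [hN]; rfl
    rw [h1, smul_zero, map_zero, map_zero, Nat.cast_zero, mul_zero, map_zero]
    congr 1
    refine Finset.sum_congr rfl fun k _ => ?_
    rw [Nat.add_sub_cancel]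
    congr 1
    have h2 : ((ad K L x) ^ (k + 1)) z = ((ad K L x) ^ k) ⁅x, z⁆ := by
      rw [pow_succ]; rfl
    rw [h2, mul_comm, ← nsmul_eq_mul, ← map_nsmul, ← Nat.cast_smul_eq_nsmul K, smul_smul]
    congr 2
    rw [Nat.factorial_succ, Nat.cast_mul]
    have h3 : ((k + 1 : ℕ) : K) ≠ 0 := Nat.cast_ne_zero.2 (Nat.succ_ne_zero k)
    have h4 : ((k.factorial : ℕ) : K) ≠ 0 := Nat.cast_ne_zero.2 k.factorial_ne_zero
    field_simp
  have hev : ∀ p z, (T z).eval p = ∑ k ∈ Finset.range (N + 1),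
      linForm b (((k.factorial : K)⁻¹) • ((ad K L x) ^ k) z) * p ^ k := fun p z => by
    simp [hT, Polynomial.eval_finsetSum, Polynomial.eval_monomial]
  have key := eval_flow_eq (adDer b x) Θ
    (fun j => by rw [adDer_X, hΘ, ← linForm_basis b, hΘ, hder])
    (fun j => by
      rw [← linForm_basis b, hΘ, hev, Finset.sum_range_succ']
      simp) ((mem_invariants b).1 hf x) 1
  refine Eq.trans ?_ key
  have h5 : polyMap b b θ = ((Polynomial.aeval (R := MvPolynomial ι K)
      (1 : MvPolynomial ι K)).restrictScalars K).comp Θ := by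
    refine MvPolynomial.algHom_ext fun i => ?_
    have h6 : ((ad K L x) ^ (N + 1)) (b i) = 0 := by rw [pow_succ, hN, zero_mul]; rfl
    rw [← linForm_basis b, polyMap_linForm, hθ _ _ h6, AlgHom.comp_apply, hΘ]
    change _ = Polynomial.aeval (1 : MvPolynomial ι K) (T (b i))
    rw [Polynomial.coe_aeval_eq_eval, hev]
    simp
  rw [h5]
  rfl

end ExpInvariant

section RootBasis

variable {K L κ : Type*} [Field K] [CharZero K] [LieRing L] [LieAlgebra K L]
  [FiniteDimensional K L] [IsKilling K L] {H : LieSubalgebra K L} [H.IsCartanSubalgebra]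
  [IsTriangularizable K H L]

lemma coe_root_ne_zero (α : H.root) : ((α : Weight K H L) : H → K) ≠ 0 :=
  H.isNonZero_coe_root α

/-- A basis made of root vectors and of the elements of a Cartan subalgebra which represent a
given basis of its dual. -/
structure IsRootBasis (d : Module.Basis κ K (Module.Dual K H))
    (b : Module.Basis (H.root ⊕ κ) K L) : Prop where
  inl_mem : ∀ α : H.root, b (.inl α) ∈ rootSpace H (α : Weight K H L)
  inr_eq : ∀ j, b (.inr j) = ((cartanEquivDual H).symm (d j) : H)

/-- A root as a linear functional. -/
abbrev rootForm (α : H.root) : Module.Dual K H := Weight.toLinear K H L α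

/-- The reflection in a root. -/
def refl (α : H.root) : Module.Dual K H ≃ₗ[K] Module.Dual K H :=
  Module.reflection (x := rootForm α)
    (f := Module.Dual.eval K H (coroot (α : Weight K H L)))
    (root_apply_coroot (H.isNonZero_coe_root α))

lemma refl_apply (α : H.root) (μ : Module.Dual K H) :
    refl α μ = μ - μ (coroot (α : Weight K H L)) • rootForm α := rfl

variable {d : Module.Basis κ K (Module.Dual K H)} {b : Module.Basis (H.root ⊕ κ) K L}

namespace IsRootBasis

lemma proj_inl (hb : IsRootBasis d b) (α : H.root) : proj H (b (.inl α)) = 0 :=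
  proj_of_mem_rootSpace H (coe_root_ne_zero α) (hb.inl_mem α)

lemma proj_inr (hb : IsRootBasis d b) (j : κ) : proj H (b (.inr j)) = d j := by
  rw [hb.inr_eq, proj_cartanEquivDual_symm]

lemma res_eq (hb : IsRootBasis d b) : res K κ H.root = polyMap b d (proj H) := by
  refine MvPolynomial.algHom_ext fun i => ?_
  rcases i with α | j
  · simp [res, polyMap, hb.proj_inl]
  · simp [res, polyMap, hb.proj_inr]

lemma mem_span_inl [Fintype κ] (hb : IsRootBasis d b) {z : L} (hz : proj H z = 0) :
    z ∈ Submodule.span K (Set.range (b ∘ Sum.inl)) := by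
  classical
  have h1 := b.sum_repr z
  rw [Fintype.sum_sum_type] at h1
  have h2 := hz
  rw [← h1, map_add, map_sum, map_sum] at h2
  simp only [map_smul, hb.proj_inl, hb.proj_inr, smul_zero, Finset.sum_const_zero, zero_add] at h2
  have h3 := Fintype.linearIndependent_iff.1 d.linearIndependent _ h2
  simp only [h3, zero_smul, Finset.sum_const_zero, add_zero] at h1
  rw [← h1]
  exact Submodule.sum_mem _ fun α _ =>
    Submodule.smul_mem _ _ (Submodule.subset_span ⟨α, rfl⟩)

lemma mem_span_inr [Fintype κ] (hb : IsRootBasis d b) (h : H) :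
    (h : L) ∈ Submodule.span K (Set.range (b ∘ Sum.inr)) := by
  have h2 : (h : L) = ((H.toSubmodule.subtype ∘ₗ (cartanEquivDual H).symm.toLinearMap)
      (cartanEquivDual H h)) := by simp
  rw [h2, ← d.sum_repr (cartanEquivDual H h), map_sum]
  refine Submodule.sum_mem _ fun j _ => ?_
  rw [map_smul]
  exact Submodule.smul_mem _ _ (Submodule.subset_span ⟨j, hb.inr_eq j⟩)

lemma inr_mem_rootSpace (hb : IsRootBasis d b) (j : κ) : b (.inr j) ∈ rootSpace H (0 : H → K) := by
  rw [rootSpace_zero_eq, hb.inr_eq]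
  exact SetLike.coe_mem ((cartanEquivDual H).symm (d j))

theorem eq_zero_of_res [Fintype κ] (hb : IsRootBasis d b) {f : MvPolynomial (H.root ⊕ κ) K}
    (hf : f ∈ invariants b) (h0 : res K κ H.root f = 0) : f = 0 := by
  refine eq_zero_of_res_eq_zero b (fun γ => ?_) hf h0
  obtain ⟨y, hy, hne⟩ := exists_killingForm_ne_zero H (hb.inl_mem γ) (b.ne_zero _)
  have h1 := lie_eq_killingForm_smul_of_mem_rootSpace_of_mem_rootSpace_neg (hb.inl_mem γ) hy
  have h2 : ⁅y, b (.inl γ)⁆ = ((-(killingForm K L (b (.inl γ)) y) •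
      (cartanEquivDual H).symm (Weight.toLinear K H L γ) : H) : L) := by
    rw [← lie_skew, h1]
    simp
  refine ⟨y, fun j => hb.mem_span_inl ?_, fun β hβ => hb.mem_span_inl ?_, ?_, ?_⟩
  · refine proj_of_mem_rootSpace H ?_
      (lie_mem_genWeightSpace_of_mem_genWeightSpace hy (hb.inr_mem_rootSpace j))
    simp
  · refine proj_of_mem_rootSpace H ?_
      (lie_mem_genWeightSpace_of_mem_genWeightSpace hy (hb.inl_mem β))
    rw [neg_add_eq_sub, sub_ne_zero]
    exact fun h => hβ (Subtype.ext (DFunLike.coe_injective h))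
  · rw [h2]
    exact hb.mem_span_inr _
  · rw [h2]
    intro h3
    rw [ZeroMemClass.coe_eq_zero, smul_eq_zero, neg_eq_zero] at h3
    have h4 := (LinearEquiv.map_eq_zero_iff _).1 (h3.resolve_left hne)
    exact coe_root_ne_zero γ (funext fun h => LinearMap.congr_fun h4 h)

end IsRootBasis

lemma exists_reflecting_automorphism {ι : Type*} (b : Module.Basis ι K L) (α : H.root) :
    ∃ θ : L →ₗ[K] L, (∀ f ∈ invariants b, polyMap b b θ f = f) ∧
      proj H ∘ₗ θ = (refl α).toLinearMap ∘ₗ proj H := by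
  obtain ⟨h, e, f, t, he, hf⟩ := exists_isSl2Triple_of_weight_isNonZero (H.isNonZero_coe_root α)
  have hh := t.h_eq_coroot (H.isNonZero_coe_root α) he hf
  have hne := LieAlgebra.isNilpotent_ad_of_mem_rootSpace H (coe_root_ne_zero α) he
  have hnf := LieAlgebra.isNilpotent_ad_of_mem_rootSpace H
    (neg_ne_zero.2 (coe_root_ne_zero α)) (neg_mem hf)
  obtain ⟨θ₁, h₁⟩ := exists_exp hne
  obtain ⟨θ₂, h₂⟩ := exists_exp hnf
  have heh : ∀ x : H, ⁅e, (x : L)⁆ = -((α : Weight K H L) x • e) := fun x => by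
    rw [← lie_skew, ← lie_eq_smul_of_mem_rootSpace he x]; rfl
  have hfh : ∀ x : H, ⁅-f, (x : L)⁆ = -((α : Weight K H L) x • f) := fun x => by
    have := lie_eq_smul_of_mem_rootSpace hf x
    rw [neg_lie, lie_skew]
    change ⁅x, f⁆ = _
    rw [this, Pi.neg_apply, neg_smul]
  have ha1 : ∀ x : H, θ₁ x = x - (α : Weight K H L) x • e := fun x => by
    rw [h₁ 2 x (by simp [pow_two, heh])]
    simp [Finset.sum_range_succ, heh, sub_eq_add_neg]
  have ha2 : ∀ x : H, θ₂ x = x - (α : Weight K H L) x • f := fun x => by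
    rw [h₂ 2 x (by rw [pow_two, Module.End.mul_apply, ad_apply, ad_apply, hfh]; simp)]
    simp only [Finset.sum_range_succ, Finset.sum_range_zero, pow_zero, pow_one, ad_apply, hfh]
    simp [sub_eq_add_neg]
  have hfe : ⁅-f, e⁆ = h := by rw [neg_lie, lie_skew, t.lie_e_f]
  have hfhh : ⁅-f, h⁆ = -(2 • f) := by rw [neg_lie, lie_skew, t.lie_h_f_nsmul]
  have ha3 : θ₁ e = e := by
    rw [h₁ 1 e (by simp)]; simp
  have ha4 : θ₂ e = e + h - f := by
    rw [h₂ 3 e (by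
      rw [pow_succ, pow_two]
      simp only [Module.End.mul_apply, ad_apply, hfe, hfhh]; simp)]
    simp only [Finset.sum_range_succ, Finset.sum_range_zero, pow_zero, pow_two, pow_one, ad_apply,
      Module.End.mul_apply, Module.End.one_apply, hfe, hfhh]
    have h2 : ((2 : K)⁻¹) • (2 • f) = f := by
      rw [← Nat.cast_smul_eq_nsmul K, smul_smul]; simp
    simp [Nat.factorial, h2, sub_eq_add_neg]
  let θ : L ≃ₗ⁅K⁆ L := (θ₁.trans θ₂).trans θ₁
  have hθ : ∀ x : H, θ x = ((x - (α : Weight K H L) x • coroot (α : Weight K H L) : H) : L) := by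
    intro x
    change θ₁ (θ₂ (θ₁ x)) = _
    have h5 : θ₁ h = h - (2 : K) • e := by
      rw [hh, ha1, root_apply_coroot (H.isNonZero_coe_root α)]
    rw [ha1, map_sub, map_smul, ha2, ha4, map_sub, map_sub, map_smul, map_smul, map_sub, map_add,
      ha1, ha3, h5]
    push_cast
    rw [← hh]
    module
  refine ⟨θ.toLinearEquiv.toLinearMap, fun p hp => ?_, ?_⟩
  · have h6 : (θ.toLinearEquiv.toLinearMap : L →ₗ[K] L) =
        θ₁.toLinearEquiv.toLinearMap ∘ₗ θ₂.toLinearEquiv.toLinearMap ∘ₗ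
          θ₁.toLinearEquiv.toLinearMap := rfl
    rw [h6, ← polyMap_comp b b b, ← polyMap_comp b b b, AlgHom.comp_apply, AlgHom.comp_apply,
      polyMap_exp_eq b hne (θ := θ₁.toLinearEquiv.toLinearMap) h₁ hp,
      polyMap_exp_eq b hnf (θ := θ₂.toLinearEquiv.toLinearMap) h₂ hp,
      polyMap_exp_eq b hne (θ := θ₁.toLinearEquiv.toLinearMap) h₁ hp]
  · ext z x
    let y : H := x - (α : Weight K H L) x • coroot (α : Weight K H L)
    have hy : θ y = x := by
      have h7 : (α : Weight K H L) y = - (α : Weight K H L) x := by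
        change Weight.toLinear K H L α y = - Weight.toLinear K H L α x
        simp only [y, map_sub, map_smul, Weight.toLinear_apply,
          root_apply_coroot (H.isNonZero_coe_root α), smul_eq_mul]
        ring
      rw [hθ, h7]
      simp [y]
    change killingForm K L (θ z) x = refl α (proj H z) x
    rw [← hy, killingForm_of_equiv_apply, refl_apply]
    change proj H z y = _
    simp only [y, map_sub, map_smul, LinearMap.sub_apply, LinearMap.smul_apply,
      Weight.toLinear_apply, smul_eq_mul]
    ring

/-- Restrictions of invariants to a Cartan subalgebra are fixed by the reflections. -/
theorem IsRootBasis.polyEquiv_refl_res (hb : IsRootBasis d b) (α : H.root)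
    {f : MvPolynomial (H.root ⊕ κ) K} (hf : f ∈ invariants b) :
    polyEquiv d (refl α) (res K κ H.root f) = res K κ H.root f := by
  obtain ⟨θ, h1, h2⟩ := exists_reflecting_automorphism b α
  rw [hb.res_eq]
  conv_rhs => rw [← h1 f hf]
  rw [polyEquiv_apply, ← AlgHom.comp_apply, ← AlgHom.comp_apply, polyMap_comp, polyMap_comp, h2]

end RootBasis

section Representations

variable {K L κ : Type*} [Field K] [CharZero K] [LieRing L] [LieAlgebra K L]
  [FiniteDimensional K L] [IsKilling K L] {H : LieSubalgebra K L} [H.IsCartanSubalgebra]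
  [IsTriangularizable K H L]
  {d : Module.Basis κ K (Module.Dual K H)} {b : Module.Basis (H.root ⊕ κ) K L}

/-- The algebra of restrictions of invariant polynomials to a Cartan subalgebra. -/
def restr (b : Module.Basis (H.root ⊕ κ) K L) : Subalgebra K (MvPolynomial κ K) :=
  (invariants b).map (res K κ H.root)

lemma mem_restr {a : MvPolynomial κ K} :
    a ∈ restr b ↔ ∃ f ∈ invariants b, res K κ H.root f = a := Subalgebra.mem_map

/-- The linear maps which fix all restrictions of invariant polynomials. -/
def fixer (d : Module.Basis κ K (Module.Dual K H)) (b : Module.Basis (H.root ⊕ κ) K L) :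
    Subgroup (Module.Dual K H ≃ₗ[K] Module.Dual K H) where
  carrier := {g | ∀ a ∈ restr b, polyEquiv d g a = a}
  one_mem' a _ := by rw [map_one]; rfl
  mul_mem' {g g'} hg hg' a ha := by
    rw [map_mul, AlgEquiv.mul_apply, hg' a ha, hg a ha]
  inv_mem' {g} hg a ha := by
    rw [map_inv]
    conv_lhs => rw [← hg a ha]
    rw [← AlgEquiv.mul_apply, inv_mul_cancel, AlgEquiv.one_apply]

lemma IsRootBasis.refl_mem_fixer (hb : IsRootBasis d b) (α : H.root) : refl α ∈ fixer d b := by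
  intro a ha
  obtain ⟨f, hf, rfl⟩ := mem_restr.1 ha
  exact hb.polyEquiv_refl_res α hf

variable {n : Type*} [Fintype n] [DecidableEq n]

/-- The elements representing the matrix coefficients through the Killing form. -/
def coeffElt (ρ : L →ₗ[K] Matrix n n K) (p q : n) : L :=
  (LinearMap.BilinForm.toDual (killingForm K L) (killingForm_nondegenerate K L)).symm
    (LinearMap.proj q ∘ₗ LinearMap.proj p ∘ₗ ρ)

lemma killingForm_coeffElt (ρ : L →ₗ[K] Matrix n n K) (p q : n) (z : L) :
    killingForm K L (coeffElt ρ p q) z = ρ z p q := by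
  rw [← LinearMap.BilinForm.toDual_def (killingForm_nondegenerate K L), coeffElt,
    LinearEquiv.apply_symm_apply]
  rfl

lemma lie_coeffElt {ρ : L →ₗ[K] Matrix n n K} (hρ : ∀ x y, ρ ⁅x, y⁆ = ρ x * ρ y - ρ y * ρ x)
    (y : L) (p q : n) : ⁅y, coeffElt ρ p q⁆ =
      ∑ r, (ρ y r q • coeffElt ρ p r - ρ y p r • coeffElt ρ r q) := by
  refine (LinearMap.BilinForm.toDual (killingForm K L)
    (killingForm_nondegenerate K L)).injective (LinearMap.ext fun z => ?_)
  rw [LinearMap.BilinForm.toDual_def, LinearMap.BilinForm.toDual_def]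
  rw [← lie_skew, map_neg, LinearMap.neg_apply, traceForm_apply_lie_apply,
    killingForm_coeffElt, hρ, map_sum, LinearMap.sum_apply, Matrix.sub_apply, Matrix.mul_apply,
    Matrix.mul_apply, neg_sub, ← Finset.sum_sub_distrib]
  refine Finset.sum_congr rfl fun r _ => ?_
  simp only [map_sub, map_smul, LinearMap.sub_apply, LinearMap.smul_apply, killingForm_coeffElt,
    smul_eq_mul]
  ring

theorem IsRootBasis.coeff_prod_mem_restr (hb : IsRootBasis d b) {ρ : L →ₗ[K] Matrix n n K}
    (hρ : ∀ x y, ρ ⁅x, y⁆ = ρ x * ρ y - ρ y * ρ x) {μ : n → Module.Dual K H}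
    (hμ : ∀ h : H, ρ h = Matrix.diagonal fun i => μ i h) (k : ℕ) :
    (∏ i, (Polynomial.X - Polynomial.C (linForm d (μ i)))).coeff k ∈ restr b := by
  let M : Matrix n n (MvPolynomial (H.root ⊕ κ) K) := .of fun p q => linForm b (coeffElt ρ p q)
  have h1 : ∀ y, M.map (adDer b y) = M * (ρ y).map C - (ρ y).map C * M := fun y => by
    ext1 p q
    rw [Matrix.map_apply, Matrix.sub_apply, Matrix.mul_apply, Matrix.mul_apply]
    change adDer b y (linForm b (coeffElt ρ p q)) = _
    rw [adDer_linForm, lie_coeffElt hρ, map_sum, ← Finset.sum_sub_distrib]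
    refine Finset.sum_congr rfl fun r _ => ?_
    simp only [map_sub, map_smul, Matrix.of_apply, Matrix.map_apply, M, smul_eq_C_mul]
    ring
  have h2 : M.charpoly.coeff k ∈ invariants b :=
    (mem_invariants b).2 fun y => derivation_charpoly_coeff _ _ _ (h1 y) k
  refine mem_restr.2 ⟨_, h2, ?_⟩
  have h3 : M.map (res K κ H.root : MvPolynomial (H.root ⊕ κ) K →+* MvPolynomial κ K) =
      Matrix.diagonal fun i => linForm d (μ i) := by
    ext1 p q
    have h4 : proj H (coeffElt ρ p q) = (Matrix.diagonal μ) p q := by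
      ext h
      rw [proj_apply, killingForm_coeffElt, hμ]
      by_cases hpq : p = q
      · subst hpq; simp
      · simp [Matrix.diagonal_apply_ne _ hpq]
    change res K κ H.root (linForm b (coeffElt ρ p q)) = _
    rw [hb.res_eq, polyMap_linForm, h4]
    by_cases hpq : p = q
    · subst hpq; simp
    · simp [Matrix.diagonal_apply_ne _ hpq]
  have h5 := Matrix.charpoly_map M
    (res K κ H.root : MvPolynomial (H.root ⊕ κ) K →+* MvPolynomial κ K)
  rw [h3, Matrix.charpoly_diagonal] at h5
  rw [h5, Polynomial.coeff_map]
  rfl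

theorem IsRootBasis.exists_weight_eq (hb : IsRootBasis d b) {ρ : L →ₗ[K] Matrix n n K}
    (hρ : ∀ x y, ρ ⁅x, y⁆ = ρ x * ρ y - ρ y * ρ x) {μ : n → Module.Dual K H}
    (hμ : ∀ h : H, ρ h = Matrix.diagonal fun i => μ i h)
    {g : Module.Dual K H ≃ₗ[K] Module.Dual K H} (hg : g ∈ fixer d b) (i : n) :
    ∃ k, g (μ i) = μ k := by
  set Q := ∏ i, (Polynomial.X - Polynomial.C (linForm d (μ i))) with hQ
  have h1 : Q.map (polyEquiv d g : MvPolynomial κ K →+* MvPolynomial κ K) = Q := by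
    ext1 k
    rw [Polynomial.coeff_map]
    exact hg _ (hb.coeff_prod_mem_restr hρ hμ k)
  have h2 : Q.eval (linForm d (g (μ i))) = 0 := by
    rw [← h1, ← polyEquiv_linForm]
    refine (Polynomial.eval_map_apply (f := (polyEquiv d g : MvPolynomial κ K →+* MvPolynomial κ K))
      (linForm d (μ i))).trans ?_
    rw [hQ, Polynomial.eval_prod, Finset.prod_eq_zero (Finset.mem_univ i) (by simp), map_zero]
  rw [hQ, Polynomial.eval_prod, Finset.prod_eq_zero_iff] at h2
  obtain ⟨k, -, hk⟩ := h2
  refine ⟨k, linForm_injective d ?_⟩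
  simpa [sub_eq_zero] using hk

/-- The weights of the adjoint representation. -/
def adWeight : H.root ⊕ κ → Module.Dual K H := Sum.elim rootForm 0

lemma lie_rootBasis (hb : IsRootBasis d b) (h : H) (i : H.root ⊕ κ) :
    ⁅(h : L), b i⁆ = adWeight i h • b i := by
  rcases i with α | j
  · exact lie_eq_smul_of_mem_rootSpace (hb.inl_mem α) h
  · exact (lie_eq_smul_of_mem_rootSpace (hb.inr_mem_rootSpace j) h).trans (by simp [adWeight])

variable [Fintype κ] [DecidableEq κ]

/-- The adjoint representation in a basis. -/
def adMatrix (b : Module.Basis n K L) : L →ₗ[K] Matrix n n K :=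
  (LinearMap.toMatrix b b).toLinearMap ∘ₗ (ad K L : L →ₗ[K] Module.End K L)

lemma adMatrix_lie (b : Module.Basis n K L) (x y : L) :
    adMatrix b ⁅x, y⁆ = adMatrix b x * adMatrix b y - adMatrix b y * adMatrix b x := by
  simp only [adMatrix, LinearMap.comp_apply, LinearEquiv.coe_coe]
  rw [← LinearMap.toMatrix_mul, ← LinearMap.toMatrix_mul, ← map_sub]
  congr 1
  ext z
  simp

lemma IsRootBasis.adMatrix_eq [DecidableEq H.root] (hb : IsRootBasis d b) (h : H) :
    adMatrix b h = Matrix.diagonal fun i => adWeight i h := by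
  ext i j
  rw [adMatrix, LinearMap.comp_apply, LinearEquiv.coe_coe, LinearMap.toMatrix_apply]
  change b.repr ⁅(h : L), b j⁆ i = _
  rw [lie_rootBasis hb, map_smul, b.repr_self, Finsupp.smul_apply, Finsupp.single_apply,
    Matrix.diagonal_apply]
  by_cases hij : i = j
  · subst hij; simp
  · simp [hij, Ne.symm hij]

lemma rootForm_ne_zero (α : H.root) : rootForm α ≠ 0 := fun h =>
  coe_root_ne_zero α (funext fun x => LinearMap.congr_fun h x)

lemma rootForm_injective : Function.Injective (rootForm : H.root → Module.Dual K H) :=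
  fun _ _ h => Subtype.ext (DFunLike.coe_injective (funext fun x => LinearMap.congr_fun h x))

theorem IsRootBasis.exists_root_eq (hb : IsRootBasis d b)
    {g : Module.Dual K H ≃ₗ[K] Module.Dual K H} (hg : g ∈ fixer d b) (α : H.root) :
    ∃ β : H.root, g (rootForm α) = rootForm β := by
  classical
  obtain ⟨k, hk⟩ := hb.exists_weight_eq (adMatrix_lie b) hb.adMatrix_eq hg (.inl α)
  rcases k with β | j
  · exact ⟨β, hk⟩
  · exact absurd hk ((LinearEquiv.map_ne_zero_iff g).2 (rootForm_ne_zero α))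

lemma span_rootForm : Submodule.span K (Set.range (rootForm : H.root → Module.Dual K H)) = ⊤ := by
  rw [← span_weight_isNonZero_eq_top K L H]
  congr 1
  ext μ
  constructor
  · rintro ⟨α, rfl⟩
    exact ⟨α, H.isNonZero_coe_root α, rfl⟩
  · rintro ⟨α, hα, rfl⟩
    exact ⟨⟨α, by simpa using hα⟩, rfl⟩

lemma eq_of_rootForm_eq {g g' : Module.Dual K H ≃ₗ[K] Module.Dual K H}
    (h : ∀ α : H.root, g (rootForm α) = g' (rootForm α)) : g = g' :=
  LinearEquiv.toLinearMap_injective (LinearMap.ext_on_range span_rootForm h)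

theorem IsRootBasis.finite_fixer (hb : IsRootBasis d b) : Finite (fixer d b) := by
  choose f hf using fun (g : fixer d b) => hb.exists_root_eq g.2
  refine Finite.of_injective f fun g g' h => Subtype.ext (eq_of_rootForm_eq fun α => ?_)
  rw [hf, hf, h]

end Representations

section HighestWeight

variable {K L κ : Type*} [Field K] [CharZero K] [LieRing L] [LieAlgebra K L]
  [FiniteDimensional K L] [IsKilling K L] {H : LieSubalgebra K L} [H.IsCartanSubalgebra]
  [IsTriangularizable K H L]
  {d : Module.Basis κ K (Module.Dual K H)} {b : Module.Basis (H.root ⊕ κ) K L}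

/-- The vectors obtained from `ω` by applying root vectors on whose roots `φ` is negative, with
their weights. -/
inductive IsLoweredVector {W : Type*} [AddCommGroup W] [Module K W] (b : Module.Basis (H.root ⊕ κ) K L)
    (D : L →ₗ[K] Module.End K W) (φ : Module.Dual K H →+ ℝ) (lam : Module.Dual K H) (ω : W) :
    Module.Dual K H → W → Prop
  | base : IsLoweredVector b D φ lam ω lam ω
  | step {μ : Module.Dual K H} {w : W} (β : H.root) : φ (rootForm β) < 0 →
      IsLoweredVector b D φ lam ω μ w →
      IsLoweredVector b D φ lam ω (rootForm β + μ) (D (b (.inl β)) w)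

variable {W : Type*} [AddCommGroup W] [Module K W] {D : L →ₗ[K] Module.End K W}
  {φ : Module.Dual K H →+ ℝ} {lam : Module.Dual K H} {ω : W}

lemma IsLoweredVector.apply_cartan (hb : IsRootBasis d b)
    (hD : ∀ x y, D ⁅x, y⁆ = D x * D y - D y * D x) (hω : ∀ h : H, D h ω = lam h • ω)
    {μ : Module.Dual K H} {w : W} (hw : IsLoweredVector b D φ lam ω μ w) (h : H) :
    D h w = μ h • w := by
  induction hw with
  | base => exact hω h
  | @step μ w β hβ hw ih =>
    have h1 : D h (D (b (.inl β)) w) = D ⁅(h : L), b (.inl β)⁆ w + D (b (.inl β)) (D h w) := by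
      rw [hD]; simp
    rw [h1, lie_rootBasis hb, map_smul, LinearMap.smul_apply, ih, map_smul, ← add_smul]
    rfl

lemma root_neg_mem (β : H.root) : ∃ γ : H.root, rootForm γ = -rootForm β :=
  ⟨⟨-(β : Weight K H L), by
    have := H.isNonZero_coe_root β
    simpa using this.neg⟩, by ext; simp⟩

lemma IsLoweredVector.sub_mem {μ : Module.Dual K H} {w : W}
    (hw : IsLoweredVector b D φ lam ω μ w) :
    lam - μ ∈ AddSubmonoid.closure (rootForm '' {α : H.root | 0 < φ (rootForm α)}) := by
  induction hw with
  | base => simp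
  | @step μ w β hβ hw ih =>
    obtain ⟨γ, hγ⟩ := root_neg_mem β
    have h1 : lam - (rootForm β + μ) = rootForm γ + (lam - μ) := by rw [hγ]; abel
    rw [h1]
    refine add_mem (AddSubmonoid.subset_closure ⟨γ, ?_, rfl⟩) ih
    change 0 < φ (rootForm γ)
    rw [hγ, map_neg]
    linarith

lemma IsLoweredVector.apply_mem_span [Fintype κ] (hb : IsRootBasis d b)
    (hD : ∀ x y, D ⁅x, y⁆ = D x * D y - D y * D x) (hω : ∀ h : H, D h ω = lam h • ω)
    (hω0 : ∀ β : H.root, 0 ≤ φ (rootForm β) → D (b (.inl β)) ω = 0)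
    {μ : Module.Dual K H} {w : W} (hw : IsLoweredVector b D φ lam ω μ w) (x : L) :
    D x w ∈ Submodule.span K {w | ∃ μ, IsLoweredVector b D φ lam ω μ w} := by
  set N := Submodule.span K {w | ∃ μ, IsLoweredVector b D φ lam ω μ w} with hN
  have hmem : ∀ {μ w}, IsLoweredVector b D φ lam ω μ w → w ∈ N := fun h =>
    Submodule.subset_span ⟨_, h⟩
  have hstep : ∀ β : H.root, φ (rootForm β) < 0 → ∀ v ∈ N, D (b (.inl β)) v ∈ N := by
    intro β hβ v hv
    refine (Submodule.span_le.2 ?_ : N ≤ N.comap (D (b (.inl β)))) hv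
    rintro v ⟨ν, hν⟩
    exact hmem (.step β hβ hν)
  induction hw generalizing x with
  | base =>
    rw [← b.sum_repr x, map_sum, LinearMap.sum_apply]
    refine Submodule.sum_mem _ fun i _ => ?_
    rw [map_smul, LinearMap.smul_apply]
    refine Submodule.smul_mem _ _ ?_
    rcases i with β | j
    · rcases lt_or_ge (φ (rootForm β)) 0 with h | h
      · exact hmem (.step β h .base)
      · rw [hω0 β h]; exact zero_mem _
    · rw [hb.inr_eq, hω]
      exact Submodule.smul_mem _ _ (hmem .base)
  | @step μ w β hβ hw ih =>
    have h1 : D x (D (b (.inl β)) w) = D ⁅x, b (.inl β)⁆ w + D (b (.inl β)) (D x w) := by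
      rw [hD]; simp
    rw [h1]
    exact add_mem (ih _) (hstep β hβ _ (ih _))

/-- Weights of a highest weight module in the orbit of the highest one are below it. -/
theorem IsRootBasis.sub_mem_of_highest [Fintype κ] (hb : IsRootBasis d b)
    (hD : ∀ x y, D ⁅x, y⁆ = D x * D y - D y * D x) (hω : ∀ h : H, D h ω = lam h • ω)
    (hω0 : ∀ β : H.root, 0 ≤ φ (rootForm β) → D (b (.inl β)) ω = 0) (hne : ω ≠ 0)
    {F : Submodule K W} [FiniteDimensional K F] (hωF : ω ∈ F)
    (hF : ∀ x, ∀ w ∈ F, D x w ∈ F) {g : Module.Dual K H ≃ₗ[K] Module.Dual K H}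
    (hg : g ∈ fixer d b) :
    lam - g lam ∈ AddSubmonoid.closure (rootForm '' {α : H.root | 0 < φ (rootForm α)}) := by
  classical
  set S := {w | ∃ μ, IsLoweredVector b D φ lam ω μ w} with hS
  set N := Submodule.span K S with hN
  have hNF : N ≤ F := by
    refine Submodule.span_le.2 ?_
    rintro w ⟨μ, hw⟩
    induction hw with
    | base => exact hωF
    | step β hβ hw ih => exact hF _ _ ih
  have : FiniteDimensional K N := Submodule.finiteDimensional_of_le hNF
  have hstab : ∀ x, ∀ w ∈ N, D x w ∈ N := fun x w hw => by
    refine (Submodule.span_le.2 ?_ : N ≤ N.comap (D x)) hw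
    rintro v ⟨ν, hν⟩
    exact hν.apply_mem_span hb hD hω hω0 x
  let t : Set N := Subtype.val ⁻¹' S
  have ht : ⊤ ≤ Submodule.span K t := by
    rw [← Submodule.map_le_map_iff_of_injective (f := N.subtype) N.injective_subtype,
      Submodule.map_span, Submodule.map_top, Submodule.range_subtype]
    refine Submodule.span_mono fun w hw => ?_
    exact ⟨⟨w, Submodule.subset_span hw⟩, hw, rfl⟩
  let ω' : N := ⟨ω, Submodule.subset_span ⟨lam, .base⟩⟩
  have hs : LinearIndepOn K id ({ω'} : Set N) :=
    LinearIndepOn.singleton (by simpa using fun h => hne (congrArg Subtype.val h))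
  have hst : {ω'} ⊆ t := by
    rintro _ rfl
    exact ⟨lam, .base⟩
  let v := Module.Basis.extendLe hs hst ht
  have hv : ∀ k, v k = k := Module.Basis.extendLe_apply_self hs hst ht
  have hfin : Fintype (hs.extend hst) := FiniteDimensional.fintypeBasisIndex v
  have hex : ∀ k : hs.extend hst, ∃ μ, IsLoweredVector b D φ lam ω μ (v k : W) := fun k => by
    rw [hv]; exact hs.extend_subset hst k.2
  choose μ hμ using hex
  let ρ₀ : L →ₗ[K] Module.End K N :=
    { toFun := fun x => (D x).restrict (hstab x)
      map_add' := fun x y => by ext; simp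
      map_smul' := fun c x => by ext; simp }
  let ρ : L →ₗ[K] Matrix (hs.extend hst) (hs.extend hst) K :=
    (LinearMap.toMatrix v v).toLinearMap ∘ₗ ρ₀
  have hρ : ∀ x y, ρ ⁅x, y⁆ = ρ x * ρ y - ρ y * ρ x := fun x y => by
    simp only [ρ, LinearMap.comp_apply, LinearEquiv.coe_coe]
    rw [← LinearMap.toMatrix_mul, ← LinearMap.toMatrix_mul, ← map_sub]
    congr 1
    ext w
    simp [ρ₀, hD]
  have hdiag : ∀ h : H, ρ h = Matrix.diagonal fun i => μ i h := fun h => by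
    ext i j
    have h1 : ρ₀ h (v j) = μ j h • v j := Subtype.ext ((hμ j).apply_cartan hb hD hω h)
    rw [LinearMap.comp_apply, LinearEquiv.coe_coe, LinearMap.toMatrix_apply, h1, map_smul,
      v.repr_self, Finsupp.smul_apply, Finsupp.single_apply, Matrix.diagonal_apply]
    by_cases hij : i = j
    · subst hij; simp
    · simp [hij, Ne.symm hij]
  let i₀ : hs.extend hst := ⟨ω', hs.subset_extend hst rfl⟩
  have hi₀ : μ i₀ = lam := by
    ext h
    have h1 := (hμ i₀).apply_cartan hb hD hω h
    rw [hv] at h1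
    have h2 : D h ω = μ i₀ h • ω := h1
    rw [hω h] at h2
    exact (smul_left_injective K hne h2).symm
  obtain ⟨k, hk⟩ := hb.exists_weight_eq hρ hdiag hg i₀
  rw [hi₀] at hk
  rw [hk]
  exact (hμ k).sub_mem

end HighestWeight

section PolarDerivation

variable {K L ι I : Type*} [Field K] [LieRing L] [LieAlgebra K L]

/-- Linear forms in one of several copies of the variables. -/
def polarForm (b : Module.Basis ι K L) (i : I) : L →ₗ[K] MvPolynomial (I × ι) K :=
  (rename (Prod.mk i)).toLinearMap ∘ₗ linForm b

lemma polarForm_basis (b : Module.Basis ι K L) (i : I) (j : ι) :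
    polarForm b i (b j) = X (i, j) := by
  simp [polarForm]

lemma polarForm_isHomogeneous (b : Module.Basis ι K L) (i : I) (z : L) :
    (polarForm b i z).IsHomogeneous 1 :=
  (linForm_isHomogeneous b z).rename_isHomogeneous

/-- The adjoint action on polynomials in several copies of the variables. -/
def polarDer (b : Module.Basis ι K L) (I : Type*) (x : L) :
    Derivation K (MvPolynomial (I × ι) K) (MvPolynomial (I × ι) K) :=
  mkDerivation K fun p => polarForm b p.1 ⁅x, b p.2⁆

lemma polarDer_polarForm (b : Module.Basis ι K L) (x z : L) (i : I) :
    polarDer b I x (polarForm b i z) = polarForm b i ⁅x, z⁆ := by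
  have : (polarDer b I x).toLinearMap ∘ₗ polarForm b i =
      polarForm b i ∘ₗ LieAlgebra.ad K L x := by
    refine b.ext fun j => ?_
    simp [polarForm_basis, polarDer, mkDerivation_X]
  exact LinearMap.congr_fun this z

lemma polarDer_X (b : Module.Basis ι K L) (x : L) (p : I × ι) :
    polarDer b I x (X p) = polarForm b p.1 ⁅x, b p.2⁆ :=
  mkDerivation_X _ _ _

/-- The adjoint action on polynomials in several copies of the variables, as a linear map. -/
def polarAction (b : Module.Basis ι K L) (I : Type*) :
    L →ₗ[K] Module.End K (MvPolynomial (I × ι) K) where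
  toFun x := (polarDer b I x).toLinearMap
  map_add' x y := by
    have : polarDer b I (x + y) = polarDer b I x + polarDer b I y :=
      derivation_ext fun p => by simp [polarDer_X]
    rw [this]; rfl
  map_smul' c x := by
    have : polarDer b I (c • x) = c • polarDer b I x :=
      derivation_ext fun p => by simp [polarDer_X]
    rw [this]; rfl

lemma polarAction_apply (b : Module.Basis ι K L) (x : L) (f : MvPolynomial (I × ι) K) :
    polarAction b I x f = polarDer b I x f := rfl

lemma polarAction_lie (b : Module.Basis ι K L) (x y : L) :
    polarAction b I ⁅x, y⁆ =
      polarAction b I x * polarAction b I y - polarAction b I y * polarAction b I x := by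
  have : polarDer b I ⁅x, y⁆ = ⁅polarDer b I x, polarDer b I y⁆ :=
    derivation_ext fun p => by
      rw [Derivation.commutator_apply, polarDer_X, polarDer_X, polarDer_X, polarDer_polarForm,
        polarDer_polarForm, lie_lie, map_sub]
  refine LinearMap.ext fun f => ?_
  change polarDer b I ⁅x, y⁆ f = _
  rw [this, Derivation.commutator_apply]
  rfl

end PolarDerivation

section PosSum

variable {K L κ : Type*} [Field K] [CharZero K] [LieRing L] [LieAlgebra K L]
  [FiniteDimensional K L] [IsKilling K L] {H : LieSubalgebra K L} [H.IsCartanSubalgebra]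
  [IsTriangularizable K H L]
  {d : Module.Basis κ K (Module.Dual K H)} {b : Module.Basis (H.root ⊕ κ) K L}

lemma IsRootBasis.adWeight_eq (hb : IsRootBasis d b) {χ : H → K} {z : L}
    (hz : z ∈ rootSpace H χ) {i : H.root ⊕ κ} (hi : b.repr z i ≠ 0) (h : H) :
    adWeight i h = χ h := by
  classical
  have h1 : b.repr ⁅(h : L), z⁆ i = χ h * b.repr z i := by
    have h2 : ⁅(h : L), z⁆ = χ h • z := lie_eq_smul_of_mem_rootSpace hz h
    rw [h2, map_smul]
    rfl
  have h3 : b.repr ⁅(h : L), z⁆ i = adWeight i h * b.repr z i := by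
    have h4 : (b.coord i) ∘ₗ (ad K L h : L →ₗ[K] L) = adWeight i h • b.coord i := by
      refine b.ext fun j => ?_
      change b.repr ⁅(h : L), b j⁆ i = adWeight i h • b.repr (b j) i
      rw [lie_rootBasis hb, map_smul, b.repr_self, Finsupp.smul_apply, Finsupp.single_apply]
      split_ifs with hij
      · rw [hij]
      · simp
    exact LinearMap.congr_fun h4 z
  exact mul_right_cancel₀ hi (h3.symm.trans h1)

theorem IsRootBasis.posSum_sub_mem [Fintype κ] (hb : IsRootBasis d b)
    {g : Module.Dual K H ≃ₗ[K] Module.Dual K H} (hg : g ∈ fixer d b) (φ : Module.Dual K H →+ ℝ) :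
    (∑ α : {α : H.root // 0 < φ (rootForm α)}, rootForm α.1) -
      g (∑ α : {α : H.root // 0 < φ (rootForm α)}, rootForm α.1) ∈
      AddSubmonoid.closure (rootForm '' {α : H.root | 0 < φ (rootForm α)}) := by
  classical
  let I := {α : H.root // 0 < φ (rootForm α)}
  let M : Matrix I I (MvPolynomial (I × (H.root ⊕ κ)) K) :=
    .of fun α i => polarForm b i (b (.inl α.1))
  have hM : ∀ α i, M α i = X (i, .inl α.1) := fun α i => polarForm_basis b i _
  have hder : ∀ x α i, (M.map (polarDer b I x)) α i = polarForm b i ⁅x, b (.inl α.1)⁆ :=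
    fun x α i => polarDer_polarForm b x _ i
  have : FiniteDimensional K (homogeneousSubmodule (I × (H.root ⊕ κ)) K (Fintype.card I)) :=
    Module.Finite.iff_fg.2 (homogeneousSubmodule_fg _ _ _)
  refine hb.sub_mem_of_highest (D := polarAction b I) (ω := M.det) (φ := φ)
    (F := homogeneousSubmodule (I × (H.root ⊕ κ)) K (Fintype.card I))
    (polarAction_lie b) (fun h => ?_) (fun β hβ => ?_) ?_ ?_ ?_ hg
  · rw [polarAction_apply, derivation_det _ M (Matrix.diagonal fun α => C (rootForm α.1 h)),
      Matrix.trace_diagonal, LinearMap.sum_apply, ← map_sum, smul_eq_C_mul]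
    ext1 α i
    rw [hder, lie_rootBasis hb, Matrix.diagonal_mul, map_smul, smul_eq_C_mul]
    rfl
  · let N : Matrix I I K := .of fun α γ => b.repr ⁅b (.inl β), b (.inl α.1)⁆ (.inl γ.1)
    have hmem : ∀ α : I, ⁅b (.inl β), b (.inl α.1)⁆ ∈ rootSpace H
        (((β : Weight K H L) : H → K) + ((α.1 : Weight K H L) : H → K)) := fun α =>
      lie_mem_genWeightSpace_of_mem_genWeightSpace (hb.inl_mem β) (hb.inl_mem α.1)
    have hw : ∀ (α : I) i, b.repr ⁅b (.inl β), b (.inl α.1)⁆ i ≠ 0 →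
        adWeight i = rootForm β + rootForm α.1 := fun α i hi =>
      LinearMap.ext fun h => hb.adWeight_eq (hmem α) hi h
    rw [polarAction_apply, derivation_det _ M (N.map C), Matrix.trace,
      Finset.sum_eq_zero, zero_mul]
    · intro α _
      rw [Matrix.diag_apply, Matrix.map_apply, C_eq_zero]
      by_contra hne
      have h1 : rootForm α.1 = rootForm β + rootForm α.1 := hw α (.inl α.1) hne
      exact rootForm_ne_zero β (right_eq_add.1 h1)
    · ext1 α i
      rw [hder, Matrix.mul_apply]
      conv_lhs => rw [← b.sum_repr ⁅b (.inl β), b (.inl α.1)⁆, map_sum]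
      refine (Fintype.sum_of_injective (fun γ : I => (Sum.inl γ.1 : H.root ⊕ κ))
        (fun γ γ' h => Subtype.ext (Sum.inl_injective h)) _ _ ?_ ?_).symm
      · intro k hk
        have h0 : b.repr ⁅b (.inl β), b (.inl α.1)⁆ k = 0 := by
          by_contra hne
          have h1 := congrArg φ (hw α k hne)
          have h2 := α.2
          rw [map_add] at h1
          rcases k with γ | j
          · exact hk ⟨⟨γ, by change φ (rootForm γ) = _ at h1; linarith⟩, rfl⟩
          · change φ 0 = _ at h1
            rw [map_zero] at h1
            linarith
        rw [h0, zero_smul, map_zero]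
      · intro γ
        rw [map_smul, smul_eq_C_mul]
        rfl
  · intro h0
    have h1 := congrArg (aeval (R := K) (fun p : I × (H.root ⊕ κ) =>
      if p.2 = .inl p.1.1 then (1 : K) else 0)) h0
    rw [map_zero, AlgHom.map_det] at h1
    have h2 : (aeval (R := K) (fun p : I × (H.root ⊕ κ) =>
      if p.2 = .inl p.1.1 then (1 : K) else 0)).mapMatrix M = 1 := by
      ext α i
      rw [AlgHom.mapMatrix_apply, Matrix.map_apply, hM, aeval_X, Matrix.one_apply]
      simp only [Sum.inl.injEq, Subtype.val_inj]
    rw [h2, Matrix.det_one] at h1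
    exact one_ne_zero h1
  · rw [mem_homogeneousSubmodule, Matrix.det_apply]
    refine IsHomogeneous.sum _ _ _ fun σ _ => ?_
    rw [Units.smul_def, ← Int.cast_smul_eq_zsmul K, smul_eq_C_mul, ← zero_add (Fintype.card I)]
    refine (isHomogeneous_C _ _).mul ?_
    have := IsHomogeneous.prod Finset.univ (fun i => M (σ i) i) (fun _ => 1) fun i _ => by
      rw [hM]; exact isHomogeneous_X _ _
    simpa using this
  · intro x w hw
    rw [mem_homogeneousSubmodule] at hw ⊢
    exact derivation_isHomogeneous _ (fun p => by
      rw [polarDer_X]; exact polarForm_isHomogeneous b _ _) hw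

end PosSum

section Weyl

lemma exists_addMonoidHom_ne_zero {K V ι : Type*} [Field K] [CharZero K] [AddCommGroup V]
    [Module K V] [Finite ι] (v : ι → V) (hv : ∀ i, v i ≠ 0) : ∃ x : V →+ ℝ, ∀ i, x (v i) ≠ 0 := by
  let _ : Module ℚ V := Module.compHom V (algebraMap ℚ K)
  obtain ⟨f, hf⟩ := Module.exists_dual_forall_apply_ne_zero (K := ℚ) v hv
  exact ⟨(Rat.castHom ℝ).toAddMonoidHom.comp f.toAddMonoidHom, fun i => by simpa using hf i⟩

variable {K L κ : Type*} [Field K] [CharZero K] [LieRing L] [LieAlgebra K L]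
  [FiniteDimensional K L] [IsKilling K L] {H : LieSubalgebra K L} [H.IsCartanSubalgebra]
  [IsTriangularizable K H L] [Fintype κ]
  {d : Module.Basis κ K (Module.Dual K H)} {b : Module.Basis (H.root ⊕ κ) K L}

lemma exists_intCast_eq (α β : H.root) :
    ∃ m : ℤ, (m : K) = rootForm β (coroot (α : Weight K H L)) :=
  ⟨_, (apply_coroot_eq_cast (α : Weight K H L) (β : Weight K H L)).symm⟩

theorem IsRootBasis.mem_closure_refl (hb : IsRootBasis d b)
    {g : Module.Dual K H ≃ₗ[K] Module.Dual K H} (hg : g ∈ fixer d b) :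
    g ∈ Subgroup.closure (Set.range (refl : H.root → _)) := by
  classical
  choose c hc using exists_intCast_eq (H := H)
  let Φ : Finset (Module.Dual K H) := Finset.univ.image rootForm
  have hΦ : ∀ {p : Module.Dual K H → Prop}, (∀ α ∈ Φ, p α) ↔ ∀ α : H.root, p (rootForm α) := by
    simp [Φ]
  let s : Module.Dual K H → (Module.Dual K H ≃ₗ[K] Module.Dual K H) :=
    Function.extend rootForm refl 1
  let n : Module.Dual K H → Module.Dual K H → ℤ :=
    Function.extend rootForm (fun α => Function.extend rootForm (c α) 0) 0
  have hs : ∀ α : H.root, s (rootForm α) = refl α := fun α =>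
    rootForm_injective.extend_apply _ _ α
  have hn : ∀ α β : H.root, n (rootForm α) (rootForm β) = c α β := fun α β => by
    simp only [n]
    rw [rootForm_injective.extend_apply, rootForm_injective.extend_apply]
  have hself : ∀ α : H.root, rootForm α (coroot (α : Weight K H L)) = 2 := fun α =>
    root_apply_coroot (H.isNonZero_coe_root α)
  obtain ⟨x, hx⟩ := exists_addMonoidHom_ne_zero (K := K)
    (Sum.elim (rootForm : H.root → _)
      fun p : {p : H.root × H.root // p.1 ≠ p.2} => rootForm p.1.1 - rootForm p.1.2) <| by
    rintro (α | p)
    · exact rootForm_ne_zero α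
    · exact sub_ne_zero.2 fun h => p.2 (rootForm_injective h)
  have key : ∃ w ∈ Subgroup.closure (s '' Φ), ∀ β ∈ Φ, g (w β) = β := by
    refine exists_mem_closure_reflections (Φ := Φ) (G := fixer d b) (s := s) (n := n)
      (x := x) (fun g hg => hΦ.2 fun α => ?_) (hΦ.2 fun α => ?_) (hΦ.2 fun α => ?_)
      (hΦ.2 fun α => hΦ.2 fun β => ?_) (hΦ.2 fun α => ?_)
      (hΦ.2 fun α => hΦ.2 fun β => ?_) (hΦ.2 fun α => hx (.inl α)) ?_ (fun g hg y => ?_) hg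
    · obtain ⟨β, hβ⟩ := hb.exists_root_eq hg α
      simp [Φ, hβ]
    · obtain ⟨β, hβ⟩ := root_neg_mem α
      exact Finset.mem_image.2 ⟨β, Finset.mem_univ _, hβ⟩
    · rw [hs]
      exact hb.refl_mem_fixer α
    · rw [hs, hn, refl_apply, ← hc]
      exact congrArg _ (LinearMap.ext fun h => by simp)
    · rw [hn]
      exact Int.cast_injective (α := K) (by rw [hc, hself]; norm_num)
    · rw [hs]
      obtain ⟨γ, hγ⟩ := hb.exists_root_eq (hb.refl_mem_fixer α) β
      rw [hγ, hn, hn]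
      refine Int.cast_injective (α := K) ?_
      rw [Int.cast_neg, hc, hc, ← hγ, refl_apply, LinearMap.sub_apply, LinearMap.smul_apply, hself,
        smul_eq_mul]
      ring
    · intro v hv v' hv' h
      obtain ⟨α, -, rfl⟩ := Finset.mem_image.1 hv
      obtain ⟨β, -, rfl⟩ := Finset.mem_image.1 hv'
      by_contra hne
      refine hx (.inr ⟨(α, β), fun h => hne (congrArg rootForm h)⟩) ?_
      simpa [sub_eq_zero] using h
    · have h1 : posSum Φ y = ∑ α : {α : H.root // 0 < y (rootForm α)}, rootForm α.1 := by
        rw [posSum, Finset.filter_image, Finset.sum_image rootForm_injective.injOn,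
          Finset.sum_subtype (p := fun α : H.root => 0 < y (rootForm α))]
        simp
      have h2 : {α | α ∈ Φ ∧ 0 < y α} = rootForm '' {α : H.root | 0 < y (rootForm α)} := by
        ext v
        constructor
        · rintro ⟨hv, h⟩
          obtain ⟨α, -, rfl⟩ := Finset.mem_image.1 hv
          exact ⟨α, h, rfl⟩
        · rintro ⟨α, h, rfl⟩
          exact ⟨Finset.mem_image_of_mem _ (Finset.mem_univ _), h⟩
      rw [h1, h2]
      exact hb.posSum_sub_mem hg y
  obtain ⟨w, hw, hwg⟩ := key
  have hwc : w ∈ Subgroup.closure (Set.range (refl : H.root → _)) := by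
    refine Subgroup.closure_mono ?_ hw
    rintro _ ⟨α, hα, rfl⟩
    obtain ⟨α, -, rfl⟩ := Finset.mem_image.1 hα
    exact ⟨α, (hs α).symm⟩
  have : g = w⁻¹ := eq_inv_of_mul_eq_one_left (eq_of_rootForm_eq fun α => hΦ.1 hwg α)
  rw [this]
  exact inv_mem hwc

end Weyl

section LinearSubstitution

variable {K ι κ : Type*} [Field K] {u : ι → MvPolynomial κ K}

lemma isHomogeneous_aeval_of_isHomogeneous_one (hu : ∀ i, (u i).IsHomogeneous 1) {n : ℕ}
    {f : MvPolynomial ι K} (hf : f.IsHomogeneous n) : (aeval u f).IsHomogeneous n := by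
  simpa using hf.aeval u hu

lemma homogeneousComponent_aeval (hu : ∀ i, (u i).IsHomogeneous 1) (n : ℕ)
    (f : MvPolynomial ι K) :
    homogeneousComponent n (aeval u f) = aeval u (homogeneousComponent n f) := by
  classical
  conv_lhs => rw [← sum_homogeneousComponent f, map_sum, map_sum]
  rw [Finset.sum_congr rfl fun i _ => homogeneousComponent_of_mem
    (isHomogeneous_aeval_of_isHomogeneous_one hu (homogeneousComponent_isHomogeneous i f)),
    Finset.sum_ite_eq]
  split_ifs with h
  · rfl
  · rw [homogeneousComponent_eq_zero n f (by simpa using h), map_zero]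

lemma totalDegree_aeval_le (hu : ∀ i, (u i).IsHomogeneous 1) (f : MvPolynomial ι K) :
    (aeval u f).totalDegree ≤ f.totalDegree := by
  conv_lhs => rw [← sum_homogeneousComponent f, map_sum]
  refine (totalDegree_finsetSum _ _).trans (Finset.sup_le fun i hi => ?_)
  refine (isHomogeneous_aeval_of_isHomogeneous_one hu
    (homogeneousComponent_isHomogeneous i f)).totalDegree_le.trans ?_
  have := Finset.mem_range.1 hi
  omega

end LinearSubstitution

section Freeness

lemma exists_polyEquiv_sub_eq {K V κ : Type*} [Field K] [AddCommGroup V] [Module K V]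
    (d : Module.Basis κ K V) {g : V ≃ₗ[K] V} {α : V} (hg : ∀ v, ∃ c : K, g v - v = c • α)
    (f : MvPolynomial κ K) : ∃ p, polyEquiv d g f - f = linForm d α * p := by
  induction f using MvPolynomial.induction_on with
  | C a => exact ⟨0, by rw [← algebraMap_eq, AlgEquiv.commutes]; simp⟩
  | add f f' h h' =>
    obtain ⟨p, hp⟩ := h
    obtain ⟨p', hp'⟩ := h'
    exact ⟨p + p', by rw [map_add, mul_add, ← hp, ← hp']; ring⟩
  | mul_X f i h =>
    obtain ⟨p, hp⟩ := h
    obtain ⟨c, hc⟩ := hg (d i)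
    have h1 : polyEquiv d g (X i) - X i = linForm d α * C c := by
      rw [← linForm_basis d, polyEquiv_linForm, ← map_sub, hc, map_smul, smul_eq_C_mul, mul_comm]
    refine ⟨p * polyEquiv d g (X i) + f * C c, ?_⟩
    rw [map_mul]
    linear_combination polyEquiv d g (X i) * hp + f * h1

variable {K L κ : Type*} [Field K] [CharZero K] [LieRing L] [LieAlgebra K L]
  [FiniteDimensional K L] [IsKilling K L] {H : LieSubalgebra K L} [H.IsCartanSubalgebra]
  [IsTriangularizable K H L] [Fintype κ]
  {d : Module.Basis κ K (Module.Dual K H)} {b : Module.Basis (H.root ⊕ κ) K L}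

lemma mem_invariants_of_mul_mem {ι : Type*} (b : Module.Basis ι K L) {f c : MvPolynomial ι K}
    (hf : f ∈ invariants b) (hf0 : f ≠ 0) (hfc : f * c ∈ invariants b) : c ∈ invariants b := by
  rw [mem_invariants] at *
  intro x
  have h := hfc x
  rw [Derivation.leibniz, hf x, smul_zero, add_zero, smul_eq_mul] at h
  exact (mul_eq_zero.1 h).resolve_left hf0

/-- Chevalley's restriction theorem. -/
theorem IsRootBasis.mem_restr_iff (hb : IsRootBasis d b) (a : MvPolynomial κ K) :
    a ∈ restr b ↔ ∀ α : H.root, polyEquiv d (refl α) a = a := by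
  classical
  refine ⟨fun ha α => hb.refl_mem_fixer α a ha, fun ha => ?_⟩
  have hJ := hb.coeff_prod_mem_restr (adMatrix_lie b) hb.adMatrix_eq
  have hspan : Submodule.span K (Set.range (adWeight : H.root ⊕ κ → Module.Dual K H)) = ⊤ := by
    rw [← top_le_iff, ← span_rootForm]
    refine Submodule.span_mono ?_
    rintro _ ⟨α, rfl⟩
    exact ⟨.inl α, rfl⟩
  have hfix : ∀ g : Module.Dual K H ≃ₗ[K] Module.Dual K H,
      (∀ f ∈ restr b, polyEquiv d g f = f) → polyEquiv d g a = a := fun g hg => by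
    have h : Subgroup.closure (Set.range (refl : H.root → _)) ≤
        (MulAction.stabilizer (MvPolynomial κ K ≃ₐ[K] MvPolynomial κ K) a).comap (polyEquiv d) := by
      rw [Subgroup.closure_le]
      rintro _ ⟨α, rfl⟩
      exact ha α
    exact h (hb.mem_closure_refl (g := g) hg)
  obtain ⟨q, hq, hq0, hqa⟩ := exists_mul_mem_of_fixed (FractionRing (MvPolynomial κ K)) hspan hJ hfix
  exact mem_map_of_isIntegral (fun f hf => hb.eq_zero_of_res hf)
    (fun f hf hf0 c => mem_invariants_of_mul_mem b hf hf0)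
    (isIntegral_of_coeff_mem hspan hJ a) hq hq0 hqa

theorem IsRootBasis.free_center (hb : IsRootBasis d b) :
    Module.Free (Subalgebra.center K (UniversalEnvelopingAlgebra K L))
      (UniversalEnvelopingAlgebra K L) := by
  classical
  have had : Function.Injective (LieAlgebra.ad K L) := by
    intro x y h
    have h1 : x - y ∈ LieAlgebra.center K L := fun z => by
      have h2 := LinearMap.congr_fun h z
      simp only [ad_apply] at h2
      rw [lie_sub, ← lie_skew z x, ← lie_skew z y, h2, sub_self]
    rw [LieAlgebra.center_eq_bot] at h1
    exact sub_eq_zero.1 h1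
  have key : ∃ B : Set (κ →₀ ℕ), ∃ e : Module.Basis B (restr b) (MvPolynomial κ K),
      ∀ m, e m = monomial (m : κ →₀ ℕ) 1 := by
    refine exists_monomial_basis (J := restr b)
      (R := Set.range fun α : H.root => polyEquiv d (refl α))
      (fun a => by rw [hb.mem_restr_iff, Set.forall_mem_range]) (fun a ha n => ?_) ?_
      (Set.forall_mem_range.2 fun α => ⟨linForm d (rootForm α), linForm_isHomogeneous d _,
        (map_ne_zero_iff _ (linForm_injective d)).2 (rootForm_ne_zero α),
        exists_polyEquiv_sub_eq d fun μ => ⟨-μ (coroot (α : Weight K H L)), by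
          rw [refl_apply, neg_smul]; abel⟩⟩)
      (Set.forall_mem_range.2 fun α f =>
        totalDegree_aeval_le (fun i => linForm_isHomogeneous d _) f)
    · obtain ⟨f, hf, rfl⟩ := mem_restr.1 ha
      refine mem_restr.2 ⟨_, homogeneousComponent_mem_invariants b n hf,
        (homogeneousComponent_aeval ?_ n f).symm⟩
      rintro (α | j)
      · exact isHomogeneous_zero _ _ _
      · exact isHomogeneous_X _ _
    · have := hb.finite_fixer
      have h : Subgroup.closure (Set.range fun α : H.root => polyEquiv d (refl α)) ≤
          (fixer d b).map (polyEquiv d) := by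
        rw [Subgroup.closure_le]
        rintro _ ⟨α, rfl⟩
        exact ⟨_, hb.refl_mem_fixer α, rfl⟩
      have : Finite ((fixer d b).map (polyEquiv d)) :=
        ((Set.toFinite (fixer d b : Set (Module.Dual K H ≃ₗ[K] Module.Dual K H))).image
          (polyEquiv d)).to_subtype
      exact Finite.of_injective _ (Subgroup.inclusion_injective h)
  obtain ⟨B, e, he⟩ := key
  exact free_center_of_restriction b had (fun f hf => hb.eq_zero_of_res hf) rfl B e he

end Freeness

end

end Kostant

/-- **Kostant's Theorem, first part.**
Let `𝔤` be a finite-dimensional semisimple Lie algebra over `ℂ`.  Then the universal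
enveloping algebra `U(𝔤)` is free as a module over its center `Z(𝔤)`. -/
theorem universalEnveloping_free_over_center
    (L : Type) [LieRing L] [LieAlgebra ℂ L]
    [FiniteDimensional ℂ L] [LieAlgebra.IsSemisimple ℂ L] :
    Module.Free (Subalgebra.center ℂ (UniversalEnvelopingAlgebra ℂ L))
      (UniversalEnvelopingAlgebra ℂ L) := by
  have : LieAlgebra.IsKilling ℂ L := inferInstance
  obtain ⟨x, hx⟩ := LieAlgebra.exists_isCartanSubalgebra_engel ℂ L
  let H := LieSubalgebra.engel ℂ x
  obtain ⟨b, hb, hb'⟩ := Kostant.exists_root_basis H (Module.finBasis ℂ (Module.Dual ℂ H))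
  exact Kostant.IsRootBasis.free_center ⟨hb, hb'⟩
end

section
/- Let 𝔤 be a finite-dimensional Lie algebra over ℂ and M a 𝔤-module with representation map φ : U(𝔤) → End_ℂ(M). Then the set 𝓛(M,M) of adjointly locally finite endomorphisms of M is a unital ℂ-subalgebra of End_ℂ(M) which is invariant under the maps f ↦ φ(ι(x)) ∘ f and f ↦ f ∘ φ(ι(x)) for every x ∈ 𝔤 (i.e., it is a 𝔤-𝔤-subbimodule), and it contains the image of φ. -/
open UniversalEnvelopingAlgebra

noncomputable section

variable (L : Type) [LieRing L] [LieAlgebra ℂ L]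
variable (M : Type) [AddCommGroup M] [Module ℂ M] [LieRingModule L M] [LieModule ℂ L M]

/-- The representation map `φ : U(𝔤) → End_ℂ(M)` attached to a `𝔤`-module `M`. -/
noncomputable def repMap : UniversalEnvelopingAlgebra ℂ L →ₐ[ℂ] Module.End ℂ M :=
  UniversalEnvelopingAlgebra.lift ℂ (LieModule.toEnd ℂ L M)

/-- `f : End_ℂ(M)` is adjointly locally finite if it lies in a finite-dimensional
subspace invariant under the adjoint action `x · g = φ(ι(x)) ∘ g − g ∘ φ(ι(x))`. -/
def AdLocallyFinite (f : Module.End ℂ M) : Prop :=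
  ∃ W : Submodule ℂ (Module.End ℂ M), FiniteDimensional ℂ W ∧ f ∈ W ∧
    ∀ (x : L), ∀ g ∈ W,
      repMap L M (ι ℂ x) * g - g * repMap L M (ι ℂ x) ∈ W

variable {L M} in
theorem AdLocallyFinite.add {f g : Module.End ℂ M} (hf : AdLocallyFinite L M f)
    (hg : AdLocallyFinite L M g) : AdLocallyFinite L M (f + g) := by
  obtain ⟨V, hV, hfV, hVinv⟩ := hf
  obtain ⟨W, hW, hgW, hWinv⟩ := hg
  refine ⟨V ⊔ W, inferInstance, Submodule.add_mem_sup hfV hgW, fun x k hk => ?_⟩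
  obtain ⟨a, ha, b, hb, rfl⟩ := Submodule.mem_sup.1 hk
  rw [mul_add, add_mul, add_sub_add_comm]
  exact Submodule.add_mem_sup (hVinv x a ha) (hWinv x b hb)

variable {L M} in
/-- The adjoint action is by derivations, so the product of two invariant subspaces is
invariant. -/
theorem AdLocallyFinite.mul {f g : Module.End ℂ M} (hf : AdLocallyFinite L M f)
    (hg : AdLocallyFinite L M g) : AdLocallyFinite L M (f * g) := by
  obtain ⟨V, hV, hfV, hVinv⟩ := hf
  obtain ⟨W, hW, hgW, hWinv⟩ := hg
  refine ⟨V * W, Module.Finite.iff_fg.2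
    ((Module.Finite.iff_fg.1 hV).mul (Module.Finite.iff_fg.1 hW)),
    Submodule.mul_mem_mul hfV hgW, fun x k hk => ?_⟩
  induction hk using Submodule.mul_induction_on' with
  | mem_mul_mem a ha b hb =>
    have leibniz (p : Module.End ℂ M) :
        p * (a * b) - a * b * p = (p * a - a * p) * b + a * (p * b - b * p) := by
      noncomm_ring
    rw [leibniz]
    exact add_mem (Submodule.mul_mem_mul (hVinv x a ha) hb)
      (Submodule.mul_mem_mul ha (hWinv x b hb))
  | add a _ b _ iha ihb =>
    rw [mul_add, add_mul, add_sub_add_comm]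
    exact add_mem iha ihb

theorem adLocallyFinite_algebraMap (c : ℂ) :
    AdLocallyFinite L M (algebraMap ℂ (Module.End ℂ M) c) := by
  refine ⟨ℂ ∙ algebraMap ℂ (Module.End ℂ M) c, inferInstance,
    Submodule.mem_span_singleton_self _, fun x g hg => ?_⟩
  obtain ⟨a, rfl⟩ := Submodule.mem_span_singleton.1 hg
  rw [mul_smul_comm, smul_mul_assoc, Algebra.commutes, sub_self]
  exact zero_mem _

theorem repMap_ι (x : L) : repMap L M (ι ℂ x) = LieModule.toEnd ℂ L M x :=
  lift_ι_apply ℂ _ x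

attribute [local instance] LieRing.ofAssociativeRing in
/-- The image of `𝔤` in `End_ℂ(M)` is itself finite-dimensional and invariant. -/
theorem adLocallyFinite_toEnd [FiniteDimensional ℂ L] (x : L) :
    AdLocallyFinite L M (LieModule.toEnd ℂ L M x) := by
  refine ⟨LinearMap.range (LieModule.toEnd ℂ L M : L →ₗ[ℂ] Module.End ℂ M), inferInstance,
    ⟨x, rfl⟩, ?_⟩
  rintro y _ ⟨z, rfl⟩
  rw [repMap_ι]
  exact ⟨⁅y, z⁆, LieHom.map_lie _ y z⟩

/-- The subalgebra `𝓛(M,M)` of adjointly locally finite endomorphisms. -/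
def adLocallyFiniteSubalgebra : Subalgebra ℂ (Module.End ℂ M) where
  carrier := {f | AdLocallyFinite L M f}
  mul_mem' := AdLocallyFinite.mul
  add_mem' := AdLocallyFinite.add
  algebraMap_mem' := adLocallyFinite_algebraMap L M

attribute [local instance] LieRing.ofAssociativeRing in
variable {L} in
/-- An algebra homomorphism out of `U(𝔤)` takes values in any subalgebra containing the image
of `𝔤`. -/
theorem UniversalEnvelopingAlgebra.algHom_mem_of_forall_ι_mem {A : Type*} [Ring A] [Algebra ℂ A]
    (F : UniversalEnvelopingAlgebra ℂ L →ₐ[ℂ] A) (S : Subalgebra ℂ A)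
    (hS : ∀ x : L, F (ι ℂ x) ∈ S) (u : UniversalEnvelopingAlgebra ℂ L) : F u ∈ S := by
  let φ : L →ₗ⁅ℂ⁆ S :=
    { toFun := fun x => ⟨F (ι ℂ x), hS x⟩
      map_add' := fun x y => Subtype.ext (by simp)
      map_smul' := fun c x => Subtype.ext (by simp)
      map_lie' := fun {x y} => Subtype.ext (by simp [LieRing.of_associative_ring_bracket]) }
  have hF : S.val.comp (lift ℂ φ) = F := by
    ext x
    simp [φ]
  rw [← hF]
  exact (lift ℂ φ u).2

/-- The set `𝓛(M,M)` of adjointly locally finite endomorphisms of a `𝔤`-module `M` is a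
unital `ℂ`-subalgebra of `End_ℂ(M)`, it is invariant under left and right composition
with `φ(ι(x))` for every `x ∈ 𝔤` (i.e. it is a `𝔤`-`𝔤`-subbimodule), and it contains the
image of the representation map `φ`. -/
theorem adLocallyFinite_subalgebra_bimodule_contains_image [FiniteDimensional ℂ L] :
    ∃ S : Subalgebra ℂ (Module.End ℂ M),
      (S : Set (Module.End ℂ M)) = {f | AdLocallyFinite L M f} ∧
      (∀ (x : L) (f : Module.End ℂ M), f ∈ S →
        repMap L M (ι ℂ x) * f ∈ S ∧ f * repMap L M (ι ℂ x) ∈ S) ∧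
      (∀ u : UniversalEnvelopingAlgebra ℂ L, repMap L M u ∈ S) := by
  have hι (x : L) : repMap L M (ι ℂ x) ∈ adLocallyFiniteSubalgebra L M := by
    rw [repMap_ι]
    exact adLocallyFinite_toEnd L M x
  exact ⟨adLocallyFiniteSubalgebra L M, rfl,
    fun x f hf => ⟨mul_mem (hι x) hf, mul_mem hf (hι x)⟩,
    algHom_mem_of_forall_ι_mem _ _ hι⟩

end
end

section
/- Let 𝔤 be a nonzero finite-dimensional semisimple Lie algebra over ℂ. Then the center Z(𝔤) of the universal enveloping algebra U(𝔤) is infinite-dimensional as a ℂ-vector space. -/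
section

open Module LieModule LinearMap TensorProduct

attribute [local instance] LieRing.ofAssociativeRing

namespace Module.End

/-- An endomorphism annihilated by a polynomial all of whose roots have norm at most `B` has trace
of norm at most `B` times the dimension. -/
theorem norm_trace_le_of_aeval_eq_zero {V : Type*} [AddCommGroup V] [Module ℂ V]
    [FiniteDimensional ℂ V] (f : End ℂ V) {p : Polynomial ℂ} (hf : Polynomial.aeval f p = 0)
    {B : ℝ} (hB : ∀ μ, p.IsRoot μ → ‖μ‖ ≤ B) :
    ‖trace ℂ V f‖ ≤ finrank ℂ V * B := by
  have hsplit := IsAlgClosed.splits f.charpoly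
  have hcard : f.charpoly.roots.card = finrank ℂ V := by
    rw [← hsplit.natDegree_eq_card_roots, LinearMap.charpoly_natDegree]
  rw [trace_eq_sum_roots_charpoly_of_splits hsplit, ← hcard]
  have hnorm : ∀ s : Multiset ℂ, (∀ μ ∈ s, ‖μ‖ ≤ B) → ‖s.sum‖ ≤ s.card * B := by
    intro s
    induction s using Multiset.induction with
    | empty => simp
    | cons a s ih =>
      intro h
      rw [Multiset.sum_cons, Multiset.card_cons]
      have h₁ := h a (Multiset.mem_cons_self a s)
      have h₂ := ih fun μ hμ ↦ h μ (Multiset.mem_cons_of_mem hμ)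
      push_cast
      linarith [norm_add_le a s.sum]
  refine hnorm _ fun μ hμ ↦ hB μ ?_
  have hμ' : f.HasEigenvalue μ :=
    (hasEigenvalue_iff_isRoot_charpoly f μ).mpr (Polynomial.isRoot_of_mem_roots hμ)
  exact (isRoot_of_hasEigenvalue hμ').dvd (minpoly.dvd ℂ f hf)

end Module.End

namespace UniversalEnvelopingAlgebra

theorem mem_center_of_forall_commute_ι {R L : Type*} [CommRing R] [LieRing L] [LieAlgebra R L]
    {c : UniversalEnvelopingAlgebra R L} (hc : ∀ x : L, Commute (ι R x) c) :
    c ∈ Subalgebra.center R (UniversalEnvelopingAlgebra R L) := by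
  rw [Subalgebra.mem_center_iff]
  intro z
  obtain ⟨t, rfl⟩ : ∃ t, mkAlgHom R L t = z := RingCon.mk'_surjective (c := ringCon R L) z
  change Commute _ _
  induction t using TensorAlgebra.induction with
  | algebraMap r => rw [AlgHom.commutes]; exact Algebra.commutes r c
  | ι x => exact hc x
  | mul a b ha hb => rw [map_mul]; exact ha.mul_left hb
  | add a b ha hb => rw [map_add]; exact ha.add_left hb

end UniversalEnvelopingAlgebra

namespace LieModule

variable {K L : Type*} [Field K] [LieRing L] [LieAlgebra K L]

theorem trace_toEnd_comp_toEnd_tensorProduct {V W : Type*}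
    [AddCommGroup V] [Module K V] [LieRingModule L V] [LieModule K L V] [FiniteDimensional K V]
    [AddCommGroup W] [Module K W] [LieRingModule L W] [LieModule K L W] [FiniteDimensional K W]
    (x y : L) :
    trace K (V ⊗[K] W) (toEnd K L (V ⊗[K] W) x * toEnd K L (V ⊗[K] W) y) =
      trace K V (toEnd K L V x * toEnd K L V y) * finrank K W +
      trace K V (toEnd K L V x) * trace K W (toEnd K L W y) +
      trace K V (toEnd K L V y) * trace K W (toEnd K L W x) +
      finrank K V * trace K W (toEnd K L W x * toEnd K L W y) := by
  have key : toEnd K L (V ⊗[K] W) x * toEnd K L (V ⊗[K] W) y =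
      TensorProduct.map (toEnd K L V x * toEnd K L V y) 1 +
      TensorProduct.map (toEnd K L V x) (toEnd K L W y) +
      TensorProduct.map (toEnd K L V y) (toEnd K L W x) +
      TensorProduct.map 1 (toEnd K L W x * toEnd K L W y) := by
    ext v w
    simp
    abel
  rw [key]
  simp [trace_tensorProduct']

end LieModule

namespace LieAlgebra.IsKilling

variable {K L : Type*} [Field K] [LieRing L] [LieAlgebra K L] [IsKilling K L]

theorem trace_ad_eq_zero [FiniteDimensional K L] (x : L) : trace K L (ad K L x) = 0 := by
  have hnd := killingForm_nondegenerate K L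
  let φ : Dual K L := trace K L ∘ₗ (ad K L : L →ₗ[K] End K L)
  let h : L := (BilinForm.toDual (killingForm K L) hnd).symm φ
  have hh (y : L) : killingForm K L h y = trace K L (ad K L y) :=
    BilinForm.apply_toDual_symm_apply φ y
  have had (y : L) : ⁅h, y⁆ = 0 := by
    refine hnd.1 _ fun z ↦ ?_
    rw [traceForm_apply_lie_apply, hh]
    simp
  have hz : ad K L h = 0 := LinearMap.ext had
  rw [← hh, killingForm_apply_apply, hz]
  simp

variable {ι : Type*} [Fintype ι] [DecidableEq ι] (b : Module.Basis ι K L)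

/-- The basis of `L` dual to `b` with respect to the Killing form. -/
noncomputable def killingDualBasis : Module.Basis ι K L :=
  BilinForm.dualBasis (killingForm K L) (killingForm_nondegenerate K L) b

theorem killingDualBasis_repr (x : L) (i : ι) :
    (killingDualBasis b).repr x i = killingForm K L x (b i) :=
  BilinForm.dualBasis_repr_apply _ _ _ _

theorem repr_eq_killingForm_killingDualBasis (x : L) (i : ι) :
    b.repr x i = killingForm K L x (killingDualBasis b i) := by
  have h := killingDualBasis_repr (killingDualBasis b) x i
  rwa [killingDualBasis, killingDualBasis,
    BilinForm.dualBasis_dualBasis _ ⟨traceForm_comm K L L⟩] at h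

theorem killingForm_basis_killingDualBasis_self (i : ι) :
    killingForm K L (b i) (killingDualBasis b i) = 1 := by
  rw [← repr_eq_killingForm_killingDualBasis]
  simp

/-- The Casimir element of the universal enveloping algebra associated to the Killing form. -/
noncomputable def casimir : UniversalEnvelopingAlgebra K L :=
  ∑ i, UniversalEnvelopingAlgebra.ι K (b i) * UniversalEnvelopingAlgebra.ι K (killingDualBasis b i)

theorem commute_ι_casimir (x : L) :
    Commute (UniversalEnvelopingAlgebra.ι K x) (casimir b) := by
  set e := UniversalEnvelopingAlgebra.ι K (L := L)
  set b' := killingDualBasis b with hb'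
  rw [commute_iff_lie_eq]
  have hleft (i : ι) : e ⁅x, b i⁆ = ∑ j, killingForm K L ⁅x, b i⁆ (b' j) • e (b j) := by
    conv_lhs => rw [← b.sum_repr ⁅x, b i⁆]
    simp [repr_eq_killingForm_killingDualBasis, hb', -UniversalEnvelopingAlgebra.ι_apply]
  have hright (i : ι) : e ⁅x, b' i⁆ = ∑ j, killingForm K L ⁅x, b' i⁆ (b j) • e (b' j) := by
    conv_lhs => rw [← b'.sum_repr ⁅x, b' i⁆]
    simp [killingDualBasis_repr, hb', -UniversalEnvelopingAlgebra.ι_apply]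
  have hterm (i : ι) :
      ⁅e x, e (b i) * e (b' i)⁆ = e ⁅x, b i⁆ * e (b' i) + e (b i) * e ⁅x, b' i⁆ := by
    simp only [LieHom.map_lie, LieRing.of_associative_ring_bracket]
    noncomm_ring
  have hinv (i j : ι) :
      killingForm K L ⁅x, b i⁆ (b' j) = - killingForm K L ⁅x, b' j⁆ (b i) := by
    rw [← lie_skew, map_neg, LinearMap.neg_apply, traceForm_apply_lie_apply,
      traceForm_comm K L L (b i)]
  rw [casimir, lie_sum]
  change ∑ i, ⁅e x, e (b i) * e (b' i)⁆ = 0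
  simp_rw [hterm, hleft, hright, Finset.sum_mul, Finset.mul_sum, Finset.sum_add_distrib]
  rw [Finset.sum_comm, ← Finset.sum_add_distrib]
  refine Finset.sum_eq_zero fun j _ ↦ ?_
  rw [← Finset.sum_add_distrib]
  refine Finset.sum_eq_zero fun i _ ↦ ?_
  rw [hinv]
  simp

theorem lift_toEnd_casimir (V : Type*) [AddCommGroup V] [Module K V] [LieRingModule L V]
    [LieModule K L V] :
    UniversalEnvelopingAlgebra.lift K (toEnd K L V) (casimir b) =
      ∑ i, toEnd K L V (b i) * toEnd K L V (killingDualBasis b i) := by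
  simp only [casimir, map_sum, map_mul, UniversalEnvelopingAlgebra.lift_ι_apply]

/-- The average eigenvalue of the Casimir element on the `(n + 1)`-st tensor power of the adjoint
representation is `n + 1`. -/
theorem exists_trace_casimir_eq {K L : Type} [Field K] [LieRing L] [LieAlgebra K L]
    [FiniteDimensional K L] [IsKilling K L] [Nontrivial L] {ι : Type*} [Fintype ι] [DecidableEq ι]
    (b : Module.Basis ι K L) (n : ℕ) :
    ∃ (V : Type) (_ : AddCommGroup V) (_ : Module K V) (_ : LieRingModule L V)
      (_ : LieModule K L V), FiniteDimensional K V ∧ 0 < finrank K V ∧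
      trace K V (UniversalEnvelopingAlgebra.lift K (toEnd K L V) (casimir b)) =
        (n + 1) * finrank K V := by
  have hadj : ∑ i, trace K L (toEnd K L L (b i) * toEnd K L L (killingDualBasis b i)) =
      finrank K L := by
    rw [finrank_eq_card_basis b, ← Finset.card_univ, Finset.cast_card]
    exact Finset.sum_congr rfl fun i _ ↦ killingForm_basis_killingDualBasis_self b i
  induction n with
  | zero =>
    refine ⟨L, inferInstance, inferInstance, inferInstance, inferInstance, inferInstance,
      finrank_pos, ?_⟩
    rw [lift_toEnd_casimir, map_sum, hadj]
    simp
  | succ n ih =>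
    obtain ⟨V, _, _, _, _, _, hpos, htr⟩ := ih
    refine ⟨V ⊗[K] L, inferInstance, inferInstance, inferInstance, inferInstance, inferInstance,
      ?_, ?_⟩
    · rw [finrank_tensorProduct]
      exact Nat.mul_pos hpos finrank_pos
    · have had (x : L) : trace K L (toEnd K L L x) = 0 := trace_ad_eq_zero x
      rw [lift_toEnd_casimir, map_sum] at htr ⊢
      simp_rw [trace_toEnd_comp_toEnd_tensorProduct, had, mul_zero, add_zero,
        Finset.sum_add_distrib, ← Finset.sum_mul, ← Finset.mul_sum]
      rw [htr, hadj, finrank_tensorProduct]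
      push_cast
      ring

end LieAlgebra.IsKilling

end

/-- For a nonzero finite-dimensional semisimple complex Lie algebra `𝔤`, the center
`Z(𝔤)` of the universal enveloping algebra `U(𝔤)` is infinite-dimensional over `ℂ`. -/
theorem center_of_universalEnveloping_infinite_dimensional
    (L : Type) [LieRing L] [LieAlgebra ℂ L] [FiniteDimensional ℂ L]
    [LieAlgebra.IsSemisimple ℂ L] [Nontrivial L] :
    ¬ FiniteDimensional ℂ (Subalgebra.center ℂ (UniversalEnvelopingAlgebra ℂ L)) := by
  intro hfin
  let b := Module.finBasis ℂ L
  let c : Subalgebra.center ℂ (UniversalEnvelopingAlgebra ℂ L) :=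
    ⟨LieAlgebra.IsKilling.casimir b, UniversalEnvelopingAlgebra.mem_center_of_forall_commute_ι
      (LieAlgebra.IsKilling.commute_ι_casimir b)⟩
  have hint : IsIntegral ℂ c := Algebra.IsIntegral.isIntegral c
  set p := minpoly ℂ c
  have hp0 : p ≠ 0 := minpoly.ne_zero hint
  have hpc : Polynomial.aeval (LieAlgebra.IsKilling.casimir b) p = 0 := by
    have h := congrArg (Subalgebra.center ℂ (UniversalEnvelopingAlgebra ℂ L)).val
      (minpoly.aeval ℂ c)
    rwa [← Polynomial.aeval_algHom_apply, map_zero] at h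
  obtain ⟨B, hB⟩ : ∃ B : ℝ, ∀ μ, p.IsRoot μ → ‖μ‖ ≤ B := by
    obtain ⟨B, hB⟩ := (p.roots.toFinset.image (‖·‖)).bddAbove
    refine ⟨B, fun μ hμ ↦ hB ?_⟩
    simp only [Finset.coe_image, Set.mem_image]
    exact ⟨μ, by simpa [hp0] using hμ, rfl⟩
  obtain ⟨n, hn⟩ := exists_nat_gt B
  obtain ⟨V, _, _, _, _, _, hpos, htr⟩ := LieAlgebra.IsKilling.exists_trace_casimir_eq b n
  have hle := Module.End.norm_trace_le_of_aeval_eq_zero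
    (UniversalEnvelopingAlgebra.lift ℂ (LieModule.toEnd ℂ L V) (LieAlgebra.IsKilling.casimir b))
    (by rw [Polynomial.aeval_algHom_apply, hpc, map_zero]) hB
  have hnorm : ‖((n : ℂ) + 1) * (Module.finrank ℂ V : ℂ)‖ = (n + 1) * Module.finrank ℂ V := by
    exact_mod_cast Complex.norm_natCast ((n + 1) * Module.finrank ℂ V)
  rw [htr, hnorm] at hle
  have hpos' : (0 : ℝ) < Module.finrank ℂ V := by exact_mod_cast hpos
  nlinarith
end
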